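/- Let k be a non-archimedean local field of characteristic ≠ 2, let M be a semi-simple module with M¹ ≠ 0 and F_M(1)·F_M(−1) ≠ 0, and let q be a quadratic space over k with dim(q) = dim_k(M). Then q has an isometry with module M if and only if det(q) = F_M(1)·F_M(−1) in k*/k*². -/

import Mathlib

open Polynomial

noncomputable section

variable {k : Type} [Field k]

/-- `f*(X) = f(0)⁻¹ X^{deg f} f(1/X)`. -/
def starPoly (f : k[X]) : k[X] := Polynomial.C (f.coeff 0)⁻¹ * f.reverse

/-- Type 0 : a product of powers of `X - 1` and `X + 1`. -/
def IsType0Pol (f : k[X]) : Prop := ∃ a b : ℕ, f = (X - 1 : k[X]) ^ a * (X + 1) ^ b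

/-- Type 1 : a product of (powers of) monic symmetric irreducible polynomials of even degree. -/
def IsType1Pol (f : k[X]) : Prop :=
  ∃ s : Multiset k[X],
    (∀ g ∈ s, g.Monic ∧ Irreducible g ∧ g = g.reverse ∧ Even g.natDegree) ∧ f = s.prod

/-- Type 2 : a product of polynomials `g * g*` with `g` monic irreducible, `g ≠ ±g*`. -/
def IsType2Pol (f : k[X]) : Prop :=
  ∃ s : Multiset k[X],
    (∀ g ∈ s, g.Monic ∧ Irreducible g ∧ g ≠ starPoly g ∧ g ≠ -starPoly g) ∧
    f = (s.map fun g => g * starPoly g).prod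

/-- A monic polynomial is hyperbolic if it is of the form `G·G*`; equivalently, all its
components of type 0 and 1 occur with an even exponent. -/
def IsHyperbolicPoly (f : k[X]) : Prop := ∃ g : k[X], g.Monic ∧ f = g * starPoly g

/-- Data describing a self-dual torsion `k[X]`-module which is finite dimensional over `k`:
the direct sum, over `i`, of `[k[X]/(f i ^ e i)]^(n i)`, where each `f i` is monic
irreducible, and where the collection is self-dual (stable under `f ↦ f*`). -/
structure ModuleData (k : Type) [Field k] where
  ι : Type
  [fin : Fintype ι]
  f : ι → k[X]
  e : ι → ℕ
  n : ι → ℕ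
  monic : ∀ i, (f i).Monic
  irr : ∀ i, Irreducible (f i)
  epos : ∀ i, 0 < e i
  npos : ∀ i, 0 < n i
  selfdual : ∃ σ : Equiv.Perm ι,
    ∀ i, f (σ i) = starPoly (f i) ∧ e (σ i) = e i ∧ n (σ i) = n i

attribute [instance] ModuleData.fin

namespace ModuleData

variable (D : ModuleData k)

/-- The underlying `K[X]`-module of `M ⊗_k K`, realised concretely, for an extension
`ι : k →+* K`. -/
abbrev SpaceVia {K : Type} [Field K] (ι : k →+* K) : Type :=
  (i : D.ι) → Fin (D.n i) →
    (Polynomial K ⧸ Ideal.span {((D.f i).map ι) ^ D.e i})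

/-- The dimension of `M` as a `k`-vector space. -/
def dim : ℕ := ∑ i, D.n i * (D.e i * (D.f i).natDegree)

/-- The characteristic polynomial `F_M` of `M`. -/
def charPoly : k[X] := ∏ i, D.f i ^ (D.n i * D.e i)

/-- The summand `i` is of type 0 : `f i` is `X - 1` or `X + 1`. -/
def IsIdx0 (i : D.ι) : Prop := D.f i = X - 1 ∨ D.f i = X + 1

/-- The summand `i` is of type 1 : `f i` is symmetric of even degree. -/
def IsIdx1 (i : D.ι) : Prop := D.f i = (D.f i).reverse ∧ Even (D.f i).natDegree

/-- The summand `i` is of type 2 : `f i` is not self-dual. -/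
def IsIdx2 (i : D.ι) : Prop := D.f i ≠ starPoly (D.f i)

open Classical in
/-- `dim_k M⁰`. -/
def dim0 : ℕ := ∑ i, if D.IsIdx0 i then D.n i * (D.e i * (D.f i).natDegree) else 0

open Classical in
/-- `dim_k M¹`. -/
def dim1 : ℕ := ∑ i, if D.IsIdx1 i then D.n i * (D.e i * (D.f i).natDegree) else 0

open Classical in
/-- `dim_k M²`. -/
def dim2 : ℕ := ∑ i, if D.IsIdx2 i then D.n i * (D.e i * (D.f i).natDegree) else 0

/-- `M` is semi-simple : all exponents are 1. -/
def Semisimple : Prop := ∀ i, D.e i = 1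

/-- `M̄_odd` : the direct sum of the summands `[k[X]/(f)]^n`, over those summands
`[k[X]/(f^e)]^n` of `M` with `e` odd and `f` self-dual (`f = f*`). -/
def oddBar : ModuleData k where
  ι := {i : D.ι // Odd (D.e i) ∧ D.f i = starPoly (D.f i)}
  fin := by classical exact inferInstance
  f i := D.f i.1
  e _ := 1
  n i := D.n i.1
  monic i := D.monic i.1
  irr i := D.irr i.1
  epos _ := one_pos
  npos i := D.npos i.1
  selfdual := ⟨Equiv.refl _, fun i => ⟨i.2.2, rfl, rfl⟩⟩

end ModuleData

theorem starPoly_eq_self_of_symm {f : k[X]} (hm : f.Monic) (hs : f = f.reverse) :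
    starPoly f = f := by
  have h0 : f.coeff 0 = 1 := by
    conv_lhs => rw [hs]
    rw [Polynomial.coeff_zero_reverse]
    exact hm
  rw [starPoly, h0, inv_one, map_one, one_mul, ← hs]

/-- The module `[k[X]/(f)]^m` for a monic symmetric irreducible `f`. -/
def ModuleData.single (f : k[X]) (hmon : f.Monic) (hirr : Irreducible f)
    (hsym : f = f.reverse) (m : ℕ) (hm : 0 < m) : ModuleData k where
  ι := Unit
  fin := inferInstance
  f _ := f
  e _ := 1
  n _ := m
  monic _ := hmon
  irr _ := hirr
  epos _ := one_pos
  npos _ := hm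
  selfdual := ⟨Equiv.refl _, fun _ => ⟨(starPoly_eq_self_of_symm hmon hsym).symm, rfl, rfl⟩⟩

section Bilin

variable {V : Type} [AddCommGroup V] [Module k V]

/-- `t` is an isometry of the bilinear space `(V, B)`. -/
def IsIsometryOf (B : LinearMap.BilinForm k V) (t : V ≃ₗ[k] V) : Prop :=
  ∀ x y, B (t x) (t y) = B x y

/-- `(V, B)` is a quadratic space : `B` is a symmetric bilinear form of non-zero
determinant (equivalently, non-degenerate). -/
def IsQuadraticSpace (B : LinearMap.BilinForm k V) : Prop :=
  (∀ x y, B x y = B y x) ∧ (∀ x, (∀ y, B x y = 0) → x = 0)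

/-- The bilinear space `(W, B)` over an extension `ι : k →+* K` has an isometry whose
associated `K[X]`-module is `M ⊗_k K`. -/
def HasIsometryWithModuleVia {K : Type} [Field K] (ι : k →+* K)
    {W : Type} [AddCommGroup W] [Module K W]
    (B : LinearMap.BilinForm K W) (D : ModuleData k) : Prop :=
  ∃ t : W ≃ₗ[K] W, IsIsometryOf B t ∧
    ∃ φ : W ≃ₗ[K] D.SpaceVia ι, ∀ w, φ (t w) = (X : Polynomial K) • φ w

/-- `(V, B)` has an isometry with module `M`. -/
def HasIsometryWithModule (B : LinearMap.BilinForm k V) (D : ModuleData k) : Prop :=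
  HasIsometryWithModuleVia (RingHom.id k) B D

/-- The bilinear space `(W, B)` over an extension `ι : k →+* K` has an isometry with
minimal polynomial (the image of) `f`. -/
def HasIsometryWithMinpolyVia {K : Type} [Field K] (ι : k →+* K)
    {W : Type} [AddCommGroup W] [Module K W]
    (B : LinearMap.BilinForm K W) (f : k[X]) : Prop :=
  ∃ t : W ≃ₗ[K] W, IsIsometryOf B t ∧ minpoly K t.toLinearMap = f.map ι

/-- `(V, B)` has an isometry with minimal polynomial `f`. -/
def HasIsometryWithMinpoly (B : LinearMap.BilinForm k V) (f : k[X]) : Prop :=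
  ∃ t : V ≃ₗ[k] V, IsIsometryOf B t ∧ minpoly k t.toLinearMap = f

/-- A (2n)-dimensional quadratic space is hyperbolic if it has a self-orthogonal subspace
of dimension n. -/
def IsHyperbolicSpace (B : LinearMap.BilinForm k V) : Prop :=
  ∃ W : Submodule k V, (∀ x ∈ W, ∀ y ∈ W, B x y = 0) ∧
    2 * Module.finrank k W = Module.finrank k V

/-- The Witt index : the largest dimension of a totally isotropic subspace. -/
def wittIndex (B : LinearMap.BilinForm k V) : ℕ :=
  sSup {m | ∃ W : Submodule k V, (∀ x ∈ W, ∀ y ∈ W, B x y = 0) ∧ Module.finrank k W = m}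

variable [FiniteDimensional k V]

/-- The Gram matrix of `B` with respect to a fixed basis. -/
def gramOf (B : LinearMap.BilinForm k V) :
    Matrix (Fin (Module.finrank k V)) (Fin (Module.finrank k V)) k :=
  LinearMap.toMatrix₂ (Module.finBasis k V) (Module.finBasis k V) B

/-- The determinant of `B` (well defined modulo nonzero squares). -/
def detOf (B : LinearMap.BilinForm k V) : k := (gramOf B).det

end Bilin

section LocalFields

open MeasureTheory Metric ComplexConjugate

set_option linter.unusedSectionVars false

/-- `z` is a positive real multiple of `w`. -/
def PosRel (z w : ℂ) : Prop := ∃ r : ℝ, 0 < r ∧ z = r * w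

namespace PosRel

theorem refl (z : ℂ) : PosRel z z := ⟨1, one_pos, by simp⟩

theorem symm {z w : ℂ} (h : PosRel z w) : PosRel w z := by
  obtain ⟨r, hr, rfl⟩ := h
  refine ⟨r⁻¹, inv_pos.2 hr, ?_⟩
  have : (r : ℂ) ≠ 0 := by exact_mod_cast hr.ne'
  push_cast
  field_simp

theorem trans {z w v : ℂ} (h : PosRel z w) (h' : PosRel w v) : PosRel z v := by
  obtain ⟨r, hr, rfl⟩ := h
  obtain ⟨s, hs, rfl⟩ := h'
  exact ⟨r * s, mul_pos hr hs, by push_cast; ring⟩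

theorem mul {z w z' w' : ℂ} (h : PosRel z w) (h' : PosRel z' w') : PosRel (z * z') (w * w') := by
  obtain ⟨r, hr, rfl⟩ := h
  obtain ⟨s, hs, rfl⟩ := h'
  exact ⟨r * s, mul_pos hr hs, by push_cast; ring⟩

theorem star {z w : ℂ} (h : PosRel z w) : PosRel (conj z) (conj w) := by
  obtain ⟨r, hr, rfl⟩ := h
  exact ⟨r, hr, by simp⟩

theorem ne_zero {z w : ℂ} (h : PosRel z w) (hw : w ≠ 0) : z ≠ 0 := by
  obtain ⟨r, hr, rfl⟩ := h
  exact mul_ne_zero (by exact_mod_cast hr.ne') hw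

theorem mul_conj_self {z : ℂ} (hz : z ≠ 0) : PosRel (z * (starRingEnd ℂ) z) 1 := by
  refine ⟨Complex.normSq z, Complex.normSq_pos.2 hz, ?_⟩
  rw [Complex.mul_conj, mul_one]

theorem one_neg_one_absurd (h : PosRel 1 (-1)) : False := by
  obtain ⟨r, hr, h⟩ := h
  have : (1 : ℝ) = r * (-1) := by exact_mod_cast h
  linarith

end PosRel

section GaussVal

variable {V W : Type*} [NormedAddCommGroup V] [MeasurableSpace V] [BorelSpace V]
  [NormedAddCommGroup W] [MeasurableSpace W] [BorelSpace W]

/-- `z` is the stable value of the integral of `f` over large compact subgroups,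
for some choice of Haar measure. -/
def GaussVal (f : V → ℂ) (z : ℂ) : Prop :=
  ∃ μ : Measure V, μ.IsAddHaarMeasure ∧ ∃ C : Set V, IsCompact C ∧
    ∀ S : AddSubgroup V, IsCompact (S : Set V) → C ⊆ S → ∫ x in (S : Set V), f x ∂μ = z

/-- A closed ball centred at the origin of an ultrametric group. -/
def ballSubgroup (V : Type*) [NormedAddCommGroup V] [IsUltrametricDist V] (R : ℝ) (hR : 0 ≤ R) :
    AddSubgroup V where
  carrier := closedBall 0 R
  zero_mem' := by simpa using hR
  add_mem' {a b} ha hb := by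
    simp only [mem_closedBall, dist_zero_right] at *
    exact (IsUltrametricDist.norm_add_le_max a b).trans (max_le ha hb)
  neg_mem' {a} ha := by simpa using ha

@[simp] theorem coe_ballSubgroup [IsUltrametricDist V] (R : ℝ) (hR : 0 ≤ R) :
    (ballSubgroup V R hR : Set V) = closedBall 0 R := rfl

theorem IsCompact.exists_subset_closedBall {C : Set V} (hC : IsCompact C) :
    ∃ R₀ : ℝ, 0 ≤ R₀ ∧ ∀ R, R₀ ≤ R → C ⊆ closedBall 0 R := by
  obtain ⟨R, hR⟩ := hC.isBounded.subset_closedBall 0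
  exact ⟨max R 0, le_max_right _ _, fun R' h =>
    hR.trans (closedBall_subset_closedBall ((le_max_left _ _).trans h))⟩

theorem GaussVal.star {f : V → ℂ} {z : ℂ} (h : GaussVal f z) :
    GaussVal (fun x => conj (f x)) (conj z) := by
  obtain ⟨μ, hμ, C, hC, h⟩ := h
  exact ⟨μ, hμ, C, hC, fun S hS hCS => by rw [integral_conj, h S hS hCS]⟩

theorem GaussVal.comp {g : W → ℂ} {z : ℂ} (h : GaussVal g z) (φ : V ≃+ W)
    (hφ : Continuous φ) (hφ' : Continuous φ.symm) : GaussVal (fun x => g (φ x)) z := by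
  obtain ⟨μ, hμ, C, hC, h⟩ := h
  let e : W ≃ₜ+ V := { φ.symm with continuous_toFun := hφ', continuous_invFun := hφ }
  refine ⟨μ.map e, e.isAddHaarMeasure_map μ, e '' C, hC.image e.continuous, ?_⟩
  intro S hS hCS
  have hm : MeasurableEmbedding e := e.toHomeomorph.measurableEmbedding
  rw [hm.setIntegral_map]
  have := h (S.comap (e : W →+ V)) ?_ ?_
  · rw [← this]
    have he : ∀ x, φ (e x) = x := fun x => φ.apply_symm_apply x
    simp only [he]
    rfl
  · exact e.toHomeomorph.isCompact_preimage.2 hS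
  · intro x hx
    exact hCS ⟨x, hx, rfl⟩

variable [IsUltrametricDist V] [ProperSpace V] [IsUltrametricDist W] [ProperSpace W]

instance instIsUltrametricDistProd {V W : Type*} [PseudoMetricSpace V] [PseudoMetricSpace W]
    [IsUltrametricDist V] [IsUltrametricDist W] : IsUltrametricDist (V × W) where
  dist_triangle_max x y z := by
    simp only [Prod.dist_eq]
    have h1 := dist_triangle_max x.1 y.1 z.1
    have h2 := dist_triangle_max x.2 y.2 z.2
    refine max_le (h1.trans ?_) (h2.trans ?_)
    · exact max_le_max (le_max_left _ _) (le_max_left _ _)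
    · exact max_le_max (le_max_right _ _) (le_max_right _ _)

theorem exists_pos_smul_of_isAddHaarMeasure (μ μ' : Measure V) [μ.IsAddHaarMeasure]
    [μ'.IsAddHaarMeasure] : ∃ c : NNReal, 0 < c ∧ μ = c • μ' :=
  ⟨_, Measure.addHaarScalarFactor_pos_of_isAddHaarMeasure μ μ',
    Measure.isAddLeftInvariant_eq_smul μ μ'⟩

theorem GaussVal.unique {f : V → ℂ} {z z' : ℂ} (h : GaussVal f z) (h' : GaussVal f z') :
    PosRel z z' := by
  obtain ⟨μ, hμ, C, hC, h⟩ := h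
  obtain ⟨μ', hμ', C', hC', h'⟩ := h'
  obtain ⟨R, hR, hR2⟩ := (hC.union hC').exists_subset_closedBall
  have hb : IsCompact (ballSubgroup V R hR : Set V) := isCompact_closedBall 0 R
  have e1 := h (ballSubgroup V R hR) hb (Set.subset_union_left.trans (hR2 R le_rfl))
  have e2 := h' (ballSubgroup V R hR) hb (Set.subset_union_right.trans (hR2 R le_rfl))
  obtain ⟨c, hc0, hc⟩ := exists_pos_smul_of_isAddHaarMeasure μ μ'
  rw [hc, Measure.restrict_smul, integral_smul_nnreal_measure] at e1
  refine ⟨c, hc0, ?_⟩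
  rw [← e1, ← e2]
  rfl

theorem GaussVal.prod {f : V → ℂ} {g : W → ℂ} {z w y : ℂ} (hf : GaussVal f z) (hg : GaussVal g w)
    (hfg : GaussVal (fun p : V × W => f p.1 * g p.2) y) : PosRel y (z * w) := by
  obtain ⟨μ, hμ, C, hC, h⟩ := hf
  obtain ⟨μ', hμ', C', hC', h'⟩ := hg
  obtain ⟨ν, hν, D, hD, hD'⟩ := hfg
  obtain ⟨R, hR, hR2⟩ := hC.exists_subset_closedBall
  obtain ⟨R', hR', hR2'⟩ := hC'.exists_subset_closedBall
  obtain ⟨T, hT, hT2⟩ := hD.exists_subset_closedBall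
  set Q := max T (max R R') with hQ
  have hQ0 : 0 ≤ Q := hT.trans (le_max_left _ _)
  have e1 := h (ballSubgroup V Q hQ0) (isCompact_closedBall 0 Q)
    (hR2 Q (by simp [hQ]))
  have e2 := h' (ballSubgroup W Q hQ0) (isCompact_closedBall 0 Q)
    (hR2' Q (by simp [hQ]))
  have e3 := hD' (ballSubgroup (V × W) Q hQ0) (isCompact_closedBall 0 Q) (hT2 Q (by simp [hQ]))
  obtain ⟨c, hc0, hc⟩ := exists_pos_smul_of_isAddHaarMeasure ν (μ.prod μ')
  rw [hc, Measure.restrict_smul, integral_smul_nnreal_measure] at e3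
  have hs : (ballSubgroup (V × W) Q hQ0 : Set (V × W)) =
      (ballSubgroup V Q hQ0 : Set V) ×ˢ (ballSubgroup W Q hQ0 : Set W) := by
    simp only [coe_ballSubgroup]
    rw [closedBall_prod_same]
    rfl
  rw [hs, setIntegral_prod_mul, e1, e2] at e3
  refine ⟨c, hc0, ?_⟩
  rw [← e3]
  rfl

end GaussVal

section SubgroupIntegral

variable {V : Type*} [NormedAddCommGroup V] [MeasurableSpace V] [BorelSpace V]
  (μ : Measure V) [μ.IsAddHaarMeasure]

theorem setIntegral_add_mem (S : AddSubgroup V) (f : V → ℂ) {z : V} (hz : z ∈ S) :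
    ∫ x in (S : Set V), f (x + z) ∂μ = ∫ x in (S : Set V), f x ∂μ := by
  have h := (measurePreserving_add_right μ z).setIntegral_preimage_emb
    (MeasurableEquiv.addRight z).measurableEmbedding f (S : Set V)
  rw [← h]
  congr 2
  ext x
  simp only [Set.mem_preimage, SetLike.mem_coe]
  exact (S.add_mem_cancel_right hz).symm

theorem setIntegral_addChar_eq_zero (S : AddSubgroup V) (χ : V → ℂ)
    (hχ : ∀ x y, χ (x + y) = χ x * χ y) {z : V} (hz : z ∈ S) (hz1 : χ z ≠ 1) :
    ∫ x in (S : Set V), χ x ∂μ = 0 := by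
  have h := setIntegral_add_mem μ S χ hz
  simp only [hχ, integral_mul_const] at h
  have h' : (∫ x in (S : Set V), χ x ∂μ) * (χ z - 1) = 0 := by rw [mul_sub, h]; ring
  exact (mul_eq_zero.1 h').resolve_right (sub_ne_zero.2 hz1)

theorem setIntegral_addChar_eq_measure {S : Set V} (hS : MeasurableSet S) (χ : V → ℂ)
    (h : ∀ x ∈ S, χ x = 1) :
    ∫ x in S, χ x ∂μ = μ.real S := by
  rw [setIntegral_congr_fun hS h]
  simp

end SubgroupIntegral

/-- A nontrivial locally trivial unitary additive character. -/
structure IsSmoothChar {K : Type*} [NormedField K] (ψ : K → ℂ) : Prop where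
  add : ∀ x y, ψ (x + y) = ψ x * ψ y
  norm : ∀ x, ‖ψ x‖ = 1
  loc : ∃ ε : ℝ, 0 < ε ∧ ∀ x, ‖x‖ ≤ ε → ψ x = 1
  nontriv : ∃ x, ψ x ≠ 1

namespace IsSmoothChar

variable {K : Type*} [NontriviallyNormedField K] {ψ : K → ℂ}

theorem zero (hψ : IsSmoothChar ψ) : ψ 0 = 1 := by
  obtain ⟨ε, hε, h⟩ := hψ.loc
  exact h 0 (by simpa using hε.le)

theorem conj_apply (hψ : IsSmoothChar ψ) (x : K) : (starRingEnd ℂ) (ψ x) = ψ (-x) := by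
  have h1 : ψ x * ψ (-x) = 1 := by rw [← hψ.add, add_neg_cancel, hψ.zero]
  have h2 : ψ x * (starRingEnd ℂ) (ψ x) = 1 := by
    rw [Complex.mul_conj, Complex.normSq_eq_norm_sq, hψ.norm]; simp
  have h0 : ψ x ≠ 0 := by
    intro h; rw [h, zero_mul] at h1; exact zero_ne_one h1
  exact mul_left_cancel₀ h0 (h2.trans h1.symm)

theorem continuous (hψ : IsSmoothChar ψ) : Continuous ψ := by
  obtain ⟨ε, hε, h⟩ := hψ.loc
  refine continuous_iff_continuousAt.2 fun x => ?_
  apply tendsto_nhds_of_eventually_eq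
  filter_upwards [Metric.closedBall_mem_nhds x hε] with y hy
  have : y = x + (y - x) := by ring
  rw [this, hψ.add, h (y - x) (by simpa [dist_eq_norm] using hy), mul_one]

/-- The annihilator of a ball is bounded. -/
theorem bound (hψ : IsSmoothChar ψ) {ε : ℝ} (hε : 0 < ε) :
    ∃ R : ℝ, ∀ t : K, (∀ y, ‖y‖ ≤ ε → ψ (t * y) = 1) → ‖t‖ ≤ R := by
  obtain ⟨x, hx⟩ := hψ.nontriv
  refine ⟨‖x‖ / ε, fun t ht => ?_⟩
  by_contra hlt
  push Not at hlt
  have h0 : 0 < ‖t‖ := (div_nonneg (norm_nonneg _) hε.le).trans_lt hlt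
  have ht0 : t ≠ 0 := norm_pos_iff.1 h0
  apply hx
  have := ht (t⁻¹ * x) (by
    rw [norm_mul, norm_inv, inv_mul_le_iff₀ h0]
    rw [div_lt_iff₀ hε] at hlt
    exact hlt.le)
  rwa [mul_inv_cancel_left₀ ht0] at this

end IsSmoothChar

section Diag

variable {K : Type*} [NontriviallyNormedField K] [IsUltrametricDist K] [ProperSpace K]
  [MeasurableSpace K] [BorelSpace K]

/-- A diagonal quadratic form. -/
def diagForm {K : Type*} [CommSemiring K] {ι : Type*} [Fintype ι] (a : ι → K) (x : ι → K) : K :=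
  ∑ i, a i * x i ^ 2

theorem diagForm_continuous {n : ℕ} (a : Fin n → K) : Continuous (diagForm a) := by
  unfold diagForm; fun_prop

theorem gaussVal_diag_exists {ψ : K → ℂ} (hψ : IsSmoothChar ψ) (h2 : (2 : K) ≠ 0) {n : ℕ}
    (a : Fin n → K) (ha : ∀ i, a i ≠ 0) : ∃ z, GaussVal (fun x => ψ (diagForm a x)) z := by
  classical
  let μ : Measure (Fin n → K) := Measure.addHaar
  obtain ⟨ε, hε, hloc⟩ := hψ.loc
  -- a ball on which `f = 1`
  obtain ⟨δ, hδ, hδ1⟩ : ∃ δ : ℝ, 0 < δ ∧ ∀ x : Fin n → K, ‖x‖ ≤ δ → ψ (diagForm a x) = 1 := by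
    have hc : ContinuousAt (diagForm a) 0 := (diagForm_continuous a).continuousAt
    have h0 : diagForm a 0 = 0 := by simp [diagForm]
    have := hc.preimage_mem_nhds (t := closedBall 0 ε) (by
      rw [h0]; exact closedBall_mem_nhds _ hε)
    obtain ⟨δ, hδ, h⟩ := Metric.nhds_basis_closedBall.mem_iff.1 this
    exact ⟨δ, hδ, fun x hx => hloc _ (by simpa using h (by simpa using hx))⟩
  set U := ballSubgroup (Fin n → K) δ hδ.le with hU
  have hUc : IsCompact (U : Set (Fin n → K)) := isCompact_closedBall 0 δ
  let b : (Fin n → K) → (Fin n → K) → K := fun x z => ∑ i, 2 * a i * x i * z i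
  have hb : ∀ x z, diagForm a (x + z) = diagForm a x + diagForm a z + b x z := by
    intro x z
    simp only [diagForm, b, ← Finset.sum_add_distrib, Pi.add_apply]
    exact Finset.sum_congr rfl fun i _ => by ring
  let P : Set (Fin n → K) := {x | ∀ z ∈ U, ψ (b x z) = 1}
  have hbadd : ∀ x z w, b x (z + w) = b x z + b x w := by
    intro x z w
    simp only [b, ← Finset.sum_add_distrib, Pi.add_apply]
    exact Finset.sum_congr rfl fun i _ => by ring
  have hbc : Continuous fun p : (Fin n → K) × (Fin n → K) => b p.1 p.2 := by
    simp only [b]; fun_prop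
  have hPclosed : IsClosed P := by
    have : P = ⋂ z ∈ U, {x | ψ (b x z) = 1} := by ext; simp [P]
    rw [this]
    refine isClosed_biInter fun z _ => isClosed_eq ?_ continuous_const
    exact hψ.continuous.comp (hbc.comp (continuous_id.prodMk continuous_const))
  obtain ⟨R, hR⟩ := hψ.bound hδ
  have hPb : ∃ R', ∀ x ∈ P, ‖x‖ ≤ R' := by
    refine ⟨∑ i, |R| / ‖2 * a i‖, fun x hx => ?_⟩
    refine (pi_norm_le_iff_of_nonneg (Finset.sum_nonneg fun i _ => by positivity)).2 fun i => ?_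
    refine le_trans ?_ (Finset.single_le_sum (f := fun i => |R| / ‖2 * a i‖)
      (fun i _ => by positivity) (Finset.mem_univ i))
    have hai : 0 < ‖2 * a i‖ := norm_pos_iff.2 (mul_ne_zero h2 (ha i))
    rw [le_div_iff₀ hai, ← norm_mul]
    refine (hR _ fun y hy => ?_).trans (le_abs_self R)
    have := hx (Pi.single i y) (by
      change Pi.single i y ∈ closedBall (0 : Fin n → K) δ
      simpa [Pi.norm_single] using hy)
    simp only [b] at this
    rw [Finset.sum_eq_single i] at this
    · rw [Pi.single_eq_same] at this
      rw [← this]; congr 1; ring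
    · intro j _ hj; rw [Pi.single_eq_of_ne hj, mul_zero]
    · simp
  obtain ⟨R', hR'⟩ := hPb
  refine ⟨∫ x in P, ψ (diagForm a x) ∂μ, μ, inferInstance, closedBall 0 (max δ R'),
    isCompact_closedBall _ _, fun S hS hCS => ?_⟩
  have hUS : U ≤ S := fun x hx => hCS (closedBall_subset_closedBall (le_max_left _ _) hx)
  have hPS : P ⊆ S := fun x hx => hCS (by simpa using Or.inr (hR' x hx))
  have hμU : 0 < μ.real (U : Set (Fin n → K)) := by
    refine ENNReal.toReal_pos ?_ hUc.measure_lt_top.ne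
    exact (measure_closedBall_pos μ 0 hδ).ne'
  have key : ∀ z ∈ U, ∫ x in (S : Set (Fin n → K)), ψ (diagForm a x) * ψ (b x z) ∂μ
      = ∫ x in (S : Set (Fin n → K)), ψ (diagForm a x) ∂μ := by
    intro z hz
    rw [← setIntegral_add_mem μ S (fun x => ψ (diagForm a x)) (hUS hz)]
    congr 1
    ext x
    have hz' : ‖z‖ ≤ δ := by
      have : z ∈ closedBall (0 : Fin n → K) δ := hz
      simpa using this
    rw [hb, hψ.add, hψ.add, hδ1 z hz', mul_one]
  have hav : ∫ z in (U : Set (Fin n → K)), ∫ x in (S : Set (Fin n → K)),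
      ψ (diagForm a x) * ψ (b x z) ∂μ ∂μ
      = μ.real (U : Set (Fin n → K)) * ∫ x in (S : Set (Fin n → K)), ψ (diagForm a x) ∂μ := by
    rw [setIntegral_congr_fun hUc.measurableSet key]
    simp
  rw [integral_integral_swap] at hav
  · have hin : ∀ x, ∫ z in (U : Set (Fin n → K)), ψ (diagForm a x) * ψ (b x z) ∂μ =
        P.indicator (fun x => μ.real (U : Set (Fin n → K)) * ψ (diagForm a x)) x := by
      intro x
      rw [integral_const_mul]
      by_cases hx : x ∈ P
      · rw [Set.indicator_of_mem hx, setIntegral_addChar_eq_measure μ hUc.measurableSet _ hx,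
          mul_comm]
      · rw [Set.indicator_of_notMem hx]
        have hx' : ∃ z ∈ U, ψ (b x z) ≠ 1 := by simpa [P] using hx
        obtain ⟨z, hz, hz1⟩ := hx'
        rw [setIntegral_addChar_eq_zero μ U (fun z => ψ (b x z))
          (fun z w => by rw [hbadd, hψ.add]) hz hz1, mul_zero]
    simp only [hin] at hav
    rw [setIntegral_indicator hPclosed.measurableSet, Set.inter_eq_self_of_subset_right hPS,
      integral_const_mul] at hav
    exact (mul_left_cancel₀ (by exact_mod_cast hμU.ne') hav).symm
  · rw [Measure.prod_restrict]
    refine ContinuousOn.integrableOn_compact (hUc.prod hS) (Continuous.continuousOn ?_)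
    have h1 : Continuous fun p : (Fin n → K) × (Fin n → K) => ψ (b p.2 p.1) :=
      hψ.continuous.comp (hbc.comp (continuous_snd.prodMk continuous_fst))
    have h2 : Continuous fun p : (Fin n → K) × (Fin n → K) => ψ (diagForm a p.2) :=
      hψ.continuous.comp ((diagForm_continuous a).comp continuous_snd)
    exact h2.mul h1

end Diag

section Gamma

variable {K : Type*} [NontriviallyNormedField K] [IsUltrametricDist K] [ProperSpace K]
  [MeasurableSpace K] [BorelSpace K]

open Classical in
/-- The Gauss integral of `x ↦ ψ (a x²)`. -/
def gaussVal (ψ : K → ℂ) (a : K) : ℂ :=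
  if h : ∃ z, GaussVal (fun x : K => ψ (a * x ^ 2)) z then h.choose else 0

variable {ψ : K → ℂ}

theorem gaussVal_spec (hψ : IsSmoothChar ψ) (h2 : (2 : K) ≠ 0) {a : K} (ha : a ≠ 0) :
    GaussVal (fun x : K => ψ (a * x ^ 2)) (gaussVal ψ a) := by
  have h : ∃ z, GaussVal (fun x : K => ψ (a * x ^ 2)) z := by
    obtain ⟨z, hz⟩ := gaussVal_diag_exists hψ h2 (fun _ : Fin 1 => a) (fun _ => ha)
    refine ⟨z, ?_⟩
    let φ : K ≃+ (Fin 1 → K) :=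
      { toFun := fun x _ => x, invFun := fun x => x 0, left_inv := fun x => rfl,
        right_inv := fun x => by ext i; rw [Subsingleton.elim i 0],
        map_add' := fun x y => rfl }
    have := hz.comp φ (continuous_pi fun _ => continuous_id) (continuous_apply 0)
    convert this using 3 with x
    simp [diagForm, φ]
  rw [gaussVal, dif_pos h]
  exact h.choose_spec

theorem gaussVal_neg (hψ : IsSmoothChar ψ) (h2 : (2 : K) ≠ 0)
    {a : K} (ha : a ≠ 0) : PosRel (gaussVal ψ (-a)) (conj (gaussVal ψ a)) := by
  refine GaussVal.unique (gaussVal_spec hψ h2 (neg_ne_zero.2 ha)) ?_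
  convert (gaussVal_spec hψ h2 ha).star using 2 with x
  rw [hψ.conj_apply, neg_mul]

theorem GaussVal.posRel_prod (hψ : IsSmoothChar ψ) (h2 : (2 : K) ≠ 0)
    {n : ℕ} (a : Fin n → K) (ha : ∀ i, a i ≠ 0) {z : ℂ}
    (hz : GaussVal (fun x => ψ (diagForm a x)) z) : PosRel z (∏ i, gaussVal ψ (a i)) := by
  induction n generalizing z with
  | zero =>
    obtain ⟨μ, hμ, C, hC, h⟩ := hz
    have := h ⊤ (Set.toFinite _).isCompact (Set.subset_univ _)
    simp only [diagForm, Finset.univ_eq_empty, Finset.sum_empty, hψ.zero,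
      AddSubgroup.coe_top, Measure.restrict_univ] at this
    simp only [Finset.univ_eq_empty, Finset.prod_empty]
    refine ⟨μ.real Set.univ, ?_, ?_⟩
    · refine ENNReal.toReal_pos ?_ (Set.toFinite (Set.univ : Set (Fin 0 → K))).isCompact.measure_lt_top.ne
      exact (isOpen_univ.measure_pos μ Set.univ_nonempty).ne'
    · rw [← this]; simp
  | succ n ih =>
    obtain ⟨w, hw⟩ := gaussVal_diag_exists hψ h2 (fun i : Fin n => a i.succ) (fun i => ha _)
    rw [Fin.prod_univ_succ]
    refine PosRel.trans ?_ (PosRel.mul (PosRel.refl _) (ih _ (fun i => ha _) hw))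
    let φ : (K × (Fin n → K)) ≃+ (Fin (n + 1) → K) :=
      { toFun := fun p => Fin.cons p.1 p.2
        invFun := fun x => (x 0, fun i => x i.succ)
        left_inv := fun p => by simp
        right_inv := fun x => by ext i; refine Fin.cases ?_ (fun i => ?_) i <;> simp
        map_add' := fun x y => by ext i; refine Fin.cases ?_ (fun i => ?_) i <;> simp }
    have h := hz.comp φ (by
      refine continuous_pi fun i => ?_
      refine Fin.cases ?_ (fun i => ?_) i
      · exact continuous_fst
      · exact (continuous_apply i).comp continuous_snd) (by
      refine Continuous.prodMk (continuous_apply 0) (continuous_pi fun i => continuous_apply _))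
    refine (gaussVal_spec hψ h2 (ha 0)).prod hw ?_
    convert h using 2 with p
    rw [← hψ.add]
    congr 1
    simp [diagForm, Fin.sum_univ_succ, φ]

theorem gaussVal_prod_eq_of_equiv (hψ : IsSmoothChar ψ) (h2 : (2 : K) ≠ 0)
    {n m : ℕ} {a : Fin n → K} {b : Fin m → K} (ha : ∀ i, a i ≠ 0)
    (hb : ∀ i, b i ≠ 0) (φ : (Fin n → K) ≃ₗ[K] (Fin m → K))
    (h : ∀ x, diagForm b (φ x) = diagForm a x) :
    PosRel (∏ i, gaussVal ψ (a i)) (∏ i, gaussVal ψ (b i)) := by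
  obtain ⟨z, hz⟩ := gaussVal_diag_exists hψ h2 b hb
  refine PosRel.trans (PosRel.symm ?_) (GaussVal.posRel_prod hψ h2 b hb hz)
  refine GaussVal.posRel_prod hψ h2 a ha ?_
  have := hz.comp φ.toAddEquiv (LinearMap.continuous_of_finiteDimensional φ.toLinearMap)
    (LinearMap.continuous_of_finiteDimensional φ.symm.toLinearMap)
  convert this using 3 with x
  exact (h x).symm

theorem gaussVal_mul_neg (hψ : IsSmoothChar ψ) (h2 : (2 : K) ≠ 0)
    {a : K} (ha : a ≠ 0) : PosRel (gaussVal ψ a * gaussVal ψ (-a)) 1 := by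
  have h0 : ∀ i, ![a, -a] i ≠ 0 := by
    intro i; fin_cases i <;> simpa using ha
  obtain ⟨z, hz⟩ := gaussVal_diag_exists hψ h2 ![a, -a] h0
  have h1 := GaussVal.posRel_prod hψ h2 _ h0 hz
  simp only [Fin.prod_univ_two, Matrix.cons_val_zero, Matrix.cons_val_one] at h1
  refine h1.symm.trans ?_
  let φ : (K × K) ≃+ (Fin 2 → K) :=
    { toFun := fun p => ![p.1 + p.2, p.1 - p.2]
      invFun := fun x => (2⁻¹ * (x 0 + x 1), 2⁻¹ * (x 0 - x 1))
      left_inv := fun p => by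
        ext
        · simp; field_simp; ring
        · simp; field_simp; ring
      right_inv := fun x => by
        ext i
        fin_cases i
        · simp; field_simp; ring
        · simp; field_simp; ring
      map_add' := fun x y => by
        ext i
        fin_cases i
        · simp; ring
        · simp; ring }
  have h := hz.comp φ (by
    refine continuous_pi fun i => ?_
    fin_cases i
    · exact continuous_fst.add continuous_snd
    · exact continuous_fst.sub continuous_snd) (by
    refine Continuous.prodMk ?_ ?_
    · change Continuous fun x : Fin 2 → K => 2⁻¹ * (x 0 + x 1)
      fun_prop
    · change Continuous fun x : Fin 2 → K => 2⁻¹ * (x 0 - x 1)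
      fun_prop)
  have h4 : (4 : K) * a ≠ 0 := mul_ne_zero (by
    have : (4 : K) = 2 * 2 := by norm_num
    rw [this]; exact mul_ne_zero h2 h2) ha
  have hfun : (fun p => ψ (diagForm ![a, -a] (φ p))) = fun p : K × K => ψ ((4 * a * p.1) * p.2) := by
    ext p
    congr 1
    simp [diagForm, φ]
    ring
  rw [hfun] at h
  obtain ⟨μ, hμ, C, hC, h⟩ := h
  obtain ⟨R₀, hR₀, hR⟩ := hC.exists_subset_closedBall
  set R := max R₀ 1 with hRdef
  have hR0 : 0 < R := lt_max_of_lt_right one_pos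
  let ν : Measure K := Measure.addHaar
  obtain ⟨c, hc0, hc⟩ := exists_pos_smul_of_isAddHaarMeasure μ (ν.prod ν)
  have e := h (ballSubgroup (K × K) R hR0.le) (isCompact_closedBall 0 R) (hR R (le_max_left _ _))
  rw [hc, Measure.restrict_smul, integral_smul_nnreal_measure] at e
  set B := ballSubgroup K R hR0.le with hB
  have hBc : IsCompact (B : Set K) := isCompact_closedBall 0 R
  have hs : (ballSubgroup (K × K) R hR0.le : Set (K × K)) = (B : Set K) ×ˢ (B : Set K) := by
    simp only [hB, coe_ballSubgroup]
    rw [closedBall_prod_same]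
    rfl
  rw [hs, setIntegral_prod] at e
  · let P : Set K := {x | ∀ y ∈ B, ψ (4 * a * x * y) = 1}
    have hPclosed : IsClosed P := by
      have : P = ⋂ y ∈ B, {x | ψ (4 * a * x * y) = 1} := by ext; simp [P]
      rw [this]
      refine isClosed_biInter fun z _ => isClosed_eq ?_ continuous_const
      exact hψ.continuous.comp (by fun_prop)
    have hin : ∀ x, ∫ y in (B : Set K), ψ (4 * a * x * y) ∂ν =
        P.indicator (fun x => (ν.real (B : Set K) : ℂ)) x := by
      intro x
      by_cases hx : x ∈ P
      · rw [Set.indicator_of_mem hx]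
        exact setIntegral_addChar_eq_measure ν hBc.measurableSet _ hx
      · rw [Set.indicator_of_notMem hx]
        have hx' : ∃ z ∈ B, ψ (4 * a * x * z) ≠ 1 := by simpa [P] using hx
        obtain ⟨z, hz, hz1⟩ := hx'
        exact setIntegral_addChar_eq_zero ν B (fun z => ψ (4 * a * x * z))
          (fun z w => by rw [mul_add, hψ.add]) hz hz1
    simp only [hin] at e
    rw [setIntegral_indicator hPclosed.measurableSet, setIntegral_const] at e
    have hB1 : 0 < ν.real (B : Set K) :=
      ENNReal.toReal_pos (measure_closedBall_pos ν 0 hR0).ne' hBc.measure_lt_top.ne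
    have hB2 : 0 < ν.real ((B : Set K) ∩ P) := by
      refine ENNReal.toReal_pos ?_
        ((measure_mono Set.inter_subset_left).trans_lt hBc.measure_lt_top).ne
      obtain ⟨ε, hε, hloc⟩ := hψ.loc
      have hr : 0 < min R (ε / (‖4 * a‖ * R)) :=
        lt_min hR0 (div_pos hε (mul_pos (norm_pos_iff.2 h4) hR0))
      refine (lt_of_lt_of_le (measure_closedBall_pos ν (0 : K) hr) (measure_mono ?_)).ne'
      intro x hx
      rw [mem_closedBall, dist_zero_right, le_min_iff] at hx
      refine ⟨by change x ∈ closedBall 0 R; simpa using hx.1, fun y hy => hloc _ ?_⟩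
      have hy' : ‖y‖ ≤ R := by
        have : y ∈ closedBall (0 : K) R := hy
        simpa using this
      rw [norm_mul, norm_mul]
      calc ‖4 * a‖ * ‖x‖ * ‖y‖ ≤ ‖4 * a‖ * (ε / (‖4 * a‖ * R)) * R := by
            gcongr; exact hx.2
        _ = ε := by
            have := (norm_pos_iff.2 h4).ne'
            field_simp
    refine ⟨c * (ν.real ((B : Set K) ∩ P) * ν.real (B : Set K)), by positivity, ?_⟩
    rw [← e]
    rw [NNReal.smul_def]
    simp
  · refine ContinuousOn.integrableOn_compact (hBc.prod hBc) (Continuous.continuousOn ?_)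
    exact hψ.continuous.comp (by fun_prop)

theorem gaussVal_ne_zero (hψ : IsSmoothChar ψ) (h2 : (2 : K) ≠ 0)
    {a : K} (ha : a ≠ 0) : gaussVal ψ a ≠ 0 :=
  left_ne_zero_of_mul ((gaussVal_mul_neg hψ h2 ha).ne_zero one_ne_zero)

end Gamma

section DiagBilin

variable {K : Type*} [CommRing K] {ι : Type*} [Fintype ι]

/-- The polar form of a diagonal quadratic form. -/
def diagPolar (a x y : ι → K) : K := ∑ i, 2 * a i * x i * y i

theorem diagForm_add (a x y : ι → K) :
    diagForm a (x + y) = diagForm a x + diagForm a y + diagPolar a x y := by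
  simp only [diagForm, diagPolar, ← Finset.sum_add_distrib, Pi.add_apply]
  exact Finset.sum_congr rfl fun i _ => by ring

theorem diagForm_smul (a x : ι → K) (t : K) : diagForm a (t • x) = t ^ 2 * diagForm a x := by
  simp only [diagForm, Finset.mul_sum, Pi.smul_apply, smul_eq_mul]
  exact Finset.sum_congr rfl fun i _ => by ring

theorem diagPolar_smul_right (a x y : ι → K) (t : K) :
    diagPolar a x (t • y) = t * diagPolar a x y := by
  simp only [diagPolar, Finset.mul_sum, Pi.smul_apply, smul_eq_mul]
  exact Finset.sum_congr rfl fun i _ => by ring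

theorem diagPolar_smul_left (a x y : ι → K) (t : K) :
    diagPolar a (t • x) y = t * diagPolar a x y := by
  simp only [diagPolar, Finset.mul_sum, Pi.smul_apply, smul_eq_mul]
  exact Finset.sum_congr rfl fun i _ => by ring

theorem diagPolar_self (a x : ι → K) : diagPolar a x x = 2 * diagForm a x := by
  simp only [diagForm, diagPolar, Finset.mul_sum]
  exact Finset.sum_congr rfl fun i _ => by ring

theorem diagPolar_add_right (a x y z : ι → K) :
    diagPolar a x (y + z) = diagPolar a x y + diagPolar a x z := by
  simp only [diagPolar, ← Finset.sum_add_distrib, Pi.add_apply]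
  exact Finset.sum_congr rfl fun i _ => by ring

theorem diagForm_zero (a : ι → K) : diagForm a 0 = 0 := by simp [diagForm]

/-- The diagonal form represents zero only trivially. -/
def DiagAnisotropic (a : ι → K) : Prop := ∀ x, diagForm a x = 0 → x = 0

end DiagBilin

section Local

variable {K : Type*} [NontriviallyNormedField K] [IsUltrametricDist K] [ProperSpace K]

theorem norm_ofNat_le_one (n : ℕ) : ‖(n : K)‖ ≤ 1 := IsUltrametricDist.norm_natCast_le_one K n

variable (K) in
theorem exists_uniformizer : ∃ p : K, p ≠ 0 ∧ ‖p‖ < 1 ∧ ∀ x : K, ‖x‖ < 1 → ‖x‖ ≤ ‖p‖ := by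
  have hc : IsCompact (ball (0 : K) 1) :=
    (isCompact_closedBall (0 : K) 1).of_isClosed_subset (IsUltrametricDist.isClosed_ball _ _)
      ball_subset_closedBall
  obtain ⟨p, hp, hmax⟩ := hc.exists_isMaxOn ⟨0, by simp⟩ (continuous_norm.continuousOn)
  obtain ⟨y, hy0, hy1⟩ := NormedField.exists_norm_lt_one K
  have h : ∀ x : K, ‖x‖ < 1 → ‖x‖ ≤ ‖p‖ := fun x hx => hmax (by simpa using hx)
  refine ⟨p, ?_, by simpa using hp, h⟩
  exact norm_pos_iff.1 (hy0.trans_le (h y hy1))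

theorem exists_root_of_norm_lt_one {τ : K} (hτ : ‖τ‖ < 1) : ∃ s : K, s = 1 + τ * s ^ 2 := by
  have hc := isCompact_closedBall (0 : K) 1
  obtain ⟨s, hs, hmin⟩ := hc.exists_isMinOn ⟨0, by simp⟩
    (f := fun s => ‖1 + τ * s ^ 2 - s‖) (by fun_prop)
  simp only [mem_closedBall, dist_zero_right] at hs
  have hs1 : ‖1 + τ * s ^ 2‖ ≤ 1 := by
    refine (IsUltrametricDist.norm_add_le_max _ _).trans (max_le (by simp) ?_)
    rw [norm_mul, norm_pow]
    exact mul_le_one₀ hτ.le (by positivity) (pow_le_one₀ (norm_nonneg _) hs)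
  refine ⟨s, ?_⟩
  by_contra hne
  have h0 : 0 < ‖1 + τ * s ^ 2 - s‖ := norm_pos_iff.2 (sub_ne_zero.2 (Ne.symm hne))
  have h1 : ‖1 + τ * s ^ 2 - s‖ ≤ ‖1 + τ * (1 + τ * s ^ 2) ^ 2 - (1 + τ * s ^ 2)‖ :=
    hmin (by simpa using hs1)
  have h2 : 1 + τ * (1 + τ * s ^ 2) ^ 2 - (1 + τ * s ^ 2) =
      τ * ((1 + τ * s ^ 2 + s) * (1 + τ * s ^ 2 - s)) := by ring
  rw [h2, norm_mul, norm_mul] at h1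
  have h3 : ‖1 + τ * s ^ 2 + s‖ ≤ 1 :=
    (IsUltrametricDist.norm_add_le_max _ _).trans (max_le hs1 hs)
  nlinarith [norm_nonneg τ, norm_nonneg (1 + τ * s ^ 2 + s),
    mul_le_mul_of_nonneg_right h3 h0.le]

variable {n : ℕ} {a : Fin n → K}

theorem DiagAnisotropic.norm_polar_sq_le (ha : DiagAnisotropic a) (x y : Fin n → K) :
    ‖diagPolar a x y‖ ^ 2 ≤ ‖diagForm a x‖ * ‖diagForm a y‖ := by
  by_contra! hlt
  set B := diagPolar a x y with hB
  set p := diagForm a x with hp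
  set q := diagForm a y with hq
  have hB0 : B ≠ 0 := by
    intro h
    rw [h, norm_zero] at hlt
    have : 0 ≤ ‖p‖ * ‖q‖ := by positivity
    nlinarith
  have hBn : 0 < ‖B‖ := norm_pos_iff.2 hB0
  obtain ⟨s, hs⟩ := exists_root_of_norm_lt_one (τ := p * q / B ^ 2) (by
    rw [norm_div, norm_mul, norm_pow, div_lt_one (by positivity)]
    exact hlt)
  set t := -(p / B) * s with ht
  have h0 : diagForm a (x + t • y) = 0 := by
    rw [diagForm_add, diagForm_smul, diagPolar_smul_right, ← hp, ← hq, ← hB, ht]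
    have : s * B ^ 2 = B ^ 2 + p * q * s ^ 2 := by
      nth_rewrite 1 [hs]; field_simp
    field_simp
    linear_combination (-p) * this
  have h1 := ha _ h0
  have hx : x = (-t) • y := by rw [neg_smul]; exact eq_neg_of_add_eq_zero_left h1
  have hpq : p = t ^ 2 * q := by rw [hp, hx, diagForm_smul]; ring
  have hBq : B = -t * (2 * q) := by rw [hB, hx, diagPolar_smul_left, diagPolar_self]
  have h4 : B ^ 2 = 4 * (p * q) := by rw [hBq, hpq]; ring
  have h5 : ‖B‖ ^ 2 = ‖(4 : K)‖ * (‖p‖ * ‖q‖) := by rw [← norm_pow, h4, norm_mul, norm_mul]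
  have h6 : ‖(4 : K)‖ ≤ 1 := by exact_mod_cast norm_ofNat_le_one (K := K) 4
  have : 0 ≤ ‖p‖ * ‖q‖ := by positivity
  nlinarith

theorem DiagAnisotropic.norm_polar_le (ha : DiagAnisotropic a) {x y : Fin n → K} {R : ℝ}
    (hx : ‖diagForm a x‖ ≤ R) (hy : ‖diagForm a y‖ ≤ R) : ‖diagPolar a x y‖ ≤ R := by
  have h := ha.norm_polar_sq_le x y
  have hR : 0 ≤ R := (norm_nonneg _).trans hx
  refine abs_le_of_sq_le_sq' (h.trans ?_) hR |>.2
  rw [sq]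
  gcongr

/-- The lattice of vectors on which an anisotropic form is bounded by `R`. -/
def DiagAnisotropic.lattice (ha : DiagAnisotropic a) (R : ℝ) (hR : 0 ≤ R) :
    AddSubgroup (Fin n → K) where
  carrier := {x | ‖diagForm a x‖ ≤ R}
  zero_mem' := by simpa [diagForm_zero] using hR
  add_mem' {x y} hx hy := by
    simp only [Set.mem_ofPred_eq] at *
    rw [diagForm_add]
    refine (IsUltrametricDist.norm_add_le_max _ _).trans (max_le ?_ (ha.norm_polar_le hx hy))
    exact (IsUltrametricDist.norm_add_le_max _ _).trans (max_le hx hy)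
  neg_mem' {x} hx := by
    simp only [Set.mem_ofPred_eq] at *
    have : -x = (-1 : K) • x := by simp
    rw [this, diagForm_smul]
    simpa using hx

theorem DiagAnisotropic.mem_lattice (ha : DiagAnisotropic a) {R : ℝ} {hR : 0 ≤ R}
    {x : Fin n → K} : x ∈ ha.lattice R hR ↔ ‖diagForm a x‖ ≤ R := Iff.rfl

theorem continuous_diagForm (a : Fin n → K) : Continuous (diagForm a) := by
  unfold diagForm; fun_prop

theorem DiagAnisotropic.exists_lower_bound (ha : DiagAnisotropic a) :
    ∃ m : ℝ, 0 < m ∧ ∀ x : Fin n → K, m * ‖x‖ ^ 2 ≤ ‖diagForm a x‖ := by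
  have hc := isCompact_sphere (0 : Fin n → K) 1
  rcases (sphere (0 : Fin n → K) 1).eq_empty_or_nonempty with he | hne
  · refine ⟨1, one_pos, fun x => ?_⟩
    by_cases hx : x = 0
    · simp [hx]
    obtain ⟨i, hi⟩ := Function.ne_iff.1 hx
    obtain ⟨j, -, hj⟩ := Finset.exists_max_image Finset.univ (fun i => ‖x i‖) ⟨i, Finset.mem_univ i⟩
    have hj0 : 0 < ‖x j‖ := (norm_pos_iff.2 hi).trans_le (hj i (Finset.mem_univ i))
    exfalso
    have hn : Nontrivial (Fin n → K) := ⟨x, 0, hx⟩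
    have : (Pi.single j 1 : Fin n → K) ∈ sphere (0 : Fin n → K) 1 := by simp [Pi.norm_single]
    rw [he] at this
    exact this
  · obtain ⟨y, hy, hmin⟩ := hc.exists_isMinOn hne (continuous_diagForm a).norm.continuousOn
    have hy1 : ‖y‖ = 1 := by simpa using hy
    refine ⟨‖diagForm a y‖, norm_pos_iff.2 fun h => ?_, fun x => ?_⟩
    · rw [ha y h, norm_zero] at hy1; exact zero_ne_one hy1
    · by_cases hx : x = 0
      · simp [hx]
      obtain ⟨i, hi⟩ := Function.ne_iff.1 hx
      obtain ⟨j, -, hj⟩ := Finset.exists_max_image Finset.univ (fun i => ‖x i‖)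
        ⟨i, Finset.mem_univ i⟩
      have hj0 : 0 < ‖x j‖ := (norm_pos_iff.2 hi).trans_le (hj i (Finset.mem_univ i))
      have hxj : ‖x‖ = ‖x j‖ := le_antisymm
        ((pi_norm_le_iff_of_nonneg (norm_nonneg _)).2 fun i => hj i (Finset.mem_univ i))
        (norm_le_pi_norm x j)
      have hj1 : x j ≠ 0 := norm_pos_iff.1 hj0
      have h1 : ‖(x j)⁻¹ • x‖ = 1 := by
        rw [norm_smul, norm_inv, hxj, inv_mul_cancel₀ hj0.ne']
      have h2 : ‖diagForm a y‖ ≤ ‖diagForm a ((x j)⁻¹ • x)‖ := hmin (by simpa using h1)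
      rw [diagForm_smul, norm_mul, norm_pow, norm_inv, inv_pow, inv_mul_eq_div,
        le_div_iff₀ (by positivity)] at h2
      rwa [hxj]

theorem DiagAnisotropic.isCompact_lattice (ha : DiagAnisotropic a) (R : ℝ) (hR : 0 ≤ R) :
    IsCompact (ha.lattice R hR : Set (Fin n → K)) := by
  obtain ⟨m, hm, h⟩ := ha.exists_lower_bound
  refine (isCompact_closedBall (0 : Fin n → K) (R / m + 1)).of_isClosed_subset ?_ fun x hx => ?_
  · exact isClosed_le (continuous_diagForm a).norm continuous_const
  · rw [mem_closedBall, dist_zero_right]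
    have h1 : m * ‖x‖ ^ 2 ≤ R := (h x).trans hx
    have h2 : ‖x‖ ^ 2 ≤ R / m := by rw [le_div_iff₀ hm, mul_comm]; exact h1
    nlinarith [sq_nonneg (‖x‖ - 1), norm_nonneg x]

end Local

section Residue

theorem exists_nontrivial_zero_of_finite {F : Type*} [Field F] [Finite F] (a b c d e f : F) :
    ∃ x : Fin 3 → F, x ≠ 0 ∧ a * x 0 ^ 2 + b * x 1 ^ 2 + c * x 2 ^ 2 + d * (x 0 * x 1) +
      e * (x 0 * x 2) + f * (x 1 * x 2) = 0 := by
  classical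
  have := Fintype.ofFinite F
  let P : MvPolynomial (Fin 3) F := MvPolynomial.C a * MvPolynomial.X 0 ^ 2 +
    MvPolynomial.C b * MvPolynomial.X 1 ^ 2 + MvPolynomial.C c * MvPolynomial.X 2 ^ 2 +
    MvPolynomial.C d * (MvPolynomial.X 0 * MvPolynomial.X 1) +
    MvPolynomial.C e * (MvPolynomial.X 0 * MvPolynomial.X 2) +
    MvPolynomial.C f * (MvPolynomial.X 1 * MvPolynomial.X 2)
  have hP : P.totalDegree < Fintype.card (Fin 3) := by
    refine lt_of_le_of_lt (b := 2) ?_ (by simp)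
    have h1 : ∀ (a : F) (i : Fin 3), (MvPolynomial.C a * MvPolynomial.X i ^ 2).totalDegree ≤ 2 := by
      intro a i
      refine (MvPolynomial.totalDegree_mul _ _).trans ?_
      rw [MvPolynomial.totalDegree_C, zero_add]
      refine (MvPolynomial.totalDegree_pow _ _).trans ?_
      rw [MvPolynomial.totalDegree_X]
    have h2 : ∀ (a : F) (i j : Fin 3),
        (MvPolynomial.C a * (MvPolynomial.X i * MvPolynomial.X j)).totalDegree ≤ 2 := by
      intro a i j
      refine (MvPolynomial.totalDegree_mul _ _).trans ?_
      rw [MvPolynomial.totalDegree_C, zero_add]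
      refine (MvPolynomial.totalDegree_mul _ _).trans ?_
      rw [MvPolynomial.totalDegree_X, MvPolynomial.totalDegree_X]
    have h3 : ∀ p q : MvPolynomial (Fin 3) F, p.totalDegree ≤ 2 → q.totalDegree ≤ 2 →
        (p + q).totalDegree ≤ 2 := fun p q hp hq =>
      (MvPolynomial.totalDegree_add p q).trans (max_le hp hq)
    exact h3 _ _ (h3 _ _ (h3 _ _ (h3 _ _ (h3 _ _ (h1 a 0) (h1 b 1)) (h1 c 2)) (h2 d 0 1))
      (h2 e 0 2)) (h2 f 1 2)
  have hdvd := char_dvd_card_solutions (ringChar F) hP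
  have h0 : MvPolynomial.eval (0 : Fin 3 → F) P = 0 := by simp [P]
  by_contra! hcon
  have : Fintype.card {x : Fin 3 → F // MvPolynomial.eval x P = 0} = 1 := by
    refine Fintype.card_eq_one_iff.2 ⟨⟨0, h0⟩, fun y => Subtype.ext ?_⟩
    by_contra hy
    refine hcon y.1 hy ?_
    have := y.2
    simpa [P] using this
  rw [this] at hdvd
  exact CharP.ringChar_ne_one (Nat.dvd_one.1 hdvd)

/-- The ring of integers. -/
abbrev integerRing (K : Type*) [NontriviallyNormedField K] [IsUltrametricDist K] : Subring K :=
  (NormedField.valuation (K := K)).integer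

theorem mem_integerRing {K : Type*} [NontriviallyNormedField K] [IsUltrametricDist K] {x : K} :
    x ∈ integerRing K ↔ ‖x‖ ≤ 1 := by
  rw [Valuation.mem_integer_iff, NormedField.valuation_apply]
  exact_mod_cast Iff.rfl

theorem exists_residue_field.{u} (K : Type u) [NontriviallyNormedField K] [IsUltrametricDist K]
    [ProperSpace K] : ∃ (F : Type u) (_ : Field F) (_ : Finite F) (r : integerRing K →+* F),
    Function.Surjective r ∧ ∀ x, r x = 0 ↔ ‖(x : K)‖ < 1 := by
  let I : Ideal (integerRing K) :=
    { carrier := {x | ‖(x : K)‖ < 1}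
      zero_mem' := by simp
      add_mem' := fun {x y} hx hy =>
        (IsUltrametricDist.norm_add_le_max (x : K) y).trans_lt (max_lt hx hy)
      smul_mem' := fun c x hx => by
        simp only [Set.mem_ofPred_eq, smul_eq_mul, Subring.coe_mul, norm_mul] at *
        exact (mul_le_of_le_one_left (norm_nonneg _) (mem_integerRing.1 c.2)).trans_lt hx }
  have hI : ∀ x, x ∈ I ↔ ‖(x : K)‖ < 1 := fun x => Iff.rfl
  have hmax : I.IsMaximal := by
    rw [Ideal.isMaximal_iff]
    refine ⟨by simp [hI], fun J x hIJ hx hxJ => ?_⟩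
    have hx1 : ‖(x : K)‖ = 1 := le_antisymm (mem_integerRing.1 x.2) (not_lt.1 hx)
    have hx0 : (x : K) ≠ 0 := by
      intro h; rw [h, norm_zero] at hx1; exact zero_ne_one hx1
    have hinv : (x : K)⁻¹ ∈ integerRing K := mem_integerRing.2 (by rw [norm_inv, hx1, inv_one])
    have := J.mul_mem_left ⟨_, hinv⟩ hxJ
    convert this
    ext
    simp [hx0]
  let := Ideal.Quotient.field I
  refine ⟨integerRing K ⧸ I, inferInstance, ?_, Ideal.Quotient.mk I,
    Ideal.Quotient.mk_surjective, fun x => by rw [Ideal.Quotient.eq_zero_iff_mem, hI]⟩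
  obtain ⟨t, ht, htf, hcov⟩ := (isCompact_closedBall (0 : K) 1).finite_cover_balls one_pos
  have hmem : ∀ x ∈ t, x ∈ integerRing K := fun x hx => mem_integerRing.2 (by simpa using ht hx)
  have := htf.to_subtype
  refine Finite.of_surjective (fun x : t => Ideal.Quotient.mk I ⟨x.1, hmem x.1 x.2⟩) fun y => ?_
  obtain ⟨x, rfl⟩ := Ideal.Quotient.mk_surjective y
  have hx : (x : K) ∈ closedBall (0 : K) 1 := by simpa using mem_integerRing.1 x.2
  obtain ⟨z, hz, hxz⟩ := Set.mem_iUnion₂.1 (hcov hx)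
  refine ⟨⟨z, hz⟩, ?_⟩
  rw [Ideal.Quotient.eq, hI]
  rw [mem_ball, dist_comm, dist_eq_norm] at hxz
  simpa using hxz

end Residue

section Cover

variable {K : Type*} [NontriviallyNormedField K] [IsUltrametricDist K] [ProperSpace K]
  {n : ℕ} {a : Fin n → K}

theorem DiagAnisotropic.smul_mem (ha : DiagAnisotropic a) {R : ℝ} (hR : 0 ≤ R) {t : K}
    (ht : ‖t‖ ≤ 1) {x : Fin n → K} (hx : x ∈ ha.lattice R hR) : t • x ∈ ha.lattice R hR := by
  rw [DiagAnisotropic.mem_lattice] at *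
  rw [diagForm_smul, norm_mul, norm_pow]
  exact (mul_le_of_le_one_left (norm_nonneg _) (pow_le_one₀ (norm_nonneg _) ht)).trans hx

theorem DiagAnisotropic.lattice_cover (ha : DiagAnisotropic a) {p : K}
    (hp : ∀ x : K, ‖x‖ < 1 → ‖x‖ ≤ ‖p‖) {F : Type*} [Field F] [Finite F]
    (r : integerRing K →+* F) (hr : Function.Surjective r) (hr0 : ∀ x, r x = 0 ↔ ‖(x : K)‖ < 1)
    {c : K} (hc : c ≠ 0) :
    ∃ v : F × F → (Fin n → K), ∀ x ∈ ha.lattice ‖c‖ (norm_nonneg c),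
      ∃ i, x - v i ∈ ha.lattice (‖c‖ * ‖p‖) (by positivity) := by
  set S := ha.lattice ‖c‖ (norm_nonneg c) with hS
  set S' := ha.lattice (‖c‖ * ‖p‖) (by positivity) with hS'
  have hcn : 0 < ‖c‖ := norm_pos_iff.2 hc
  have hmem' : ∀ x, ‖diagForm a x‖ < ‖c‖ → x ∈ S' := by
    intro x hx
    have h1 : ‖diagForm a x / c‖ < 1 := by rwa [norm_div, div_lt_one hcn]
    have := hp _ h1
    rw [norm_div, div_le_iff₀ hcn, mul_comm] at this
    exact this
  have hM : ∀ t : K, ‖t‖ < 1 → ∀ x ∈ S, t • x ∈ S' := by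
    intro t ht x hx
    apply hmem'
    rw [diagForm_smul, norm_mul, norm_pow]
    have hx' : ‖diagForm a x‖ ≤ ‖c‖ := hx
    nlinarith [norm_nonneg t, norm_nonneg (diagForm a x), pow_le_of_le_one (norm_nonneg t) ht.le two_ne_zero]
  have hO' : ∀ t : K, ‖t‖ ≤ 1 → ∀ x ∈ S', t • x ∈ S' := fun t ht x hx => ha.smul_mem _ ht hx
  obtain ⟨s, hs⟩ := hr.hasRightInverse
  have hsn : ∀ i, ‖(s i : K)‖ ≤ 1 := fun i => mem_integerRing.1 (s i).2
  have hs1 : ∀ i, i ≠ 0 → ‖(s i : K)‖ = 1 := by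
    intro i hi
    refine le_antisymm (hsn i) (not_lt.1 fun h => hi ?_)
    rw [← hs i]; exact (hr0 _).2 h
  have hs0 : ∀ i, i = 0 → ‖(s i : K)‖ < 1 := by
    rintro i rfl; exact (hr0 _).1 (hs 0)
  -- approximate an integral coefficient by a representative
  have happ : ∀ t : K, ‖t‖ ≤ 1 → ∃ i, ‖t - s i‖ < 1 := by
    intro t ht
    refine ⟨r ⟨t, mem_integerRing.2 ht⟩, (hr0 (⟨t, mem_integerRing.2 ht⟩ - s _)).1 ?_⟩
    rw [map_sub, hs, sub_self]
  suffices ∃ x₁ ∈ S, ∃ x₂ ∈ S, ∀ x ∈ S, ∃ t₁ t₂ : K, ‖t₁‖ ≤ 1 ∧ ‖t₂‖ ≤ 1 ∧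
      x - (t₁ • x₁ + t₂ • x₂) ∈ S' by
    obtain ⟨x₁, h1, x₂, h2, h⟩ := this
    refine ⟨fun i => (s i.1 : K) • x₁ + (s i.2 : K) • x₂, fun x hx => ?_⟩
    obtain ⟨t₁, t₂, ht1, ht2, ht⟩ := h x hx
    obtain ⟨i, hi⟩ := happ t₁ ht1
    obtain ⟨j, hj⟩ := happ t₂ ht2
    refine ⟨(i, j), ?_⟩
    have := S'.add_mem ht (S'.add_mem (hM _ hi _ h1) (hM _ hj _ h2))
    convert this using 1
    module
  by_cases h1 : ∀ x ∈ S, x ∈ S'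
  · exact ⟨0, S.zero_mem, 0, S.zero_mem, fun x hx => ⟨0, 0, by simp, by simp, by simpa using h1 x hx⟩⟩
  push Not at h1
  obtain ⟨x₁, hx1, hx1'⟩ := h1
  by_cases h2 : ∀ x ∈ S, ∃ t : K, ‖t‖ ≤ 1 ∧ x - t • x₁ ∈ S'
  · refine ⟨x₁, hx1, 0, S.zero_mem, fun x hx => ?_⟩
    obtain ⟨t, ht, h⟩ := h2 x hx
    exact ⟨t, 0, ht, by simp, by simpa using h⟩
  push Not at h2
  obtain ⟨x₂, hx2, hx2'⟩ := h2
  refine ⟨x₁, hx1, x₂, hx2, fun x hx => ?_⟩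
  have hdiv : ∀ t : K, ‖t‖ ≤ ‖c‖ → t / c ∈ integerRing K := fun t ht =>
    mem_integerRing.2 (by rwa [norm_div, div_le_one hcn])
  have hB : ∀ {x y}, x ∈ S → y ∈ S → ‖diagPolar a x y‖ ≤ ‖c‖ := fun hx hy => ha.norm_polar_le hx hy
  obtain ⟨w, hw0, hw⟩ := exists_nontrivial_zero_of_finite
    (r ⟨_, hdiv (diagForm a x₁) hx1⟩) (r ⟨_, hdiv (diagForm a x₂) hx2⟩)
    (r ⟨_, hdiv (diagForm a x) hx⟩)
    (r ⟨_, hdiv _ (hB hx1 hx2)⟩) (r ⟨_, hdiv _ (hB hx1 hx)⟩) (r ⟨_, hdiv _ (hB hx2 hx)⟩)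
  set y := (s (w 0) : K) • x₁ + (s (w 1) : K) • x₂ + (s (w 2) : K) • x with hy
  have hyS : y ∈ S' := by
    apply hmem'
    have h3 : r (⟨_, hdiv (diagForm a x₁) hx1⟩ * s (w 0) ^ 2 + ⟨_, hdiv (diagForm a x₂) hx2⟩ * s (w 1) ^ 2
        + ⟨_, hdiv (diagForm a x) hx⟩ * s (w 2) ^ 2 + ⟨_, hdiv _ (hB hx1 hx2)⟩ * (s (w 0) * s (w 1))
        + ⟨_, hdiv _ (hB hx1 hx)⟩ * (s (w 0) * s (w 2))
        + ⟨_, hdiv _ (hB hx2 hx)⟩ * (s (w 1) * s (w 2))) = 0 := by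
      simp only [map_add, map_mul, map_pow, hs (w _)]
      exact hw
    rw [hr0] at h3
    have h4 : diagForm a y = c * (diagForm a x₁ / c * (s (w 0) : K) ^ 2 +
        diagForm a x₂ / c * (s (w 1) : K) ^ 2 + diagForm a x / c * (s (w 2) : K) ^ 2 +
        diagPolar a x₁ x₂ / c * (s (w 0) * s (w 1)) + diagPolar a x₁ x / c * (s (w 0) * s (w 2)) +
        diagPolar a x₂ x / c * (s (w 1) * s (w 2))) := by
      have hsymm : ∀ u v : Fin n → K, diagPolar a u v = diagPolar a v u := fun u v => by
        simp only [diagPolar]; exact Finset.sum_congr rfl fun i _ => by ring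
      rw [hy, diagForm_add, diagForm_add, diagForm_smul, diagForm_smul, diagForm_smul,
        diagPolar_smul_right, diagPolar_smul_right, diagPolar_smul_left, hsymm (_ + _) x,
        diagPolar_add_right, diagPolar_smul_right, diagPolar_smul_right, hsymm x, hsymm x]
      field_simp
      ring
    rw [h4, norm_mul]
    exact mul_lt_of_lt_one_right hcn (by exact_mod_cast h3)
  by_cases hw2 : w 2 = 0
  · exfalso
    have h3 : (s (w 0) : K) • x₁ + (s (w 1) : K) • x₂ ∈ S' := by
      have := S'.sub_mem hyS (hM _ (hs0 _ hw2) x hx)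
      rwa [hy, add_sub_cancel_right] at this
    by_cases hw1 : w 1 = 0
    · have hw00 : w 0 ≠ 0 := by
        intro h
        apply hw0
        ext i; fin_cases i
        exacts [h, hw1, hw2]
      have h4 : (s (w 0) : K) • x₁ ∈ S' := by
        have := S'.sub_mem h3 (hM _ (hs0 _ hw1) x₂ hx2)
        rwa [add_sub_cancel_right] at this
      have h5 := hO' (s (w 0) : K)⁻¹ (by rw [norm_inv, hs1 _ hw00, inv_one]) _ h4
      rw [inv_smul_smul₀ (norm_pos_iff.1 (by rw [hs1 _ hw00]; exact one_pos))] at h5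
      exact hx1' h5
    · have h5 := hO' (s (w 1) : K)⁻¹ (by rw [norm_inv, hs1 _ hw1, inv_one]) _ h3
      have hne : (s (w 1) : K) ≠ 0 := norm_pos_iff.1 (by rw [hs1 _ hw1]; exact one_pos)
      refine hx2' (-((s (w 1) : K)⁻¹ * s (w 0))) ?_ ?_
      · rw [norm_neg, norm_mul, norm_inv, hs1 _ hw1, inv_one, one_mul]; exact hsn _
      · convert h5 using 1
        rw [smul_add, smul_smul, inv_smul_smul₀ hne, neg_smul]
        abel
  · have hne : (s (w 2) : K) ≠ 0 := norm_pos_iff.1 (by rw [hs1 _ hw2]; exact one_pos)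
    have h5 := hO' (s (w 2) : K)⁻¹ (by rw [norm_inv, hs1 _ hw2, inv_one]) _ hyS
    refine ⟨-((s (w 2) : K)⁻¹ * s (w 0)), -((s (w 2) : K)⁻¹ * s (w 1)), ?_, ?_, ?_⟩
    · rw [norm_neg, norm_mul, norm_inv, hs1 _ hw2, inv_one, one_mul]; exact hsn _
    · rw [norm_neg, norm_mul, norm_inv, hs1 _ hw2, inv_one, one_mul]; exact hsn _
    · convert h5 using 1
      rw [hy, smul_add, smul_add, smul_smul, smul_smul, inv_smul_smul₀ hne, neg_smul, neg_smul]
      abel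

end Cover

section Volume

theorem exists_scale {V : Type*} [NormedAddCommGroup V] [MeasurableSpace V] [BorelSpace V]
    [IsUltrametricDist V] [ProperSpace V] (μ : Measure V) [μ.IsAddHaarMeasure] (e : V ≃ₜ+ V) :
    ∃ c : ℝ, 0 < c ∧ (∀ S, μ.real (e ⁻¹' S) = c * μ.real S) ∧
      ∀ (f : V → ℂ) (S : Set V), ∫ x in e ⁻¹' S, f (e x) ∂μ = c * ∫ x in S, f x ∂μ := by
  have := e.isAddHaarMeasure_map μ
  obtain ⟨c, hc, h⟩ := exists_pos_smul_of_isAddHaarMeasure (μ.map e) μ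
  have hm : MeasurableEmbedding e := e.toHomeomorph.measurableEmbedding
  refine ⟨c, hc, fun S => ?_, fun f S => ?_⟩
  · rw [measureReal_def, ← hm.map_apply, h, measureReal_def]
    simp
  · rw [← hm.setIntegral_map, h, Measure.restrict_smul, integral_smul_nnreal_measure]
    rfl

variable {K : Type*} [NontriviallyNormedField K] [IsUltrametricDist K] [ProperSpace K]
  [MeasurableSpace K] [BorelSpace K]

/-- A linear automorphism as a homeomorphic additive automorphism. -/
def LinearEquiv.toCAE {V : Type*} [NormedAddCommGroup V] [NormedSpace K V] [FiniteDimensional K V]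
    (e : V ≃ₗ[K] V) : V ≃ₜ+ V :=
  { e.toAddEquiv with
    continuous_toFun := LinearMap.continuous_of_finiteDimensional e.toLinearMap
    continuous_invFun := LinearMap.continuous_of_finiteDimensional e.symm.toLinearMap }

@[simp] theorem LinearEquiv.toCAE_apply {V : Type*} [NormedAddCommGroup V] [NormedSpace K V]
    [FiniteDimensional K V] (e : V ≃ₗ[K] V) (x : V) : e.toCAE x = e x := rfl

theorem measureReal_closedBall_pos {V : Type*} [NormedAddCommGroup V] [MeasurableSpace V]
    [BorelSpace V] [ProperSpace V] (μ : Measure V) [μ.IsAddHaarMeasure] (x : V) {R : ℝ}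
    (hR : 0 < R) : 0 < μ.real (closedBall x R) :=
  ENNReal.toReal_pos (measure_closedBall_pos μ x hR).ne'
    (isCompact_closedBall x R).measure_lt_top.ne

theorem measureReal_preimage_inv_smul (κ : Measure K) [κ.IsAddHaarMeasure] {n : ℕ}
    (μ : Measure (Fin n → K)) [μ.IsAddHaarMeasure] {p : K} (hp : p ≠ 0) (S : Set (Fin n → K)) :
    μ.real ((fun x => p⁻¹ • x) ⁻¹' S) =
      (κ.real (closedBall 0 ‖p‖) / κ.real (closedBall 0 1)) ^ n * μ.real S := by
  obtain ⟨c, hc, h, -⟩ := exists_scale μ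
    (LinearEquiv.toCAE (LinearEquiv.smulOfUnit (Units.mk0 p⁻¹ (inv_ne_zero hp)) : (Fin n → K) ≃ₗ[K] _))
  have h' : ∀ S : Set (Fin n → K), μ.real ((fun x => p⁻¹ • x) ⁻¹' S) = c * μ.real S := h
  rw [h']
  congr 1
  have hb := h' (closedBall 0 1)
  have hpn : 0 < ‖p‖ := norm_pos_iff.2 hp
  have hpre : (fun x : Fin n → K => p⁻¹ • x) ⁻¹' closedBall 0 1 = closedBall 0 ‖p‖ := by
    ext x
    simp only [Set.mem_preimage, mem_closedBall, dist_zero_right, norm_smul, norm_inv]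
    rw [inv_mul_le_iff₀ hpn, mul_one]
  rw [hpre] at hb
  obtain ⟨d, hd, hμ⟩ := exists_pos_smul_of_isAddHaarMeasure μ (Measure.pi fun _ : Fin n => κ)
  have hpi : ∀ R : ℝ, 0 < R → μ.real (closedBall 0 R) = d * κ.real (closedBall 0 R) ^ n := by
    intro R hR
    rw [hμ, measureReal_def, Measure.smul_apply, Measure.pi_closedBall _ _ hR.le]
    simp only [Pi.zero_apply, Finset.prod_const, Finset.card_univ, Fintype.card_fin,
      measureReal_def]
    rw [ENNReal.smul_def, smul_eq_mul, ENNReal.toReal_mul, ENNReal.toReal_pow]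
    rfl
  rw [hpi _ hpn, hpi _ one_pos] at hb
  have h1 := measureReal_closedBall_pos κ 0 one_pos
  have hd' : (0 : ℝ) < d := hd
  rw [div_pow, eq_div_iff (by positivity)]
  refine mul_left_cancel₀ hd'.ne' ?_
  linarith

/-- The unit ball is a union of `#F` translates of the open unit ball. -/
theorem measureReal_unitBall (κ : Measure K) [κ.IsAddHaarMeasure] {p : K} (hp1 : ‖p‖ < 1)
    (hp : ∀ x : K, ‖x‖ < 1 → ‖x‖ ≤ ‖p‖) {F : Type*} [Field F] [Finite F]
    (r : integerRing K →+* F) (hr : Function.Surjective r) (hr0 : ∀ x, r x = 0 ↔ ‖(x : K)‖ < 1) :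
    κ.real (closedBall 0 1) = Nat.card F * κ.real (closedBall 0 ‖p‖) := by
  have := Fintype.ofFinite F
  obtain ⟨s, hs⟩ := hr.hasRightInverse
  have hball : ∀ x : K, ‖x‖ < 1 ↔ ‖x‖ ≤ ‖p‖ := fun x => ⟨hp x, fun h => h.trans_lt hp1⟩
  have hU : closedBall (0 : K) 1 = ⋃ i : F, closedBall (s i : K) ‖p‖ := by
    ext x
    simp only [Set.mem_iUnion, mem_closedBall, dist_eq_norm, sub_zero]
    constructor
    · intro hx
      refine ⟨r ⟨x, mem_integerRing.2 hx⟩, (hball _).1 ?_⟩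
      refine (hr0 (⟨x, mem_integerRing.2 hx⟩ - s _)).1 ?_
      rw [map_sub, hs, sub_self]
    · rintro ⟨i, hi⟩
      have : x = (x - s i) + s i := by ring
      rw [this]
      exact (IsUltrametricDist.norm_add_le_max _ _).trans
        (max_le (hi.trans hp1.le) (mem_integerRing.1 (s i).2))
  have hdisj : Pairwise (Function.onFun Disjoint fun i : F => closedBall (s i : K) ‖p‖) := by
    intro i j hij
    refine Set.disjoint_left.2 fun x hi hj => hij ?_
    rw [mem_closedBall, dist_eq_norm, ← hball] at hi hj
    rw [← hs i, ← hs j, ← sub_eq_zero, ← map_sub, hr0]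
    have : ((s i - s j : integerRing K) : K) = (x - s j) - (x - s i) := by
      push_cast; ring
    rw [this, sub_eq_add_neg]
    refine (IsUltrametricDist.norm_add_le_max _ _).trans_lt (max_lt hj ?_)
    rwa [norm_neg]
  rw [hU, measureReal_def, measure_iUnion hdisj (fun i => measurableSet_closedBall), tsum_fintype]
  have htr : ∀ i : F, κ (closedBall (s i : K) ‖p‖) = κ (closedBall 0 ‖p‖) := fun i =>
    Measure.addHaar_closedBall_center κ _ _
  simp only [htr]
  simp [measureReal_def]

theorem DiagAnisotropic.dim_le_four {n : ℕ} {a : Fin n → K} (ha : DiagAnisotropic a) : n ≤ 4 := by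
  obtain ⟨p, hp0, hp1, hp⟩ := exists_uniformizer K
  obtain ⟨F, _, _, r, hr, hr0⟩ := exists_residue_field K
  let κ : Measure K := Measure.addHaar
  let μ : Measure (Fin n → K) := Measure.addHaar
  have := Fintype.ofFinite F
  have hκ := measureReal_unitBall κ hp1 hp r hr hr0
  have hpn : 0 < ‖p‖ := norm_pos_iff.2 hp0
  have hκ0 := measureReal_closedBall_pos κ 0 hpn
  have hcard : 1 < Nat.card F := Finite.one_lt_card
  set Q : ℝ := (Nat.card F : ℝ) with hQ
  have hQ1 : 1 < Q := by rw [hQ]; exact_mod_cast hcard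
  have hstep : ∀ c : K, c ≠ 0 → μ.real (ha.lattice ‖c‖ (norm_nonneg c) : Set (Fin n → K)) ≤
      Q ^ 2 * μ.real (ha.lattice (‖c‖ * ‖p‖) (by positivity) : Set (Fin n → K)) := by
    intro c hc
    obtain ⟨v, hv⟩ := ha.lattice_cover hp r hr hr0 hc
    set S' := ha.lattice (‖c‖ * ‖p‖) (by positivity)
    have hsub : (ha.lattice ‖c‖ (norm_nonneg c) : Set (Fin n → K)) ⊆
        ⋃ i : F × F, (fun x => x + -v i) ⁻¹' (S' : Set (Fin n → K)) := by
      intro x hx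
      obtain ⟨i, hi⟩ := hv x hx
      exact Set.mem_iUnion.2 ⟨i, by simpa [← sub_eq_add_neg] using hi⟩
    have hfin : ∀ i, μ ((fun x => x + -v i) ⁻¹' (S' : Set (Fin n → K))) = μ (S' : Set (Fin n → K)) :=
      fun i => measure_preimage_add_right μ _ _
    have hS'fin : μ (S' : Set (Fin n → K)) ≠ ⊤ := (ha.isCompact_lattice _ _).measure_lt_top.ne
    refine (measureReal_mono hsub ?_).trans ((measureReal_iUnion_fintype_le _).trans ?_)
    · refine ((measure_iUnion_fintype_le μ _).trans_lt ?_).ne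
      simp only [hfin]
      exact ENNReal.sum_lt_top.2 fun _ _ => hS'fin.lt_top
    · simp only [measureReal_def, hfin]
      simp [hQ, sq]
  have h1 := hstep 1 one_ne_zero
  have h2 := hstep p hp0
  have hsc := measureReal_preimage_inv_smul κ μ hp0
    (ha.lattice ‖(1 : K)‖ (norm_nonneg _) : Set (Fin n → K))
  have hpre : (fun x : Fin n → K => p⁻¹ • x) ⁻¹' (ha.lattice ‖(1 : K)‖ (norm_nonneg _) : Set (Fin n → K))
      = (ha.lattice (‖p‖ * ‖p‖) (by positivity) : Set (Fin n → K)) := by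
    ext x
    simp only [Set.mem_preimage, SetLike.mem_coe, DiagAnisotropic.mem_lattice]
    rw [diagForm_smul, norm_mul, norm_pow, norm_inv, inv_pow, inv_mul_le_iff₀ (by positivity),
      norm_one, mul_one, sq]
  rw [hpre] at hsc
  have hone : (ha.lattice (‖(1 : K)‖ * ‖p‖) (by positivity) : Set (Fin n → K)) =
      (ha.lattice ‖p‖ (by positivity) : Set (Fin n → K)) := by
    ext x
    simp only [SetLike.mem_coe, DiagAnisotropic.mem_lattice, norm_one, one_mul]
  rw [hone] at h1
  set m := μ.real (ha.lattice ‖(1 : K)‖ (norm_nonneg _) : Set (Fin n → K)) with hm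
  have hm0 : 0 < m := by
    refine ENNReal.toReal_pos ?_ (ha.isCompact_lattice _ _).measure_lt_top.ne
    refine (MeasureTheory.Measure.measure_pos_of_mem_nhds μ (x := 0) ?_).ne'
    have hopen : IsOpen {x : Fin n → K | ‖diagForm a x‖ < 1} :=
      isOpen_lt (continuous_diagForm a).norm continuous_const
    refine Filter.mem_of_superset (hopen.mem_nhds (by simp [diagForm_zero])) fun x hx => ?_
    have hx' : ‖diagForm a x‖ < 1 := hx
    simp only [SetLike.mem_coe, DiagAnisotropic.mem_lattice, norm_one]
    exact hx'.le
  have h3 : m ≤ Q ^ 2 * (Q ^ 2 * ((κ.real (closedBall 0 ‖p‖) / κ.real (closedBall 0 1)) ^ n * m)) := by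
    rw [← hsc]
    exact h1.trans (by gcongr)
  rw [hκ] at h3
  have h4 : κ.real (closedBall 0 ‖p‖) / (Q * κ.real (closedBall 0 ‖p‖)) = Q⁻¹ := by
    field_simp
  rw [h4, inv_pow] at h3
  have h5 : Q ^ n ≤ Q ^ 4 := by
    have hQn : 0 < Q ^ n := by positivity
    have : m * Q ^ n ≤ Q ^ 4 * m := by
      calc m * Q ^ n ≤ (Q ^ 2 * (Q ^ 2 * ((Q ^ n)⁻¹ * m))) * Q ^ n := by gcongr
        _ = Q ^ 4 * m := by field_simp
    nlinarith
  exact (pow_le_pow_iff_right₀ hQ1).1 h5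

end Volume

section Key

variable {K : Type*} [NontriviallyNormedField K] [IsUltrametricDist K] [ProperSpace K]

theorem IsSmoothChar.exists_conductor {ψ : K → ℂ} (hψ : IsSmoothChar ψ) :
    ∃ t₀ : K, t₀ ≠ 0 ∧ ∀ t, (∀ y, ‖y‖ ≤ 1 → ψ (t * y) = 1) ↔ ‖t‖ ≤ ‖t₀‖ := by
  let A : Set K := {t | ∀ y, ‖y‖ ≤ 1 → ψ (t * y) = 1}
  obtain ⟨R, hR⟩ := hψ.bound one_pos
  have hAc : IsClosed A := by
    have : A = ⋂ y : K, ⋂ _ : ‖y‖ ≤ 1, {t | ψ (t * y) = 1} := by ext; simp [A]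
    rw [this]
    refine isClosed_iInter fun y => isClosed_iInter fun _ => isClosed_eq ?_ continuous_const
    exact hψ.continuous.comp (by fun_prop)
  have hAk : IsCompact A := (isCompact_closedBall (0 : K) R).of_isClosed_subset hAc fun t ht => by
    simpa using hR t ht
  obtain ⟨t₀, ht₀, hmax⟩ := hAk.exists_isMaxOn ⟨0, fun y _ => by rw [zero_mul, hψ.zero]⟩
    continuous_norm.continuousOn
  obtain ⟨ε, hε, hloc⟩ := hψ.loc
  obtain ⟨s, hs0, hs⟩ := NormedField.exists_norm_lt K hε
  have hsA : s ∈ A := fun y hy => hloc _ (by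
    rw [norm_mul]; exact (mul_le_of_le_one_right (norm_nonneg _) hy).trans hs.le)
  have h0 : t₀ ≠ 0 := norm_pos_iff.1 (hs0.trans_le (hmax hsA))
  refine ⟨t₀, h0, fun t => ⟨fun h => hmax h, fun h y hy => ?_⟩⟩
  have := ht₀ (t₀⁻¹ * (t * y)) (by
    rw [norm_mul, norm_mul, norm_inv, inv_mul_le_iff₀ (norm_pos_iff.2 h0), mul_one]
    exact (mul_le_of_le_one_right (norm_nonneg _) hy).trans h)
  rwa [mul_inv_cancel_left₀ h0] at this

variable [MeasurableSpace K] [BorelSpace K]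

theorem setIntegral_ball_char {ψ : K → ℂ} (hψ : IsSmoothChar ψ) (κ : Measure K)
    [κ.IsAddHaarMeasure] {t₀ p : K} (hp : p ≠ 0)
    (ht₀ : ∀ t, (∀ y, ‖y‖ ≤ 1 → ψ (t * y) = 1) ↔ ‖t‖ ≤ ‖t₀‖) (t : K) :
    ∫ u in closedBall 0 ‖p‖, ψ (u * t) ∂κ =
      Set.indicator {t : K | ‖t‖ * ‖p‖ ≤ ‖t₀‖} (fun _ => (κ.real (closedBall 0 ‖p‖) : ℂ)) t := by
  have hpn : 0 < ‖p‖ := norm_pos_iff.2 hp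
  have hiff : (∀ u ∈ ballSubgroup K ‖p‖ (norm_nonneg p), ψ (u * t) = 1) ↔ ‖t‖ * ‖p‖ ≤ ‖t₀‖ := by
    rw [← norm_mul, ← ht₀]
    constructor
    · intro h y hy
      have := h (p * y) (by
        change p * y ∈ closedBall 0 ‖p‖
        rw [mem_closedBall, dist_zero_right, norm_mul]
        exact mul_le_of_le_one_right (norm_nonneg _) hy)
      rw [← this]; congr 1; ring
    · intro h u hu
      have hu' : ‖u‖ ≤ ‖p‖ := by
        have : u ∈ closedBall (0 : K) ‖p‖ := hu
        simpa using this
      have := h (p⁻¹ * u) (by rw [norm_mul, norm_inv, inv_mul_le_iff₀ hpn, mul_one]; exact hu')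
      rw [← this]; congr 1; field_simp
  by_cases h : ‖t‖ * ‖p‖ ≤ ‖t₀‖
  · rw [Set.indicator_of_mem (by exact h)]
    exact setIntegral_addChar_eq_measure κ measurableSet_closedBall _ (hiff.2 h)
  · rw [Set.indicator_of_notMem (by exact h)]
    have hx := mt hiff.1 h
    push Not at hx
    obtain ⟨z, hz, hz1⟩ := hx
    exact setIntegral_addChar_eq_zero κ (ballSubgroup K ‖p‖ (norm_nonneg p)) (fun z => ψ (z * t))
      (fun z w => by rw [add_mul, hψ.add]) hz hz1

theorem DiagAnisotropic.gaussVal_eq {ψ : K → ℂ} (hψ : IsSmoothChar ψ) {n : ℕ} {a : Fin n → K}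
    (ha : DiagAnisotropic a)
    (hT : ∀ c : K, c ≠ 0 → ∃ T : (Fin n → K) ≃ₗ[K] (Fin n → K),
      ∀ x, diagForm a (T x) = c * diagForm a x) {z : ℂ}
    (hz : GaussVal (fun x => ψ (diagForm a x)) z) :
    ∃ A Q c : ℝ, 0 < A ∧ 1 < Q ∧ 0 < c ∧ c ^ 2 = Q ^ n ∧ z = ((A * (Q - c) : ℝ) : ℂ) := by
  obtain ⟨p, hp0, hp1, hp⟩ := exists_uniformizer K
  obtain ⟨F, _, _, r, hr, hr0⟩ := exists_residue_field K
  have hpn : 0 < ‖p‖ := norm_pos_iff.2 hp0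
  let κ : Measure K := Measure.addHaar
  obtain ⟨μ, hμ, C, hC, hz⟩ := hz
  obtain ⟨t₀, ht0, ht⟩ := hψ.exists_conductor
  have htn : 0 < ‖t₀‖ := norm_pos_iff.2 ht0
  let L : ℝ → Set (Fin n → K) := fun R => {x | ‖diagForm a x‖ ≤ R}
  have hLc : ∀ R, 0 ≤ R → IsCompact (L R) := fun R hR => ha.isCompact_lattice R hR
  have hLpos : ∀ R, 0 < R → 0 < μ.real (L R) := by
    intro R hR
    refine ENNReal.toReal_pos ?_ (hLc R hR.le).measure_lt_top.ne
    refine (MeasureTheory.Measure.measure_pos_of_mem_nhds μ (x := 0) ?_).ne'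
    have hopen : IsOpen {x : Fin n → K | ‖diagForm a x‖ < R} :=
      isOpen_lt (continuous_diagForm a).norm continuous_const
    refine Filter.mem_of_superset (hopen.mem_nhds (by simpa [diagForm_zero] using hR)) fun x hx => ?_
    exact (show ‖diagForm a x‖ < R from hx).le
  have hscale : ∀ c : K, c ≠ 0 → ∃ d : ℝ, 0 < d ∧ (∀ R, μ.real (L (R / ‖c‖)) = d * μ.real (L R)) ∧
      ∀ R, ∫ x in L (R / ‖c‖), ψ (c * diagForm a x) ∂μ = d * ∫ x in L R, ψ (diagForm a x) ∂μ := by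
    intro c hc
    obtain ⟨T, hT⟩ := hT c hc
    obtain ⟨d, hd, h1, h2⟩ := exists_scale μ (LinearEquiv.toCAE T)
    have hpre : ∀ R, (LinearEquiv.toCAE T) ⁻¹' (L R) = L (R / ‖c‖) := by
      intro R
      ext x
      simp only [L, Set.mem_preimage, Set.mem_ofPred_eq, LinearEquiv.toCAE_apply, hT, norm_mul]
      rw [le_div_iff₀ (norm_pos_iff.2 hc), mul_comm]
    refine ⟨d, hd, fun R => by rw [← hpre, h1], fun R => ?_⟩
    rw [← hpre, ← h2]
    simp only [LinearEquiv.toCAE_apply, hT]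
  -- a large lattice
  obtain ⟨R₁, hR₁⟩ := (hC.image (continuous_diagForm a)).isBounded.exists_norm_le
  set R := max R₁ (‖t₀‖ / ‖p‖) with hR
  have hR0 : 0 < R := lt_max_of_lt_right (by positivity)
  have hS := hz (ha.lattice R hR0.le) (hLc R hR0.le) fun x hx =>
    (hR₁ _ ⟨x, hx, rfl⟩).trans (le_max_left _ _)
  change ∫ x in L R, ψ (diagForm a x) ∂μ = z at hS
  have hunit : ∀ u : K, ‖u‖ = 1 → ∫ x in L R, ψ (u * diagForm a x) ∂μ = z := by
    intro u hu
    obtain ⟨d, hd, h1, h2⟩ := hscale u (norm_pos_iff.1 (by rw [hu]; exact one_pos))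
    have h1 := h1 R
    have h2 := h2 R
    rw [hu, div_one] at h1 h2
    have : d = 1 := by
      have := hLpos R hR0
      nlinarith
    rw [h2, this, hS, Complex.ofReal_one, one_mul]
  set kO := κ.real (closedBall 0 1) with hkO
  set kM := κ.real (closedBall 0 ‖p‖) with hkM
  have hkM0 : 0 < kM := measureReal_closedBall_pos κ 0 hpn
  have hQ : kO = Nat.card F * kM := measureReal_unitBall κ hp1 hp r hr hr0
  have hcard : (1 : ℝ) < Nat.card F := by exact_mod_cast Finite.one_lt_card
  have hkOM : kM < kO := by rw [hQ]; nlinarith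
  have hsub : closedBall (0 : K) ‖p‖ ⊆ closedBall 0 1 := closedBall_subset_closedBall hp1.le
  let U : Set K := closedBall 0 1 \ closedBall 0 ‖p‖
  have hUmeas : MeasurableSet U := measurableSet_closedBall.diff measurableSet_closedBall
  have hUnorm : ∀ u ∈ U, ‖u‖ = 1 := by
    rintro u ⟨h1, h2⟩
    simp only [mem_closedBall, dist_zero_right] at h1 h2
    exact le_antisymm h1 (not_lt.1 fun h => h2 (hp u h))
  have hUk : κ.real U = kO - kM :=
    measureReal_sdiff hsub measurableSet_closedBall (isCompact_closedBall _ _).measure_lt_top.ne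
  have hLHS : ∫ u in U, ∫ x in L R, ψ (u * diagForm a x) ∂μ ∂κ = (kO - kM : ℝ) * z := by
    rw [setIntegral_congr_fun hUmeas fun u hu => hunit u (hUnorm u hu)]
    rw [setIntegral_const, hUk, Complex.real_smul]
  have hcont : Continuous fun q : K × (Fin n → K) => ψ (q.1 * diagForm a q.2) :=
    hψ.continuous.comp (continuous_fst.mul ((continuous_diagForm a).comp continuous_snd))
  rw [integral_integral_swap] at hLHS
  · have hin : ∀ x, ∫ u in U, ψ (u * diagForm a x) ∂κ =
        (L ‖t₀‖).indicator (fun _ => (kO : ℂ)) x - (L (‖t₀‖ / ‖p‖)).indicator (fun _ => (kM : ℂ)) x := by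
      intro x
      have hi : ∀ r : ℝ, IntegrableOn (fun u => ψ (u * diagForm a x)) (closedBall 0 r) κ := fun r =>
        ContinuousOn.integrableOn_compact (isCompact_closedBall _ _)
          (hψ.continuous.comp (by fun_prop)).continuousOn
      rw [setIntegral_sdiff measurableSet_closedBall (hi 1) hsub]
      have e1 := setIntegral_ball_char hψ κ one_ne_zero ht (diagForm a x)
      have e2 := setIntegral_ball_char hψ κ hp0 ht (diagForm a x)
      rw [norm_one] at e1
      rw [e1, e2]
      congr 1
      · simp only [Set.indicator_apply, Set.mem_ofPred_eq, mul_one, L, hkO]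
      · simp only [Set.indicator_apply, Set.mem_ofPred_eq, L, le_div_iff₀ hpn, hkM]
    simp only [hin] at hLHS
    have hm : ∀ R, 0 ≤ R → MeasurableSet (L R) := fun R hR => (hLc R hR).measurableSet
    have hi : ∀ (S : ℝ) (w : ℂ), 0 ≤ S → Integrable ((L S).indicator fun _ => w) (μ.restrict (L R)) := by
      intro S w hS0
      have : Integrable (fun _ : Fin n → K => w) (μ.restrict (L R)) :=
        integrableOn_const (hLc R hR0.le).measure_lt_top.ne
      exact this.indicator (hm S hS0)
    have hev : ∀ (S : ℝ) (w : ℝ), 0 ≤ S → S ≤ R →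
        ∫ x in L R, (L S).indicator (fun _ => (w : ℂ)) x ∂μ = ((μ.real (L S) * w : ℝ) : ℂ) := by
      intro S w hS0 hSR
      rw [setIntegral_indicator (hm S hS0), Set.inter_eq_self_of_subset_right, setIntegral_const,
        Complex.real_smul, Complex.ofReal_mul]
      exact fun x hx => le_trans hx hSR
    have hp1' : ‖t₀‖ ≤ ‖t₀‖ / ‖p‖ := by
      rw [le_div_iff₀ hpn]; exact mul_le_of_le_one_right htn.le hp1.le
    have hbig : ‖t₀‖ / ‖p‖ ≤ R := le_max_right _ _
    rw [integral_sub (hi _ _ htn.le) (hi _ _ (by positivity)), hev _ _ htn.le (hp1'.trans hbig),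
      hev _ _ (by positivity) hbig, ← Complex.ofReal_sub] at hLHS
    obtain ⟨c, hc, h1, -⟩ := hscale p hp0
    have e1 := h1 ‖t₀‖
    have e2 := h1 (‖t₀‖ * ‖p‖)
    rw [mul_div_cancel_right₀ _ hpn.ne'] at e2
    have e3 := measureReal_preimage_inv_smul κ μ hp0 (L (‖t₀‖ / ‖p‖))
    have hpre : (fun x : Fin n → K => p⁻¹ • x) ⁻¹' (L (‖t₀‖ / ‖p‖)) = L (‖t₀‖ * ‖p‖) := by
      ext x
      simp only [L, Set.mem_preimage, Set.mem_ofPred_eq]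
      rw [diagForm_smul, norm_mul, norm_pow, norm_inv, inv_pow, inv_mul_le_iff₀ (by positivity)]
      have : ‖p‖ ^ 2 * (‖t₀‖ / ‖p‖) = ‖t₀‖ * ‖p‖ := by field_simp
      rw [this]
    rw [hpre] at e3
    set m := μ.real (L ‖t₀‖) with hm
    have hm0 : 0 < m := hLpos _ htn
    rw [e1] at e3 hLHS
    rw [e3] at e2
    refine ⟨m * kM / (kO - kM), kO / kM, c, ?_, ?_, hc, ?_, ?_⟩
    · have : 0 < kO - kM := sub_pos.2 hkOM
      positivity
    · rwa [one_lt_div hkM0]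
    · have : 0 < kO := hkM0.trans hkOM
      change m = c * ((kM / kO) ^ n * (c * m)) at e2
      have h5 : 1 = c ^ 2 * (kM / kO) ^ n := by
        refine mul_right_cancel₀ hm0.ne' ?_
        linarith
      rw [div_pow] at h5 ⊢
      field_simp at h5 ⊢
      linarith
    · have h6 : ((kO - kM : ℝ) : ℂ) ≠ 0 := by exact_mod_cast (sub_pos.2 hkOM).ne'
      refine mul_left_cancel₀ h6 (hLHS.symm.trans ?_)
      rw [← Complex.ofReal_mul]
      congr 1
      have h7 : kO - kM ≠ 0 := (sub_pos.2 hkOM).ne'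
      field_simp
  · rw [Measure.prod_restrict]
    refine IntegrableOn.mono_set (t := closedBall 0 1 ×ˢ L R) ?_
      (Set.prod_mono Set.sdiff_subset le_rfl)
    exact ContinuousOn.integrableOn_compact ((isCompact_closedBall _ _).prod (hLc R hR0.le))
      hcont.continuousOn

theorem DiagAnisotropic.gaussVal_eq_zero {ψ : K → ℂ} (hψ : IsSmoothChar ψ) {a : Fin 2 → K}
    (ha : DiagAnisotropic a)
    (hT : ∀ c : K, c ≠ 0 → ∃ T : (Fin 2 → K) ≃ₗ[K] (Fin 2 → K),
      ∀ x, diagForm a (T x) = c * diagForm a x) {z : ℂ}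
    (hz : GaussVal (fun x => ψ (diagForm a x)) z) : z = 0 := by
  obtain ⟨A, Q, c, hA, hQ, hc, h, rfl⟩ := ha.gaussVal_eq hψ hT hz
  have : c = Q := by
    rw [sq_eq_sq₀ hc.le (by linarith)] at h
    exact h
  rw [this, sub_self, mul_zero, Complex.ofReal_zero]

theorem DiagAnisotropic.gaussVal_neg {ψ : K → ℂ} (hψ : IsSmoothChar ψ) {a : Fin 4 → K}
    (ha : DiagAnisotropic a)
    (hT : ∀ c : K, c ≠ 0 → ∃ T : (Fin 4 → K) ≃ₗ[K] (Fin 4 → K),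
      ∀ x, diagForm a (T x) = c * diagForm a x) {z : ℂ}
    (hz : GaussVal (fun x => ψ (diagForm a x)) z) : PosRel z (-1) := by
  obtain ⟨A, Q, c, hA, hQ, hc, h, rfl⟩ := ha.gaussVal_eq hψ hT hz
  have : c = Q ^ 2 := by
    have h' : c ^ 2 = (Q ^ 2) ^ 2 := by rw [h]; ring
    rwa [sq_eq_sq₀ hc.le (by positivity)] at h'
  refine ⟨A * (c - Q), ?_, by push_cast; ring⟩
  rw [this]
  exact mul_pos hA (by nlinarith)

end Key

section NormForms

variable {K : Type*} [NontriviallyNormedField K] [IsUltrametricDist K] [ProperSpace K]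
  [MeasurableSpace K] [BorelSpace K]

theorem DiagAnisotropic.exists_similitude {n : ℕ} {a : Fin n → K} (ha : DiagAnisotropic a) {c : K}
    (hc : c ≠ 0) (M : Matrix (Fin n) (Fin n) K)
    (hM : ∀ x, diagForm a (M.mulVec x) = c * diagForm a x) :
    ∃ T : (Fin n → K) ≃ₗ[K] (Fin n → K), ∀ x, diagForm a (T x) = c * diagForm a x := by
  have hinj : Function.Injective (Matrix.toLin' M) := by
    rw [← LinearMap.ker_eq_bot, LinearMap.ker_eq_bot']
    intro x hx
    refine ha x ((mul_eq_zero.1 ?_).resolve_left hc)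
    rw [← hM, ← Matrix.toLin'_apply, hx, diagForm_zero]
  exact ⟨LinearEquiv.ofInjectiveEndo _ hinj, fun x => by
    rw [LinearEquiv.coe_ofInjectiveEndo, Matrix.toLin'_apply, hM]⟩

theorem diagForm_two (a b : K) (x : Fin 2 → K) :
    diagForm ![a, b] x = a * x 0 ^ 2 + b * x 1 ^ 2 := by
  simp [diagForm, Fin.sum_univ_two]

theorem eq_zero_of_sq_eq_nonsquare_mul {F : Type*} [Field F] {a : F} (ha : ¬ IsSquare a) {x y : F}
    (h : x ^ 2 - a * y ^ 2 = 0) : x = 0 ∧ y = 0 := by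
  by_cases hy : y = 0
  · subst hy
    simpa using h
  · refine absurd ⟨x / y, ?_⟩ ha
    field_simp
    linear_combination -h

theorem diagAnisotropic_two {a : K} (ha : ¬ IsSquare a) : DiagAnisotropic ![1, -a] := by
  intro x hx
  rw [diagForm_two] at hx
  have := eq_zero_of_sq_eq_nonsquare_mul ha (x := x 0) (y := x 1) (by linear_combination hx)
  ext i; fin_cases i <;> simp [this]

theorem exists_non_norm {ψ : K → ℂ} (hψ : IsSmoothChar ψ) (h2 : (2 : K) ≠ 0) {a : K}
    (ha : ¬ IsSquare a) : ∃ l : K, l ≠ 0 ∧ ∀ x y : K, x ^ 2 - a * y ^ 2 ≠ l := by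
  by_contra! hcon
  have ha0 : a ≠ 0 := by rintro rfl; exact ha ⟨0, by simp⟩
  have han := diagAnisotropic_two ha
  have hne : ∀ i, (![1, -a] : Fin 2 → K) i ≠ 0 := by
    intro i; fin_cases i <;> simp [ha0]
  obtain ⟨z, hz⟩ := gaussVal_diag_exists hψ h2 ![1, -a] hne
  have hz0 := DiagAnisotropic.gaussVal_eq_zero hψ han (fun c hc => by
    obtain ⟨p, q, hpq⟩ := hcon c hc
    refine han.exists_similitude hc !![p, a * q; q, p] fun x => ?_
    rw [diagForm_two, diagForm_two, ← hpq]
    simp [Matrix.mulVec, dotProduct, Fin.sum_univ_two]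
    ring) hz
  have h := GaussVal.posRel_prod hψ h2 _ hne hz
  exact PosRel.ne_zero h (Finset.prod_ne_zero_iff.2 fun i _ => gaussVal_ne_zero hψ h2 (hne i)) hz0

theorem diagForm_four (a b c d : K) (x : Fin 4 → K) :
    diagForm ![a, b, c, d] x = a * x 0 ^ 2 + b * x 1 ^ 2 + c * x 2 ^ 2 + d * x 3 ^ 2 := by
  simp [diagForm, Fin.sum_univ_four]

theorem diagAnisotropic_quaternion {a l : K} (ha : ¬ IsSquare a)
    (hl : ∀ x y : K, x ^ 2 - a * y ^ 2 ≠ l) : DiagAnisotropic ![1, -a, -l, a * l] := by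
  intro x hx
  rw [diagForm_four] at hx
  have h0 : x 2 ^ 2 - a * x 3 ^ 2 = 0 := by
    by_contra hn
    refine hl ((x 0 * x 2 - a * x 1 * x 3) / (x 2 ^ 2 - a * x 3 ^ 2))
      ((x 1 * x 2 - x 0 * x 3) / (x 2 ^ 2 - a * x 3 ^ 2)) ?_
    field_simp
    linear_combination (x 2 ^ 2 - a * x 3 ^ 2) * hx
  have h1 := eq_zero_of_sq_eq_nonsquare_mul ha h0
  have h2 := eq_zero_of_sq_eq_nonsquare_mul ha (x := x 0) (y := x 1)
    (by linear_combination hx + l * h0)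
  ext i; fin_cases i <;> simp [h1, h2]

theorem exists_quaternion_norm_eq {a l : K} (ha : ¬ IsSquare a)
    (hl : ∀ x y : K, x ^ 2 - a * y ^ 2 ≠ l) {c : K} (hc : c ≠ 0) :
    ∃ x : Fin 4 → K, diagForm ![1, -a, -l, a * l] x = c := by
  by_contra! hcon
  have h5 : DiagAnisotropic (![1, -a, -l, a * l, -c] : Fin 5 → K) := by
    intro x hx
    have hx' : diagForm ![1, -a, -l, a * l] (fun i : Fin 4 => x i.castSucc) = c * x 4 ^ 2 := by
      rw [diagForm_four]
      simp [diagForm, Fin.sum_univ_five] at hx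
      simp
      linear_combination hx
    by_cases h4 : x 4 = 0
    · rw [h4] at hx'
      have := diagAnisotropic_quaternion ha hl _ (hx'.trans (by ring))
      ext i
      refine Fin.lastCases h4 (fun i => ?_) i
      exact congrFun this i
    · refine absurd ?_ (hcon ((x 4)⁻¹ • fun i : Fin 4 => x i.castSucc))
      rw [diagForm_smul, hx']
      field_simp
  exact absurd h5.dim_le_four (by norm_num)

theorem gaussVal_quaternion {ψ : K → ℂ} (hψ : IsSmoothChar ψ) (h2 : (2 : K) ≠ 0) {a l : K}
    (ha : ¬ IsSquare a) (hl0 : l ≠ 0) (hl : ∀ x y : K, x ^ 2 - a * y ^ 2 ≠ l) {c : K}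
    (hc : c ≠ 0) :
    PosRel (gaussVal ψ c * gaussVal ψ (-(a * c)) * gaussVal ψ (-(c * l)) * gaussVal ψ (a * c * l))
      (-1) := by
  have ha0 : a ≠ 0 := by rintro rfl; exact ha ⟨0, by simp⟩
  have han := diagAnisotropic_quaternion ha hl
  have heq : ∀ x, diagForm ![c, -(a * c), -(c * l), a * c * l] x
      = c * diagForm ![1, -a, -l, a * l] x := by
    intro x; rw [diagForm_four, diagForm_four]; ring
  have hne : ∀ i, (![c, -(a * c), -(c * l), a * c * l] : Fin 4 → K) i ≠ 0 := by
    intro i; fin_cases i <;> simp [ha0, hc, hl0]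
  have han' : DiagAnisotropic ![c, -(a * c), -(c * l), a * c * l] := fun x hx =>
    han x ((mul_eq_zero.1 ((heq x).symm.trans hx)).resolve_left hc)
  obtain ⟨z, hz⟩ := gaussVal_diag_exists hψ h2 _ hne
  have hz0 := DiagAnisotropic.gaussVal_neg hψ han' (fun e he => by
    obtain ⟨p, hp⟩ := exists_quaternion_norm_eq ha hl he
    refine han'.exists_similitude he !![p 0, a * p 1, l * p 2, -(a * l * p 3);
      p 1, p 0, l * p 3, -(l * p 2); p 2, -(a * p 3), p 0, a * p 1;
      p 3, -p 2, p 1, p 0] fun x => ?_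
    rw [heq, heq, ← hp, diagForm_four, diagForm_four, diagForm_four]
    simp [Matrix.mulVec, dotProduct, Fin.sum_univ_four]
    ring) hz
  have h := (GaussVal.posRel_prod hψ h2 _ hne hz).symm.trans hz0
  simpa [Fin.prod_univ_four] using h

end NormForms

section DiagAlgebra

variable {F : Type*} [Field F]

theorem diagPolar_single {n : ℕ} (a x : Fin n → F) (i : Fin n) :
    diagPolar a x (Pi.single i 1) = 2 * a i * x i := by
  classical
  simp [diagPolar, Pi.single_apply]

theorem diagPolar_map {n m : ℕ} {a : Fin n → F} {b : Fin m → F}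
    (T : (Fin n → F) →ₗ[F] (Fin m → F)) (hT : ∀ x, diagForm b (T x) = diagForm a x)
    (x y : Fin n → F) : diagPolar b (T x) (T y) = diagPolar a x y := by
  have h := hT (x + y)
  rw [map_add, diagForm_add, diagForm_add, hT, hT] at h
  exact add_left_cancel h

theorem diagForm_single {n : ℕ} (a : Fin n → F) (i : Fin n) :
    diagForm a (Pi.single i 1) = a i := by
  classical
  simp [diagForm, Pi.single_apply]

theorem diagForm_append {n m : ℕ} (a : Fin n → F) (b : Fin m → F) (x : Fin (n + m) → F) :
    diagForm (Fin.append a b) x =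
      diagForm a (fun i => x (Fin.castAdd m i)) + diagForm b (fun i => x (Fin.natAdd n i)) := by
  simp [diagForm, Fin.sum_univ_add]

theorem diagEquiv_of_map (h2 : (2 : F) ≠ 0) {n : ℕ} {a b : Fin n → F} (ha : ∀ i, a i ≠ 0)
    (T : (Fin n → F) →ₗ[F] (Fin n → F)) (hT : ∀ x, diagForm b (T x) = diagForm a x) :
    ∃ φ : (Fin n → F) ≃ₗ[F] (Fin n → F), ∀ x, diagForm b (φ x) = diagForm a x := by
  have hinj : Function.Injective T := by
    rw [← LinearMap.ker_eq_bot, LinearMap.ker_eq_bot']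
    intro x hx
    ext i
    have h := diagPolar_map T hT x (Pi.single i 1)
    rw [hx, diagPolar_single] at h
    have h' : 2 * a i * x i = 0 := by rw [← h]; simp [diagPolar]
    simpa [h2, ha i] using h'
  exact ⟨LinearEquiv.ofInjectiveEndo _ hinj, fun x => by
    rw [LinearEquiv.coe_ofInjectiveEndo, hT]⟩

theorem exists_diag (h2 : (2 : F) ≠ 0)
    {V : Type*} [AddCommGroup V] [Module F V] [FiniteDimensional F V]
    (B : LinearMap.BilinForm F V) (hs : ∀ x y, B x y = B y x)
    (hn : ∀ x, (∀ y, B x y = 0) → x = 0) {n : ℕ} (hd : Module.finrank F V = n) :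
    ∃ a : Fin n → F, (∀ i, a i ≠ 0) ∧
      ∃ φ : (Fin n → F) ≃ₗ[F] V, ∀ x, B (φ x) (φ x) = diagForm a x := by
  subst hd
  let _ := invertibleOfNonzero h2
  obtain ⟨v, hv⟩ := LinearMap.BilinForm.exists_orthogonal_basis (B := B) ⟨fun x y => hs x y⟩
  refine ⟨fun i => B (v i) (v i), fun i => ?_, v.equivFun.symm, fun x => ?_⟩
  · exact hv.not_isOrtho_basis_self_of_separatingLeft (fun x hx => hn x hx) i
  · rw [v.equivFun_symm_apply]
    simp only [map_sum, map_smul, LinearMap.sum_apply, LinearMap.smul_apply, smul_eq_mul, diagForm]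
    refine Finset.sum_congr rfl fun i _ => ?_
    rw [Finset.sum_eq_single i]
    · ring
    · intro j _ hji
      rw [show B (v j) (v i) = 0 from hv hji]
      ring
    · simp

theorem exists_split (h2 : (2 : F) ≠ 0)
    {n : ℕ} {a : Fin (n + 1) → F} (ha : ∀ i, a i ≠ 0) {x : Fin (n + 1) → F}
    (hx : diagForm a x ≠ 0) :
    ∃ a' : Fin n → F, (∀ i, a' i ≠ 0) ∧ ∃ φ : (Fin (n + 1) → F) ≃ₗ[F] (Fin (n + 1) → F),
      ∀ y, diagForm a (φ y) = diagForm (Fin.cons (diagForm a x) a' : Fin (n + 1) → F) y := by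
  let B : LinearMap.BilinForm F (Fin (n + 1) → F) := LinearMap.mk₂ F (fun x y => ∑ i, a i * x i * y i)
    (fun x x' y => by simp [mul_add, add_mul, Finset.sum_add_distrib])
    (fun c x y => by
      simp only [Pi.smul_apply, smul_eq_mul, Finset.mul_sum]
      exact Finset.sum_congr rfl fun i _ => by ring)
    (fun x x' y => by simp [mul_add, Finset.sum_add_distrib])
    (fun c x y => by
      simp only [Pi.smul_apply, smul_eq_mul, Finset.mul_sum]
      exact Finset.sum_congr rfl fun i _ => by ring)
  have hB : ∀ x y, B x y = ∑ i, a i * x i * y i := fun x y => rfl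
  have hBs : ∀ x y, B x y = B y x := fun x y => by
    rw [hB, hB]; exact Finset.sum_congr rfl fun i _ => by ring
  have hBq : ∀ x, B x x = diagForm a x := fun x => by
    rw [hB]; exact Finset.sum_congr rfl fun i _ => by ring
  have hBn : ∀ x, (∀ y, B x y = 0) → x = 0 := fun x h => by
    ext i
    have := h (Pi.single i 1)
    rw [hB] at this
    simpa [Pi.single_apply, ha i] using this
  rw [← hBq] at hx ⊢
  let W := LinearMap.ker (B x)
  have hW : Module.finrank F W = n := by
    have h1 := LinearMap.finrank_range_add_finrank_ker (B x)
    rw [LinearMap.range_eq_top.2 (LinearMap.surjective (fun h => hx (by rw [h]; rfl))), finrank_top,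
      Module.finrank_self, Module.finrank_pi, Fintype.card_fin, add_comm] at h1
    exact Nat.succ_injective h1
  let BW : LinearMap.BilinForm F W := B.compl₁₂ W.subtype W.subtype
  obtain ⟨a', ha', φ, hφ⟩ := exists_diag h2 BW (fun u v => hBs _ _) (fun u hu => by
    refine Subtype.ext (hBn _ fun v => ?_)
    have h0 : B u x = 0 := (hBs _ _).trans u.2
    have hv : v - (B x v / B x x) • x ∈ W := by
      rw [LinearMap.mem_ker, map_sub, map_smul, smul_eq_mul, div_mul_cancel₀ _ hx, sub_self]
    have := hu ⟨_, hv⟩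
    change B u (v - (B x v / B x x) • x) = 0 at this
    rwa [map_sub, map_smul, h0, smul_zero, sub_zero] at this) hW
  let T : (Fin (n + 1) → F) →ₗ[F] (Fin (n + 1) → F) :=
    (LinearMap.proj 0).smulRight x + W.subtype ∘ₗ φ.toLinearMap ∘ₗ
      LinearMap.pi fun i => LinearMap.proj i.succ
  refine ⟨a', ha', diagEquiv_of_map h2 (fun i => ?_) T fun y => ?_⟩
  · refine Fin.cases hx (fun i => ?_) i
    simpa using ha' i
  · have hT : T y = y 0 • x + (φ fun i => y i.succ : Fin (n + 1) → F) := rfl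
    set w := φ fun i => y i.succ with hw
    have h0 : B x w = 0 := w.2
    have hww : B w w = diagForm a' fun i => y i.succ := hφ _
    rw [← hBq, hT]
    simp only [map_add, map_smul, LinearMap.add_apply, LinearMap.smul_apply, h0, hBs w x, hww]
    simp [diagForm, Fin.sum_univ_succ]
    ring

theorem diagEquiv_det (h2 : (2 : F) ≠ 0)
    {n : ℕ} {a b : Fin n → F} (φ : (Fin n → F) ≃ₗ[F] (Fin n → F))
    (hφ : ∀ x, diagForm b (φ x) = diagForm a x) : ∃ c, c ≠ 0 ∧ ∏ i, a i = (∏ i, b i) * c ^ 2 := by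
  classical
  let M := LinearMap.toMatrix' φ.toLinearMap
  have hMa : ∀ l i, M l i = φ.toLinearMap (Pi.single i 1) l := fun l i => by
    simp [M, LinearMap.toMatrix'_apply, Pi.single]
  have hM : M.transpose * Matrix.diagonal b * M = Matrix.diagonal a := by
    ext i j
    have h := diagPolar_map φ.toLinearMap hφ (Pi.single i 1) (Pi.single j 1)
    rw [diagPolar_single] at h
    have h' : diagPolar b (φ.toLinearMap (Pi.single i 1)) (φ.toLinearMap (Pi.single j 1))
        = 2 * (M.transpose * Matrix.diagonal b * M) i j := by
      rw [Matrix.mul_apply, Finset.mul_sum]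
      refine Finset.sum_congr rfl fun l _ => ?_
      rw [Matrix.mul_diagonal, Matrix.transpose_apply, hMa, hMa]
      ring
    rw [h'] at h
    refine mul_left_cancel₀ h2 (h.trans ?_)
    rw [Matrix.diagonal_apply, Pi.single_apply]
    by_cases hij : j = i
    · subst hij; simp
    · simp [hij, Ne.symm hij]
  refine ⟨M.det, ?_, ?_⟩
  · rw [LinearMap.det_toMatrix']
    exact (LinearEquiv.isUnit_det' φ).ne_zero
  · have := congrArg Matrix.det hM
    rw [Matrix.det_mul, Matrix.det_mul, Matrix.det_transpose, Matrix.det_diagonal,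
      Matrix.det_diagonal] at this
    rw [← this]; ring

theorem exists_diagForm_eq_of_isotropic (h2 : (2 : F) ≠ 0)
    {n : ℕ} {a : Fin n → F} (ha : ∀ i, a i ≠ 0)
    {x : Fin n → F} (hx : x ≠ 0) (h : diagForm a x = 0) (c : F) : ∃ y, diagForm a y = c := by
  obtain ⟨i, hi⟩ := Function.ne_iff.1 hx
  have hp : diagPolar a x (Pi.single i 1) ≠ 0 := by
    rw [diagPolar_single]
    exact mul_ne_zero (mul_ne_zero h2 (ha i)) hi
  refine ⟨((c - diagForm a (Pi.single i 1)) / diagPolar a x (Pi.single i 1)) • x + Pi.single i 1, ?_⟩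
  rw [diagForm_add, diagForm_smul, h, diagPolar_smul_left, div_mul_cancel₀ _ hp]
  ring

end DiagAlgebra

section Dichotomy

variable {K : Type*} [NontriviallyNormedField K] [IsUltrametricDist K] [ProperSpace K]
  [MeasurableSpace K] [BorelSpace K]

theorem gaussVal_mul_sq {ψ : K → ℂ} (hψ : IsSmoothChar ψ) (h2 : (2 : K) ≠ 0) {a s : K}
    (ha : a ≠ 0) (hs : s ≠ 0) : PosRel (gaussVal ψ (a * s ^ 2)) (gaussVal ψ a) := by
  have h := gaussVal_prod_eq_of_equiv hψ h2 (a := fun _ : Fin 1 => a * s ^ 2)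
    (b := fun _ : Fin 1 => a) (fun _ => mul_ne_zero ha (pow_ne_zero _ hs)) (fun _ => ha)
    (LinearEquiv.smulOfNeZero K _ s hs) fun x => by
      rw [LinearEquiv.smulOfNeZero_apply, diagForm_smul]
      simp [diagForm]
      ring
  simpa using h

/-- Two nondegenerate diagonal forms of the same rank and determinant are either isometric or
have Gauss sums pointing in opposite directions. -/
theorem diag_dichotomy {ψ : K → ℂ} (hψ : IsSmoothChar ψ) (h2 : (2 : K) ≠ 0) {n : ℕ}
    (a b : Fin n → K) (ha : ∀ i, a i ≠ 0) (hb : ∀ i, b i ≠ 0)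
    (hab : ∃ c, c ≠ 0 ∧ ∏ i, a i = (∏ i, b i) * c ^ 2) :
    (∃ φ : (Fin n → K) ≃ₗ[K] (Fin n → K), ∀ x, diagForm b (φ x) = diagForm a x) ∨
      PosRel ((∏ i, gaussVal ψ (a i)) * conj (∏ i, gaussVal ψ (b i))) (-1) := by
  induction n with
  | zero => exact .inl ⟨LinearEquiv.refl K _, fun x => by simp [diagForm]⟩
  | succ n ih =>
    by_cases hcv : ∃ x y, diagForm a x = diagForm b y ∧ diagForm b y ≠ 0
    · obtain ⟨x, y, hxy, hy⟩ := hcv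
      obtain ⟨a', ha', φ, hφ⟩ := exists_split h2 ha (hxy ▸ hy)
      obtain ⟨b', hb', χ, hχ⟩ := exists_split h2 hb hy
      rw [hxy] at hφ
      generalize diagForm b y = c at *
      have hca : ∀ i, (Fin.cons c a' : Fin (n + 1) → K) i ≠ 0 :=
        Fin.cases (by simpa using hy) (by simpa using ha')
      have hcb : ∀ i, (Fin.cons c b' : Fin (n + 1) → K) i ≠ 0 :=
        Fin.cases (by simpa using hy) (by simpa using hb')
      obtain ⟨d, hd, hd'⟩ := diagEquiv_det h2 φ hφ
      obtain ⟨e, he, he'⟩ := diagEquiv_det h2 χ hχ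
      obtain ⟨f, hf, hf'⟩ := hab
      rw [Fin.prod_univ_succ (fun i => (Fin.cons c a' : Fin (n + 1) → K) i)] at hd'
      rw [Fin.prod_univ_succ (fun i => (Fin.cons c b' : Fin (n + 1) → K) i)] at he'
      simp only [Fin.cons_zero, Fin.cons_succ] at hd' he'
      obtain h | h := ih a' b' ha' hb' ⟨d * f / e, by positivity, by
        refine mul_left_cancel₀ hy ?_
        rw [hd', hf']
        field_simp
        linear_combination -he'⟩
      · left
        obtain ⟨ω, hω⟩ := h
        let T : (Fin (n + 1) → K) →ₗ[K] (Fin (n + 1) → K) :=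
          LinearMap.pi (Fin.cons (LinearMap.proj 0) fun i =>
            LinearMap.proj i ∘ₗ ω.toLinearMap ∘ₗ LinearMap.pi fun i => LinearMap.proj i.succ)
        obtain ⟨τ, hτ⟩ := diagEquiv_of_map (a := (Fin.cons c a' : Fin (n + 1) → K))
          (b := (Fin.cons c b' : Fin (n + 1) → K)) h2 hca T fun x => by
            have := hω fun i => x i.succ
            simp only [diagForm] at this
            simp [diagForm, Fin.sum_univ_succ, T]
            exact this
        exact ⟨φ.symm.trans (τ.trans χ), fun x => by
          simp only [LinearEquiv.trans_apply]
          rw [hχ, hτ, ← hφ, LinearEquiv.apply_symm_apply]⟩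
      · right
        have h1 := gaussVal_prod_eq_of_equiv hψ h2 hca ha φ hφ
        have h2' := gaussVal_prod_eq_of_equiv hψ h2 hcb hb χ hχ
        refine (h1.symm.mul h2'.symm.star).trans ?_
        rw [Fin.prod_univ_succ, Fin.prod_univ_succ]
        simp only [Fin.cons_zero, Fin.cons_succ, map_mul]
        have := (PosRel.mul_conj_self (gaussVal_ne_zero hψ h2 hy)).mul h
        rw [map_prod, one_mul] at this
        convert this using 1
        rw [map_prod]
        ring
    · push Not at hcv
      have hcv' : ∀ x y, diagForm a x = diagForm b y → diagForm a x = 0 := fun x y h =>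
        h.trans (hcv x y h)
      obtain rfl | rfl | hn : n = 0 ∨ n = 1 ∨ 2 ≤ n := by omega
      · obtain ⟨c, hc, hc'⟩ := hab
        simp only [Nat.reduceAdd, Fin.prod_univ_one] at hc'
        refine absurd ?_ (ha 0)
        have := hcv' (Pi.single 0 1) (Pi.single 0 c) (by
          rw [diagForm_single]; simpa [diagForm] using hc')
        rwa [diagForm_single] at this
      · right
        obtain ⟨e, he, he'⟩ := hab
        simp only [Nat.reduceAdd, Fin.prod_univ_two] at he'
        have hb0 : ∀ x, diagForm a x ≠ b 0 := fun x h => hb 0 (by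
          rw [← diagForm_single b 0] at h
          rw [← diagForm_single b 0, ← h]
          exact hcv' _ _ h)
        have hA : ∀ x y, a 0 * x ^ 2 + a 1 * y ^ 2 ≠ b 0 := fun x y h =>
          hb0 ![x, y] (by simpa [diagForm, Fin.sum_univ_two] using h)
        have ha0 := ha 0
        have ha1 := ha 1
        have hns : ¬ IsSquare (-(a 1 / a 0)) := by
          rintro ⟨s, hs⟩
          have hs' : a 1 = -(a 0 * s ^ 2) := by field_simp at hs; linear_combination -hs
          have hs0 : s ≠ 0 := by rintro rfl; exact ha1 (by rw [hs']; ring)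
          obtain ⟨y, hy⟩ := exists_diagForm_eq_of_isotropic h2 ha (x := ![s, 1])
            (fun h => one_ne_zero (congrFun h 1)) (by
              simp only [diagForm, Nat.reduceAdd, Fin.sum_univ_two, Matrix.cons_val_zero,
                Matrix.cons_val_one, hs']
              ring) (b 0)
          exact hb0 y hy
        have h := gaussVal_quaternion hψ h2 (a := -(a 1 / a 0)) (l := b 0 / a 0) (c := a 0) hns
          (div_ne_zero (hb 0) ha0) (fun x y h => hA x y (by field_simp at h; linear_combination h))
          ha0
        have e1 : -(-(a 1 / a 0) * a 0) = a 1 := by field_simp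
        have e2 : -(a 0 * (b 0 / a 0)) = -b 0 := by field_simp
        have e3 : -(a 1 / a 0) * a 0 * (b 0 / a 0) = -b 1 * (b 0 * e / a 0) ^ 2 := by
          field_simp
          linear_combination (-(b 0)) * he'
        rw [e1, e2, e3] at h
        simp only [Nat.reduceAdd, Fin.prod_univ_two, map_mul]
        refine PosRel.trans ?_ h
        rw [mul_assoc (_ * _)]
        refine (PosRel.refl _).mul ((gaussVal_neg hψ h2 (hb 0)).symm.mul ?_)
        refine (gaussVal_neg hψ h2 (hb 1)).symm.trans (gaussVal_mul_sq hψ h2 (neg_ne_zero.2 (hb 1)) ?_).symm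
        exact div_ne_zero (mul_ne_zero (hb 0) he) ha0
      · exfalso
        have hnz : ∃ x y, diagForm a x = diagForm b y ∧ (x ≠ 0 ∨ y ≠ 0) := by
          by_contra! hcon
          have : DiagAnisotropic (Fin.append a fun i => -b i) := fun x hx => by
            rw [diagForm_append] at hx
            have hneg : ∀ y, diagForm (fun i => -b i) y = -diagForm b y := fun y => by
              simp [diagForm]
            rw [hneg] at hx
            obtain ⟨h1, h2⟩ := hcon _ _ (add_neg_eq_zero.1 hx)
            ext i
            exact Fin.addCases (congrFun h1) (congrFun h2) i
          have := this.dim_le_four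
          omega
        obtain ⟨x, y, hxy, h⟩ := hnz
        obtain h | h := h
        · obtain ⟨x', hx'⟩ := exists_diagForm_eq_of_isotropic h2 ha h (hcv' _ _ hxy) (b 0)
          rw [← diagForm_single b 0] at hx'
          exact hb 0 (by rw [← diagForm_single b 0]; exact hcv _ _ hx')
        · obtain ⟨y', hy'⟩ := exists_diagForm_eq_of_isotropic h2 hb h (hcv _ _ hxy) (a 0)
          rw [← diagForm_single a 0] at hy'
          exact ha 0 (by rw [← diagForm_single a 0]; exact hcv' _ _ hy'.symm)

end Dichotomy

theorem Valuation.isRankOneDiscrete_of_surjective {k : Type*} [Field k]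
    (v : Valuation k (WithZero (Multiplicative ℤ))) (hv : Function.Surjective v) :
    v.IsRankOneDiscrete := by
  refine ⟨⟨Units.mk0 (WithZero.exp (-1 : ℤ)) WithZero.exp_ne_zero, ?_, ?_⟩⟩
  · trans ⊤
    · rw [Subgroup.eq_top_iff']
      intro x
      refine Subgroup.mem_zpowers_iff.2 ⟨-WithZero.log (x : WithZero (Multiplicative ℤ)), ?_⟩
      ext
      simp
    · symm
      rw [Subgroup.eq_top_iff']
      intro x
      obtain ⟨y, hy⟩ := hv x
      exact Subgroup.subset_closure ⟨y, hy⟩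
  · rw [← Units.val_lt_val, Units.val_mk0, Units.val_one, ← WithZero.exp_zero]
    exact WithZero.exp_lt_exp.2 (by norm_num)

/-- The character `q ↦ exp (2πiq)` of `ℚ/ℤ`. -/
def ratCircle : AddCircle (1 : ℚ) →+ Additive Circle :=
  QuotientAddGroup.lift (AddSubgroup.zmultiples (1 : ℚ))
    { toFun := fun q => Additive.ofMul (Circle.exp (2 * Real.pi * q))
      map_zero' := by simp
      map_add' := fun x y => by
        rw [← ofMul_mul, ← Circle.exp_add]; push_cast; ring_nf }
    (by
      rintro x ⟨n, rfl⟩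
      rw [AddMonoidHom.mem_ker]
      change Additive.ofMul (Circle.exp _) = Additive.ofMul 1
      congr 1
      simp only [zsmul_eq_mul, mul_one, Rat.cast_intCast]
      rw [mul_comm]
      exact Circle.exp_int_mul_two_pi n)

theorem ratCircle_eq_zero {x : AddCircle (1 : ℚ)} (h : ratCircle x = 0) : x = 0 := by
  obtain ⟨q, rfl⟩ := QuotientAddGroup.mk_surjective x
  change Additive.ofMul (Circle.exp (2 * Real.pi * q)) = Additive.ofMul 1 at h
  obtain ⟨n, hn⟩ := Circle.exp_eq_one.1 (Additive.ofMul.injective h)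
  rw [QuotientAddGroup.eq_zero_iff]
  refine ⟨n, ?_⟩
  have : (q : ℝ) = n := by
    have := Real.pi_ne_zero
    field_simp at hn
    linarith
  simp
  exact_mod_cast this.symm

theorem exists_isSmoothChar (K : Type*) [NontriviallyNormedField K] [IsUltrametricDist K] :
    ∃ ψ : K → ℂ, IsSmoothChar ψ := by
  let U := ballSubgroup K 1 zero_le_one
  obtain ⟨x, hx⟩ := NontriviallyNormedField.non_trivial (α := K)
  have hxU : (QuotientAddGroup.mk x : K ⧸ U) ≠ 0 := fun h => by
    rw [QuotientAddGroup.eq_zero_iff] at h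
    have : ‖x‖ ≤ 1 := mem_closedBall_zero_iff.1 (show x ∈ closedBall (0 : K) 1 from h)
    linarith
  obtain ⟨c, hc⟩ := CharacterModule.exists_character_apply_ne_zero_of_ne_zero hxU
  refine ⟨fun y => ((ratCircle (c (QuotientAddGroup.mk y : K ⧸ U))).toMul : Circle), ?_, ?_, ?_, ?_⟩
  · intro a b
    rw [QuotientAddGroup.mk_add, map_add, map_add, toMul_add, Circle.coe_mul]
  · intro a
    exact Circle.norm_coe _
  · refine ⟨1, one_pos, fun y hy => ?_⟩
    have : (QuotientAddGroup.mk y : K ⧸ U) = 0 := by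
      rw [QuotientAddGroup.eq_zero_iff]
      exact (mem_closedBall_zero_iff.2 hy : y ∈ closedBall (0 : K) 1)
    rw [this, map_zero, map_zero, toMul_zero, Circle.coe_one]
  · refine ⟨x, fun h => hc (ratCircle_eq_zero ?_)⟩
    exact Additive.toMul.injective (Circle.coe_injective (h.trans Circle.coe_one.symm))

section Transfer

variable {k : Type*} [NontriviallyNormedField k] [IsUltrametricDist k] [ProperSpace k]
  [MeasurableSpace k] [BorelSpace k]

theorem IsSmoothChar.comp_linearMap {K : Type*} [NontriviallyNormedField K] [NormedAlgebra k K]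
    [FiniteDimensional k K] {ψ : k → ℂ} (hψ : IsSmoothChar ψ) {σ : K →ₗ[k] k} (hσ : σ ≠ 0) :
    IsSmoothChar (fun x => ψ (σ x)) where
  add x y := by rw [map_add, hψ.add]
  norm x := hψ.norm _
  loc := by
    obtain ⟨ε, hε, h⟩ := hψ.loc
    have hc : Continuous σ := LinearMap.continuous_of_finiteDimensional σ
    obtain ⟨δ, hδ, hd⟩ := Metric.continuous_iff.1 hc 0 ε hε
    refine ⟨δ / 2, by positivity, fun x hx => h _ ?_⟩
    have := hd x (by rw [dist_zero_right]; linarith)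
    rw [map_zero, dist_zero_right] at this
    exact this.le
  nontriv := by
    obtain ⟨y, hy⟩ := hψ.nontriv
    obtain ⟨x, rfl⟩ := LinearMap.surjective hσ y
    exact ⟨x, hy⟩

theorem gaussVal_transfer {K : Type*} [NontriviallyNormedField K] [NormedAlgebra k K]
    [FiniteDimensional k K] [IsUltrametricDist K] [ProperSpace K] [MeasurableSpace K]
    [BorelSpace K] {ψ : k → ℂ} (hψ : IsSmoothChar ψ) (h2 : (2 : k) ≠ 0) (h2' : (2 : K) ≠ 0)
    {σ : K →ₗ[k] k} (hσ : σ ≠ 0) {a c : K} (ha : a ≠ 0) (hc : c ≠ 0) {m : ℕ} {α : Fin m → k}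
    (hα : ∀ i, α i ≠ 0) (φ : (Fin m → k) ≃ₗ[k] K × K)
    (h : ∀ x, σ (c * ((φ x).1 ^ 2 - a * (φ x).2 ^ 2)) = diagForm α x) :
    PosRel (∏ i, gaussVal ψ (α i))
      (gaussVal (fun x => ψ (σ x)) c * gaussVal (fun x => ψ (σ x)) (-(a * c))) := by
  obtain ⟨z, hz⟩ := gaussVal_diag_exists hψ h2 α hα
  refine (GaussVal.posRel_prod hψ h2 α hα hz).symm.trans ?_
  have hψK := hψ.comp_linearMap (K := K) hσ
  refine GaussVal.prod (gaussVal_spec hψK h2' hc)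
    (gaussVal_spec hψK h2' (neg_ne_zero.2 (mul_ne_zero ha hc))) ?_
  have := hz.comp φ.symm.toAddEquiv (LinearMap.continuous_of_finiteDimensional φ.symm.toLinearMap)
    (LinearMap.continuous_of_finiteDimensional φ.toLinearMap)
  convert this using 2 with p
  change _ = ψ (diagForm α (φ.symm p))
  rw [← h, LinearEquiv.apply_symm_apply, ← hψ.add, ← map_add]
  ring_nf

theorem exists_twist_of_normed {K : Type*} [NontriviallyNormedField K] [NormedAlgebra k K]
    [FiniteDimensional k K] [IsUltrametricDist K] [ProperSpace K] [MeasurableSpace K]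
    [BorelSpace K] {ψ : k → ℂ} (hψ : IsSmoothChar ψ) (h2 : (2 : k) ≠ 0) (h2' : (2 : K) ≠ 0)
    {σ : K →ₗ[k] k} (hσ : σ ≠ 0) {a : K} (ha : ¬ IsSquare a) :
    ∃ l : K, l ≠ 0 ∧ ∀ (m : ℕ) (α β : Fin m → k), (∀ i, α i ≠ 0) → (∀ i, β i ≠ 0) →
      ∀ φ χ : (Fin m → k) ≃ₗ[k] K × K,
      (∀ x, σ ((φ x).1 ^ 2 - a * (φ x).2 ^ 2) = diagForm α x) →
      (∀ x, σ (l * ((χ x).1 ^ 2 - a * (χ x).2 ^ 2)) = diagForm β x) →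
      PosRel ((∏ i, gaussVal ψ (α i)) * conj (∏ i, gaussVal ψ (β i))) (-1) := by
  have hψK := hψ.comp_linearMap (K := K) hσ
  have ha0 : a ≠ 0 := by rintro rfl; exact ha ⟨0, by simp⟩
  obtain ⟨l, hl0, hl⟩ := exists_non_norm hψK h2' ha
  refine ⟨l, hl0, fun m α β hα hβ φ χ hφ hχ => ?_⟩
  have h1 := gaussVal_transfer hψ h2 h2' hσ ha0 one_ne_zero hα φ (by simpa using hφ)
  have h3 := gaussVal_transfer hψ h2 h2' hσ ha0 hl0 hβ χ hχ
  refine (h1.mul h3.star).trans (PosRel.trans ?_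
    (gaussVal_quaternion hψK h2' ha hl0 hl one_ne_zero))
  have e1 := (gaussVal_neg hψK h2' hl0).symm
  have e2 := (gaussVal_neg hψK h2' (neg_ne_zero.2 (mul_ne_zero ha0 hl0))).symm
  rw [neg_neg] at e2
  have := (PosRel.refl (gaussVal (fun x => ψ (σ x)) 1 *
    gaussVal (fun x => ψ (σ x)) (-(a * 1)))).mul (e1.mul e2)
  simpa [mul_assoc] using this

/-- Scaling the norm form `x ^ 2 - a * y ^ 2` by a suitable `l` reverses the sign of the Gauss sum
of its transfer to the base field. -/
theorem exists_twist {K : Type*} [Field K] [Algebra k K]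
    [FiniteDimensional k K] {ψ : k → ℂ} (hψ : IsSmoothChar ψ) (h2 : (2 : k) ≠ 0)
    {σ : K →ₗ[k] k} (hσ : σ ≠ 0) {a : K} (ha : ¬ IsSquare a) :
    ∃ l : K, l ≠ 0 ∧ ∀ (m : ℕ) (α β : Fin m → k), (∀ i, α i ≠ 0) → (∀ i, β i ≠ 0) →
      ∀ φ χ : (Fin m → k) ≃ₗ[k] K × K,
      (∀ x, σ ((φ x).1 ^ 2 - a * (φ x).2 ^ 2) = diagForm α x) →
      (∀ x, σ (l * ((χ x).1 ^ 2 - a * (χ x).2 ^ 2)) = diagForm β x) →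
      PosRel ((∏ i, gaussVal ψ (α i)) * conj (∏ i, gaussVal ψ (β i))) (-1) := by
  have h2' : (2 : K) ≠ 0 := by
    have := (map_ne_zero (algebraMap k K)).2 h2
    rwa [map_ofNat] at this
  let := spectralNorm.nontriviallyNormedField k K
  let : NormedAlgebra k K := spectralNorm.normedAlgebra k K
  have : IsUltrametricDist K :=
    IsUltrametricDist.isUltrametricDist_of_isNonarchimedean_norm
      (isNonarchimedean_spectralNorm (K := k) (L := K))
  have : ProperSpace K := FiniteDimensional.proper k K
  let : MeasurableSpace K := borel K
  have : BorelSpace K := ⟨rfl⟩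
  exact exists_twist_of_normed hψ h2 h2' hσ ha

end Transfer

section Skew

variable {F : Type*} [Field F]

open Matrix

/-- The determinant of a skew-symmetric matrix is a square. -/
theorem Matrix.exists_det_eq_sq_of_transpose_eq_neg (h2 : (2 : F) ≠ 0) :
    ∀ (n : ℕ) (S : Matrix (Fin n) (Fin n) F), Sᵀ = -S → ∃ c, S.det = c ^ 2 := by
  intro n
  induction n using Nat.strong_induction_on with
  | _ n ih =>
  intro S hS
  have hS' : ∀ i j, S i j = -S j i := fun i j => congrFun (congrFun hS j) i
  have hd : ∀ i, S i i = 0 := fun i => by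
    have := hS' i i
    have h : 2 * S i i = 0 := by linear_combination this
    exact (mul_eq_zero.1 h).resolve_left h2
  match n, S, hS, hS', hd with
  | 0, S, _, _, _ => exact ⟨1, by simp⟩
  | 1, S, _, _, hd => exact ⟨0, by simp [hd]⟩
  | m + 2, S, hS, hS', hd =>
    by_cases hrow : ∀ j, S 0 j = 0
    · exact ⟨0, by rw [det_eq_zero_of_row_eq_zero 0 hrow]; simp⟩
    push Not at hrow
    obtain ⟨j, hj⟩ := hrow
    have hj0 : j ≠ 0 := by rintro rfl; exact hj (hd 0)
    let e : Fin 2 ⊕ Fin m ≃ Fin (m + 2) :=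
      (finSumFinEquiv.trans (finCongr (add_comm 2 m))).trans (Equiv.swap 1 j)
    have e0 : e (Sum.inl 0) = 0 := by
      change Equiv.swap 1 j 0 = 0
      exact Equiv.swap_apply_of_ne_of_ne (by simp) hj0.symm
    have e1 : e (Sum.inl 1) = j := by
      change Equiv.swap 1 j 1 = j
      exact Equiv.swap_apply_left _ _
    let R := S.submatrix e e
    have hR : R.det = S.det := det_submatrix_equiv_self e S
    have hRt : ∀ x y, R x y = - R y x := fun x y => hS' _ _
    let A : Matrix (Fin 2) (Fin 2) F := !![0, S 0 j; -S 0 j, 0]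
    let A' : Matrix (Fin 2) (Fin 2) F := !![0, -(S 0 j)⁻¹; (S 0 j)⁻¹, 0]
    have hAA : A' * A = 1 := by
      ext a b; fin_cases a <;> fin_cases b <;> simp [A, A', hj]
    have hA : R.toBlocks₁₁ = A := by
      ext a b
      fin_cases a <;> fin_cases b
      · exact hd _
      · change S (e (Sum.inl 0)) (e (Sum.inl 1)) = S 0 j
        rw [e0, e1]
      · change S (e (Sum.inl 1)) (e (Sum.inl 0)) = -S 0 j
        rw [e0, e1, hS']
      · exact hd _
    let inst : Invertible A := ⟨A', hAA, mul_eq_one_comm.1 hAA⟩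
    have hinv : ⅟A = A' := rfl
    rw [← hR, ← fromBlocks_toBlocks R, hA, det_fromBlocks₁₁, hinv]
    have h21 : R.toBlocks₂₁ = -R.toBlocks₁₂ᵀ := by
      ext a b; exact hRt _ _
    have h22 : R.toBlocks₂₂ᵀ = -R.toBlocks₂₂ := by
      ext a b; exact hRt _ _
    have hA't : A'ᵀ = -A' := by
      ext a b; fin_cases a <;> fin_cases b <;> simp [A']
    obtain ⟨c, hc⟩ := ih m (by omega) (R.toBlocks₂₂ - R.toBlocks₂₁ * A' * R.toBlocks₁₂) (by
      rw [h21, transpose_sub, h22, transpose_mul, transpose_mul, hA't, transpose_neg,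
        transpose_transpose]
      simp only [Matrix.neg_mul, Matrix.mul_neg, Matrix.mul_assoc, neg_neg, sub_neg_eq_add,
        neg_add_rev]
      abel)
    refine ⟨S 0 j * c, ?_⟩
    rw [hc]
    simp [A, det_fin_two]
    ring

theorem Matrix.exists_det_gram_eq (h2 : (2 : F) ≠ 0) {n : ℕ} {G T : Matrix (Fin n) (Fin n) F}
    (hG : Gᵀ = G) (hG0 : G.det ≠ 0) (hT : Tᵀ * G * T = G)
    (hF : (T - 1).det * (T + 1).det ≠ 0) :
    ∃ c, c ≠ 0 ∧ G.det = (T - 1).det * (T + 1).det * c ^ 2 := by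
  have hT1 : T.det = 1 := by
    have h : (1 + Tᵀ) * G * T = G * (T + 1) := by
      rw [Matrix.add_mul, Matrix.add_mul, hT]; noncomm_ring
    have h' := congrArg det h
    have h3 : (1 + Tᵀ).det = (T + 1).det := by
      rw [← det_transpose]; simp [add_comm]
    rw [det_mul, det_mul, det_mul, h3] at h'
    have h4 : (G.det * (T + 1).det) * T.det = (G.det * (T + 1).det) * 1 := by
      linear_combination h'
    exact mul_left_cancel₀ (mul_ne_zero hG0 (right_ne_zero_of_mul hF)) h4
  obtain ⟨c, hc⟩ := Matrix.exists_det_eq_sq_of_transpose_eq_neg h2 n (G * T - Tᵀ * G) (by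
    rw [transpose_sub, transpose_mul, transpose_mul, transpose_transpose, hG]; abel)
  have h5 : (G * T - Tᵀ * G) * T = G * ((T - 1) * (T + 1)) := by
    rw [Matrix.sub_mul, hT]; noncomm_ring
  have h6 := congrArg det h5
  rw [det_mul, hc, hT1, mul_one, det_mul, det_mul] at h6
  set p := (T - 1).det * (T + 1).det
  refine ⟨c / p, div_ne_zero ?_ hF, ?_⟩
  · rintro rfl
    exact mul_ne_zero hG0 hF (by rw [← h6]; simp)
  · field_simp
    linear_combination -h6

end Skew

section DetOf

variable {F : Type} [Field F] {V : Type} [AddCommGroup V] [Module F V] [FiniteDimensional F V]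

theorem exists_detOf_eq (B : LinearMap.BilinForm F V) {ι : Type*} [Fintype ι] [DecidableEq ι]
    (b : Module.Basis ι F V) :
    ∃ c, c ≠ 0 ∧ (LinearMap.toMatrix₂ b b B).det = detOf B * c ^ 2 := by
  let b' := b.reindex (Fintype.equivOfCardEq (β := Fin (Module.finrank F V))
    (by rw [Fintype.card_fin, Module.finrank_eq_card_basis b]))
  have h : (LinearMap.toMatrix₂ b' b' B).det = (LinearMap.toMatrix₂ b b B).det := by
    rw [← Matrix.det_submatrix_equiv_self (Fintype.equivOfCardEq (β := Fin (Module.finrank F V))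
      (by rw [Fintype.card_fin, Module.finrank_eq_card_basis b]) : ι ≃ _)]
    congr 1
    ext i j
    simp [b', LinearMap.toMatrix₂_apply]
  have h2 := LinearMap.toMatrix₂_mul_basis_toMatrix (Module.finBasis F V) (Module.finBasis F V)
    b' b' B
  refine ⟨((Module.finBasis F V).toMatrix b').det, ?_, ?_⟩
  · have := Module.Basis.toMatrix_mul_toMatrix_flip (Module.finBasis F V) b'
    exact left_ne_zero_of_mul_eq_one (by rw [← Matrix.det_mul, this, Matrix.det_one])
  · rw [← h, ← h2, Matrix.det_mul, Matrix.det_mul, Matrix.det_transpose, detOf, gramOf]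
    ring

theorem IsQuadraticSpace.detOf_ne_zero {B : LinearMap.BilinForm F V} (hB : IsQuadraticSpace B) :
    detOf B ≠ 0 :=
  (LinearMap.separatingLeft_iff_det_ne_zero (Module.finBasis F V)).1 hB.2

theorem bilin_eq_of_diag (h2 : (2 : F) ≠ 0) {B : LinearMap.BilinForm F V}
    (hs : ∀ x y, B x y = B y x) {n : ℕ} {a : Fin n → F} (φ : (Fin n → F) →ₗ[F] V)
    (hφ : ∀ x, B (φ x) (φ x) = diagForm a x) (x y : Fin n → F) :
    B (φ x) (φ y) = ∑ i, a i * x i * y i := by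
  have h := hφ (x + y)
  rw [diagForm_add, ← hφ x, ← hφ y] at h
  simp only [map_add, LinearMap.add_apply, hs (φ y) (φ x)] at h
  have h3 : 2 * B (φ x) (φ y) = 2 * ∑ i, a i * x i * y i := by
    have : diagPolar a x y = 2 * ∑ i, a i * x i * y i := by
      rw [diagPolar, Finset.mul_sum]
      exact Finset.sum_congr rfl fun i _ => by ring
    rw [← this]
    linear_combination h
  exact mul_left_cancel₀ h2 h3

theorem exists_prod_eq_detOf (h2 : (2 : F) ≠ 0) {B : LinearMap.BilinForm F V}
    (hs : ∀ x y, B x y = B y x) {n : ℕ} {a : Fin n → F} (φ : (Fin n → F) ≃ₗ[F] V)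
    (hφ : ∀ x, B (φ x) (φ x) = diagForm a x) :
    ∃ c, c ≠ 0 ∧ ∏ i, a i = detOf B * c ^ 2 := by
  obtain ⟨c, hc, h⟩ := exists_detOf_eq B ((Pi.basisFun F (Fin n)).map φ)
  refine ⟨c, hc, ?_⟩
  rw [← h, ← Matrix.det_diagonal]
  congr 1
  ext i j
  rw [LinearMap.toMatrix₂_apply]
  simp only [Module.Basis.map_apply, Pi.basisFun_apply]
  rw [← LinearEquiv.coe_toLinearMap, bilin_eq_of_diag h2 hs φ.toLinearMap hφ]
  by_cases hij : i = j
  · subst hij; simp [Pi.single_apply]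
  · simp [Pi.single_apply, hij, Ne.symm hij]

theorem exists_detOf_eq_of_isometry (h2 : (2 : F) ≠ 0) {B : LinearMap.BilinForm F V}
    (hB : IsQuadraticSpace B) {t : V ≃ₗ[F] V} (ht : IsIsometryOf B t)
    (hF : LinearMap.det (t.toLinearMap - 1) * LinearMap.det (t.toLinearMap + 1) ≠ 0) :
    ∃ c, c ≠ 0 ∧ detOf B =
      LinearMap.det (t.toLinearMap - 1) * LinearMap.det (t.toLinearMap + 1) * c ^ 2 := by
  let b := Module.finBasis F V
  have e1 : LinearMap.det (t.toLinearMap - 1) = (LinearMap.toMatrix b b t.toLinearMap - 1).det := by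
    rw [← LinearMap.det_toMatrix b, map_sub, LinearMap.toMatrix_one]
  have e2 : LinearMap.det (t.toLinearMap + 1) = (LinearMap.toMatrix b b t.toLinearMap + 1).det := by
    rw [← LinearMap.det_toMatrix b, map_add, LinearMap.toMatrix_one]
  rw [e1, e2] at hF ⊢
  refine Matrix.exists_det_gram_eq h2 (G := gramOf B) ?_ hB.detOf_ne_zero ?_ hF
  · ext i j
    simp [gramOf, LinearMap.toMatrix₂_apply, hB.1]
  · rw [gramOf, ← LinearMap.toMatrix₂_compl₁₂]
    congr 1
    ext x y
    exact ht x y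

end DetOf

section ModuleDet

theorem LinearMap.det_pi_dependent {F ι : Type*} [Field F] [Fintype ι]
    {M : ι → Type*} [∀ i, AddCommGroup (M i)] [∀ i, Module F (M i)]
    [∀ i, FiniteDimensional F (M i)] (f : ∀ i, M i →ₗ[F] M i) :
    LinearMap.det (LinearMap.pi fun i => (f i).comp (LinearMap.proj i)) =
      ∏ i, LinearMap.det (f i) := by
  classical
  let _ : LinearOrder ι := LinearOrder.lift' (Fintype.equivFin ι) (Fintype.equivFin ι).injective
  let b := fun i => Module.finBasis F (M i)
  let B := Pi.basis b
  rw [← LinearMap.det_toMatrix B]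
  have hentry : ∀ x y : Σ i, Fin (Module.finrank F (M i)),
      LinearMap.toMatrix B B (LinearMap.pi fun i => (f i).comp (LinearMap.proj i)) x y =
        (b x.1).repr (f x.1 ((Pi.single y.1 (b y.1 y.2) : ∀ i, M i) x.1)) x.2 := by
    intro x y
    rw [LinearMap.toMatrix_apply', Pi.basis_apply, Pi.basis_repr]
    rfl
  have hT : Matrix.BlockTriangular
      (LinearMap.toMatrix B B (LinearMap.pi fun i => (f i).comp (LinearMap.proj i)))
      (Sigma.fst) := by
    intro x y hxy
    rw [hentry, Pi.single_eq_of_ne hxy.ne', map_zero, map_zero]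
    rfl
  rw [hT.det_fintype]
  refine Finset.prod_congr rfl fun i _ => ?_
  rw [← LinearMap.det_toMatrix (b i), ← Matrix.det_submatrix_equiv_self (Equiv.sigmaSubtype i).symm]
  congr 1
  ext p q
  change LinearMap.toMatrix B B _ ⟨i, p⟩ ⟨i, q⟩ = _
  rw [hentry, LinearMap.toMatrix_apply', Pi.single_eq_same]

theorem AdjoinRoot.det_smul_eq {F : Type*} [Field F] {g : F[X]} (hg : g.Monic) (c : F) :
    LinearMap.det (LinearMap.mulLeft F (algebraMap F (AdjoinRoot g) c - AdjoinRoot.root g)) =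
      g.eval c := by
  have h := congrArg (eval c) (charpoly_leftMulMatrix (AdjoinRoot.powerBasis hg.ne_zero))
  rw [AdjoinRoot.minpoly_powerBasis_gen_of_monic hg, Matrix.eval_charpoly] at h
  rw [← h]
  change Algebra.norm F _ = _
  rw [Algebra.norm_eq_matrix_det (AdjoinRoot.powerBasis hg.ne_zero).basis, map_sub,
    AdjoinRoot.powerBasis_gen]
  congr 2
  rw [AlgHom.commutes, Matrix.algebraMap_eq_diagonal]
  rfl

variable {k : Type} [Field k]

instance ModuleData.instFiniteDimensional (D : ModuleData k) (i : D.ι) :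
    FiniteDimensional k (k[X] ⧸ Ideal.span {((D.f i).map (RingHom.id k)) ^ D.e i}) :=
  (AdjoinRoot.powerBasis (f := ((D.f i).map (RingHom.id k)) ^ D.e i)
    (((D.monic i).map _).pow _).ne_zero).finite

theorem ModuleData.det_sub_eq (D : ModuleData k) {V : Type} [AddCommGroup V] [Module k V]
    (t : V →ₗ[k] V) (φ : V ≃ₗ[k] D.SpaceVia (RingHom.id k))
    (h : ∀ w, φ (t w) = (X : k[X]) • φ w) (c : k) :
    LinearMap.det (algebraMap k (Module.End k V) c - t) = D.charPoly.eval c := by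
  rw [← LinearMap.det_conj _ φ]
  let m : ∀ i, (k[X] ⧸ Ideal.span {((D.f i).map (RingHom.id k)) ^ D.e i}) →ₗ[k]
      (k[X] ⧸ Ideal.span {((D.f i).map (RingHom.id k)) ^ D.e i}) := fun i =>
    LinearMap.mulLeft k (algebraMap k (AdjoinRoot (((D.f i).map (RingHom.id k)) ^ D.e i)) c -
      AdjoinRoot.root _)
  have e : (φ : V →ₗ[k] D.SpaceVia (RingHom.id k)) ∘ₗ (algebraMap k (Module.End k V) c - t) ∘ₗ
      (φ.symm : D.SpaceVia (RingHom.id k) →ₗ[k] V) =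
      LinearMap.pi fun i => (LinearMap.pi fun j : Fin (D.n i) =>
        (m i).comp (LinearMap.proj j)).comp (LinearMap.proj i) := by
    ext1 x
    funext i j
    simp only [LinearMap.comp_apply, LinearEquiv.coe_coe, LinearMap.sub_apply, map_sub,
      Module.algebraMap_end_apply, map_smul, h, LinearEquiv.apply_symm_apply]
    have e1 : (c • x - (X : k[X]) • x) i j = c • x i j - (X : k[X]) • x i j := rfl
    have e2 : ∀ y : AdjoinRoot (((D.f i).map (RingHom.id k)) ^ D.e i),
        m i y = c • y - AdjoinRoot.root _ * y := fun y => by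
      rw [Algebra.smul_def]
      exact sub_mul (algebraMap k (AdjoinRoot (((D.f i).map (RingHom.id k)) ^ D.e i)) c)
        (AdjoinRoot.root _) y
    rw [e1]
    refine Eq.trans ?_ (e2 (x i j)).symm
    congr 1
  rw [e, LinearMap.det_pi_dependent, ModuleData.charPoly, eval_prod]
  refine Finset.prod_congr rfl fun i _ => ?_
  rw [LinearMap.det_pi, Finset.prod_const, Finset.card_univ, Fintype.card_fin]
  have := AdjoinRoot.det_smul_eq (((D.monic i).map (RingHom.id k)).pow (D.e i)) c
  rw [mul_comm, pow_mul, eval_pow]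
  congr 1
  refine this.trans ?_
  rw [Polynomial.map_id]

theorem ModuleData.exists_detOf_eq (h2 : (2 : k) ≠ 0) (D : ModuleData k)
    (hFM : D.charPoly.eval 1 * D.charPoly.eval (-1) ≠ 0)
    {V : Type} [AddCommGroup V] [Module k V] [FiniteDimensional k V]
    {B : LinearMap.BilinForm k V} (hB : IsQuadraticSpace B) (h : HasIsometryWithModule B D) :
    ∃ c : k, c ≠ 0 ∧ detOf B = (D.charPoly.eval 1 * D.charPoly.eval (-1)) * c ^ 2 := by
  obtain ⟨t, ht, φ, hφ⟩ := h
  have e : D.charPoly.eval 1 * D.charPoly.eval (-1) =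
      LinearMap.det (t.toLinearMap - 1) * LinearMap.det (t.toLinearMap + 1) := by
    rw [← D.det_sub_eq t.toLinearMap φ hφ, ← D.det_sub_eq t.toLinearMap φ hφ, ← map_mul, ← map_mul]
    congr 1
    rw [map_neg, map_one]
    noncomm_ring
  rw [e] at hFM ⊢
  exact exists_detOf_eq_of_isometry h2 hB ht hFM

end ModuleDet

section Involution

variable {k L : Type} [Field k] [Field L] [Algebra k L]

theorem eq_zero_of_forall_mul {σ : L →ₗ[k] k} (hσ : σ ≠ 0) {c : L} (h : ∀ z, σ (c * z) = 0) :
    c = 0 := by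
  by_contra hc
  refine hσ (LinearMap.ext fun z => ?_)
  have := h (c⁻¹ * z)
  rwa [mul_inv_cancel_left₀ hc] at this

theorem exists_invariant_functional (h2 : (2 : k) ≠ 0) {τ : L →ₐ[k] L} (hτ : ∀ x, τ (τ x) = x) :
    ∃ σ : L →ₗ[k] k, σ ≠ 0 ∧ ∀ x, σ (τ x) = σ x := by
  obtain ⟨g, hg⟩ : ∃ g : Module.Dual k L, g 1 ≠ 0 := by
    by_contra! h
    exact one_ne_zero ((Module.forall_dual_apply_eq_zero_iff k (1 : L)).1 h)
  refine ⟨g + g.comp τ.toLinearMap, fun h => ?_, fun x => ?_⟩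
  · have := LinearMap.congr_fun h 1
    simp only [LinearMap.add_apply, LinearMap.comp_apply, AlgHom.toLinearMap_apply, map_one,
      LinearMap.zero_apply, ← two_mul] at this
    exact mul_ne_zero h2 hg this
  · simp [hτ, add_comm]

/-- The subfield fixed by an endomorphism. -/
def fixedIntermediateField (τ : L →ₐ[k] L) : IntermediateField k L where
  __ := AlgHom.equalizer τ (AlgHom.id k L)
  inv_mem' x hx := by
    change τ x⁻¹ = x⁻¹
    rw [map_inv₀, show τ x = x from hx]

/-- Hermitian forms of rank one over a field with involution, as transfers of scaled binary norm
forms over the fixed field. -/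
theorem exists_twisted_forms (h2 : (2 : k) ≠ 0) [FiniteDimensional k L] {τ : L →ₐ[k] L}
    (hτ : ∀ x, τ (τ x) = x) (hne : ∃ x, τ x ≠ x) :
    ∃ (K : Type) (_ : Field K) (_ : Algebra k K) (_ : FiniteDimensional k K) (σ : K →ₗ[k] k)
      (a : K), σ ≠ 0 ∧ ¬ IsSquare a ∧ ∀ l : K, l ≠ 0 → ∃ B : LinearMap.BilinForm k L,
        IsQuadraticSpace B ∧ (∀ r, τ r = r⁻¹ → r ≠ 0 → ∀ x y, B (r * x) (r * y) = B x y) ∧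
        ∃ Ψ : L ≃ₗ[k] K × K, ∀ x, B x x = σ (l * ((Ψ x).1 ^ 2 - a * (Ψ x).2 ^ 2)) := by
  have h2L : (2 : L) ≠ 0 := by
    have := (map_ne_zero (algebraMap k L)).2 h2
    rwa [map_ofNat] at this
  obtain ⟨σ', hσ', hσ'τ⟩ := exists_invariant_functional h2 hτ
  obtain ⟨x₀, hx₀⟩ := hne
  set d := x₀ - τ x₀ with hd
  have hd0 : d ≠ 0 := sub_ne_zero.2 hx₀.symm
  have hτd : τ d = -d := by rw [hd, map_sub, hτ]; ring
  let K := fixedIntermediateField τ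
  have hmem : ∀ x : L, x ∈ K ↔ τ x = x := fun x => Iff.rfl
  have hK : ∀ x : K, τ (x : L) = x := fun x => x.2
  let a : K := ⟨d ^ 2, (hmem _).2 (by rw [map_pow, hτd, neg_sq])⟩
  have hhalf : ∀ z : L, (z + τ z) / 2 ∈ K := fun z => (hmem _).2 (by
    rw [map_div₀, map_add, hτ, map_ofNat, add_comm])
  refine ⟨K, inferInstance, inferInstance, inferInstance, σ'.comp K.val.toLinearMap, a, ?_, ?_, ?_⟩
  · intro h
    refine hσ' (LinearMap.ext fun z => ?_)
    have h3 : σ' ((z + τ z) / 2) = 0 := LinearMap.congr_fun h ⟨_, hhalf z⟩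
    have h4 : (2 : k) • ((z + τ z) / 2) = z + τ z := by
      rw [Algebra.smul_def, map_ofNat]; field_simp
    have h5 := congrArg σ' h4
    rw [map_smul, h3, smul_zero, map_add, hσ'τ, ← two_mul] at h5
    exact (mul_eq_zero.1 h5.symm).resolve_left h2
  · rintro ⟨b, hb⟩
    have hb' : d ^ 2 = (b : L) * b := congrArg Subtype.val hb
    have : (d - b) * (d + b) = 0 := by linear_combination hb'
    have hdK : τ d = d := by
      rcases mul_eq_zero.1 this with h | h
      · rw [sub_eq_zero.1 h, hK]
      · rw [eq_neg_of_add_eq_zero_left h, map_neg, hK]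
    rw [hτd] at hdK
    have : 2 * d = 0 := by linear_combination -hdK
    exact (mul_ne_zero h2L hd0) this
  · intro l hl
    have hl' : (l : L) ≠ 0 := fun h => hl (Subtype.ext h)
    let B : LinearMap.BilinForm k L := LinearMap.mk₂ k (fun x y => σ' (l * x * τ y))
      (fun x y z => by rw [← map_add]; ring_nf)
      (fun c x y => by rw [← map_smul]; congr 1; simp only [Algebra.smul_def]; ring)
      (fun x y z => by rw [map_add τ, mul_add, map_add])
      (fun c x y => by rw [map_smul τ, mul_smul_comm, map_smul])
    have hB : ∀ x y, B x y = σ' (l * x * τ y) := fun x y => rfl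
    refine ⟨B, ⟨fun x y => ?_, fun x hx => ?_⟩, fun r hr hr0 x y => ?_, ?_⟩
    · rw [hB, hB, ← hσ'τ, map_mul τ, map_mul τ, hτ, hK]
      ring_nf
    · have : (l : L) * x = 0 := eq_zero_of_forall_mul hσ' fun z => by
        have := hx (τ z)
        rwa [hB, hτ] at this
      exact (mul_eq_zero.1 this).resolve_left hl'
    · rw [hB, hB, map_mul τ, hr]
      congr 1
      field_simp
    · let S : K × K →ₗ[k] L := K.val.toLinearMap.comp (LinearMap.fst k K K) +
        (LinearMap.mulLeft k d).comp (K.val.toLinearMap.comp (LinearMap.snd k K K))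
      have hS : ∀ p, S p = p.1 + d * p.2 := fun p => rfl
      have hbij : Function.Bijective S := by
        constructor
        · rw [← LinearMap.ker_eq_bot, LinearMap.ker_eq_bot']
          intro p hp
          rw [hS] at hp
          have h1 := congrArg τ hp
          rw [map_add, map_mul, hτd, hK, hK, map_zero] at h1
          have h3 : 2 * (p.1 : L) = 0 := by linear_combination hp + h1
          have h4 : (p.1 : L) = 0 := (mul_eq_zero.1 h3).resolve_left h2L
          rw [h4, zero_add] at hp
          have h5 := (mul_eq_zero.1 hp).resolve_left hd0
          exact Prod.ext (Subtype.ext h4) (Subtype.ext h5)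
        · intro z
          refine ⟨(⟨_, hhalf z⟩, ⟨(z - τ z) / (2 * d), (hmem _).2 ?_⟩), ?_⟩
          · rw [map_div₀, map_sub, hτ, map_mul, map_ofNat, hτd]
            field_simp
            ring
          · rw [hS]
            field_simp
            ring
      refine ⟨(LinearEquiv.ofBijective S hbij).symm, fun x => ?_⟩
      obtain ⟨p, rfl⟩ := (LinearEquiv.ofBijective S hbij).surjective x
      rw [LinearEquiv.symm_apply_apply, LinearEquiv.ofBijective_apply, hB, hS, map_add τ, map_mul τ,
        hK, hK, hτd]
      change _ = σ' (l * ((p.1 : L) ^ 2 - d ^ 2 * (p.2 : L) ^ 2))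
      ring_nf

end Involution

section InvariantForm

variable {k J : Type} [Field k] [Fintype J] {L : J → Type} [∀ j, Field (L j)]
  [∀ j, Algebra k (L j)]

/-- An involution of a finite family of fields inverting the elements `r j` yields a quadratic
form on the product for which multiplication by `r` is an isometry. -/
theorem exists_invariant_form (h2 : (2 : k) ≠ 0) (r : ∀ j, L j) (hr : ∀ j, r j ≠ 0) (ρ : J → J)
    (hρ : ∀ j, ρ (ρ j) = j) (θ : ∀ i j, i = ρ j → (L i →ₐ[k] L j))
    (hθ : ∀ i j h, Function.Surjective (θ i j h)) (hθr : ∀ i j h, θ i j h (r i) = (r j)⁻¹)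
    (hθθ : ∀ j h x, θ j j h (θ j j h x) = x) :
    ∃ B : LinearMap.BilinForm k (∀ j, L j), IsQuadraticSpace B ∧
      ∀ x y, B (fun j => r j * x j) (fun j => r j * y j) = B x y := by
  classical
  let _ : LinearOrder J := LinearOrder.lift' (Fintype.equivFin J) (Fintype.equivFin J).injective
  have hσ : ∀ j, ∃ σ : L j →ₗ[k] k, (∀ h x, σ (θ j j h x) = σ x) ∧ (ρ j < j → σ = 0) ∧
      (j ≤ ρ j → σ ≠ 0) := by
    intro j
    rcases lt_trichotomy j (ρ j) with h | h | h
    · obtain ⟨g, hg⟩ : ∃ g : Module.Dual k (L j), g 1 ≠ 0 := by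
        by_contra! h
        exact one_ne_zero ((Module.forall_dual_apply_eq_zero_iff k (1 : L j)).1 h)
      exact ⟨g, fun h' => absurd h' h.ne, fun h' => absurd h' h.asymm,
        fun _ h' => hg (by rw [h']; rfl)⟩
    · obtain ⟨σ, h3, h4⟩ := exists_invariant_functional h2 (hθθ j h)
      exact ⟨σ, fun _ => h4, fun h' => absurd h' h.symm.not_lt, fun _ => h3⟩
    · exact ⟨0, fun _ _ => rfl, fun _ => rfl, fun h' => absurd h h'.not_gt⟩
  choose σ hσ1 hσ2 hσ3 using hσ
  let B : LinearMap.BilinForm k (∀ j, L j) := LinearMap.mk₂ k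
    (fun x y => ∑ j, (σ j (x j * θ _ j rfl (y (ρ j))) + σ j (y j * θ _ j rfl (x (ρ j)))))
    (fun x y z => by
      simp only [Pi.add_apply, map_add, add_mul, mul_add, ← Finset.sum_add_distrib]
      exact Finset.sum_congr rfl fun j _ => by ring)
    (fun c x y => by
      simp only [Pi.smul_apply, map_smul, smul_mul_assoc, mul_smul_comm, smul_add, Finset.smul_sum])
    (fun x y z => by
      simp only [Pi.add_apply, map_add, add_mul, mul_add, ← Finset.sum_add_distrib]
      exact Finset.sum_congr rfl fun j _ => by ring)
    (fun c x y => by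
      simp only [Pi.smul_apply, map_smul, smul_mul_assoc, mul_smul_comm, smul_add, Finset.smul_sum])
  have hB : ∀ x y, B x y =
      ∑ j, (σ j (x j * θ _ j rfl (y (ρ j))) + σ j (y j * θ _ j rfl (x (ρ j)))) := fun x y => rfl
  have hcast : ∀ (x : ∀ j, L j) i i' j (h : i = ρ j) (h' : i' = ρ j),
      θ i j h (x i) = θ i' j h' (x i') := by
    intro x i i' j h h'
    obtain rfl : i = i' := h.trans h'.symm
    rfl
  have hsingle : ∀ (x : ∀ j, L j) i (z : L i), B x (Pi.single i z) =
      σ (ρ i) (x (ρ i) * θ i (ρ i) (hρ i).symm z) + σ i (z * θ _ i rfl (x (ρ i))) := by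
    intro x i z
    rw [hB, Finset.sum_add_distrib, Finset.sum_eq_single (ρ i), Finset.sum_eq_single i]
    · rw [Pi.single_eq_same, hcast (Pi.single i z) _ i _ _ (hρ i).symm, Pi.single_eq_same]
    · intro j _ hj
      rw [Pi.single_eq_of_ne hj, zero_mul, map_zero]
    · simp
    · intro j _ hj
      rw [Pi.single_eq_of_ne, map_zero, mul_zero, map_zero]
      rintro rfl
      exact hj (hρ j).symm
    · simp
  have hfix : ∀ (x : ∀ j, L j) i j (z : L i) (h : i = ρ j) (h' : i = ρ i), j = i →
      σ j (x j * θ i j h z) = σ i (x i * θ i i h' z) := by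
    rintro x i j z h h' rfl
    rfl
  refine ⟨B, ⟨fun x y => ?_, fun x hx => ?_⟩, fun x y => ?_⟩
  · rw [hB, hB]
    exact Finset.sum_congr rfl fun j _ => add_comm _ _
  · have hx' : ∀ i, x (ρ i) = 0 := by
      intro i
      have hz := fun z => (hsingle x i z).symm.trans (hx _)
      rcases lt_trichotomy i (ρ i) with h | h | h
      · have h0 : σ (ρ i) = 0 := hσ2 _ (by rwa [hρ])
        have := eq_zero_of_forall_mul (hσ3 i h.le) fun z => by
          have := hz z
          rw [h0, LinearMap.zero_apply, zero_add, mul_comm] at this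
          exact this
        exact (map_eq_zero _).1 this
      · have := eq_zero_of_forall_mul (hσ3 i h.le) (c := θ _ i rfl (x (ρ i))) fun z => by
          have h3 := hz z
          rw [hfix x i (ρ i) z _ h h.symm, ← hσ1 i h, map_mul, hθθ, hcast x i (ρ i) i h rfl,
            mul_comm z, ← two_mul] at h3
          exact (mul_eq_zero.1 h3).resolve_left h2
        exact (map_eq_zero _).1 this
      · have h0 : σ i = 0 := hσ2 _ h
        refine eq_zero_of_forall_mul (hσ3 (ρ i) (by rw [hρ]; exact h.le)) fun z => ?_
        obtain ⟨w, rfl⟩ := hθ i (ρ i) (hρ i).symm z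
        have := hz w
        rwa [h0, LinearMap.zero_apply, add_zero] at this
    funext i
    have := hx' (ρ i)
    rw [hρ] at this
    exact this
  · rw [hB, hB]
    refine Finset.sum_congr rfl fun j _ => ?_
    have hrj := hr j
    rw [map_mul (θ _ j rfl), map_mul (θ _ j rfl), hθr]
    congr 2 <;> field_simp

end InvariantForm

section Reciprocal

variable {k : Type} [Field k]

theorem starPoly_starPoly {f : k[X]} (hf : f.Monic) (h0 : f.coeff 0 ≠ 0) :
    starPoly (starPoly f) = f := by
  have h1 : (C (f.coeff 0)⁻¹ * f.reverse).coeff 0 = (f.coeff 0)⁻¹ := by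
    rw [coeff_C_mul, coeff_zero_reverse, hf.leadingCoeff, mul_one]
  rw [starPoly, starPoly, h1, inv_inv, reverse_mul_of_domain, reverse_C, reverse,
    reverse_natDegree, natTrailingDegree_eq_zero_of_constantCoeff_ne_zero h0, Nat.sub_zero, reverse,
    reflect_reflect, ← mul_assoc, ← C_mul, mul_inv_cancel₀ h0, C_1, one_mul]

theorem AdjoinRoot.root_ne_zero_of_coeff_zero {f : k[X]} (h0 : f.coeff 0 ≠ 0)
    [Fact (Irreducible f)] : AdjoinRoot.root f ≠ 0 := by
  intro h
  have := AdjoinRoot.eval₂_root f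
  rw [h, eval₂_at_zero] at this
  exact h0 ((map_eq_zero _).1 this)

theorem AdjoinRoot.eval₂_root_inv_eq_zero {f g : k[X]} [Fact (Irreducible g)]
    (hg : g.coeff 0 ≠ 0) (h : g = starPoly f) :
    f.eval₂ (algebraMap k (AdjoinRoot g)) (AdjoinRoot.root g)⁻¹ = 0 := by
  have hr := AdjoinRoot.root_ne_zero_of_coeff_zero hg
  have hf0 : (f.coeff 0)⁻¹ ≠ 0 := by
    rintro h'
    rw [starPoly, h', C_0, zero_mul] at h
    rw [h, coeff_zero] at hg
    exact hg rfl
  let _ : Invertible (AdjoinRoot.root g)⁻¹ := ⟨AdjoinRoot.root g, mul_inv_cancel₀ hr,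
    inv_mul_cancel₀ hr⟩
  refine (eval₂_reverse_eq_zero_iff _ (AdjoinRoot.root g)⁻¹ f).1 ?_
  change eval₂ _ (AdjoinRoot.root g) _ = 0
  have := AdjoinRoot.eval₂_root g
  conv at this => lhs; arg 3; rw [h]
  rw [starPoly, eval₂_mul, eval₂_C] at this
  exact (mul_eq_zero.1 this).resolve_left ((_root_.map_ne_zero _).2 hf0)

/-- The homomorphism `root f ↦ (root g)⁻¹`. -/
def AdjoinRoot.invHom (f g : k[X]) [Fact (Irreducible g)] (hg : g.coeff 0 ≠ 0)
    (h : g = starPoly f) : AdjoinRoot f →ₐ[k] AdjoinRoot g :=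
  AdjoinRoot.liftAlgHom f (Algebra.ofId k _) (AdjoinRoot.root g)⁻¹
    (AdjoinRoot.eval₂_root_inv_eq_zero hg h)

theorem AdjoinRoot.invHom_root (f g : k[X]) [Fact (Irreducible g)] (hg : g.coeff 0 ≠ 0)
    (h : g = starPoly f) :
    AdjoinRoot.invHom f g hg h (AdjoinRoot.root f) = (AdjoinRoot.root g)⁻¹ :=
  AdjoinRoot.liftAlgHom_root _ _ _ _

theorem AdjoinRoot.invHom_invHom (f g : k[X]) [Fact (Irreducible g)] [Fact (Irreducible f)]
    (hg : g.coeff 0 ≠ 0) (hf : f.coeff 0 ≠ 0) (h : g = starPoly f) (h' : f = starPoly g)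
    (x : AdjoinRoot g) :
    AdjoinRoot.invHom f g hg h (AdjoinRoot.invHom g f hf h' x) = x := by
  have : (AdjoinRoot.invHom f g hg h).comp (AdjoinRoot.invHom g f hf h') = AlgHom.id k _ := by
    apply AdjoinRoot.algHom_ext
    rw [AlgHom.comp_apply, invHom_root, map_inv₀, invHom_root, inv_inv]
    rfl
  exact DFunLike.congr_fun this x

theorem AdjoinRoot.root_inv_ne_root {f : k[X]} [hf : Fact (Irreducible f)] (h0 : f.coeff 0 ≠ 0)
    (hd : Even f.natDegree) : (AdjoinRoot.root f)⁻¹ ≠ AdjoinRoot.root f := by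
  intro h
  have hr := AdjoinRoot.root_ne_zero_of_coeff_zero h0
  have h1 : AdjoinRoot.root f * AdjoinRoot.root f = 1 := by
    conv_lhs => arg 1; rw [← h]
    exact inv_mul_cancel₀ hr
  have h2 : f ∣ (X - C 1) * (X + C 1) := by
    rw [← AdjoinRoot.mk_eq_zero]
    simp only [map_mul, map_sub, map_add, AdjoinRoot.mk_X, map_one]
    linear_combination h1
  have hle : f.natDegree ≤ 1 := by
    rcases hf.out.prime.dvd_or_dvd h2 with h | h
    · exact (natDegree_le_of_dvd h (X_sub_C_ne_zero _)).trans (natDegree_X_sub_C_le _)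
    · exact (natDegree_le_of_dvd h (X_add_C_ne_zero _)).trans (natDegree_X_add_C _).le
  have hpos := hf.out.natDegree_pos
  rw [show f.natDegree = 1 by omega] at hd
  exact absurd hd (by decide)

end Reciprocal

section Involution

theorem exists_involutive_lift {J α : Type*} (f : J → α) (s : α → α)
    (hs : ∀ j, s (s (f j)) = f j) (σ : Equiv.Perm J) (hσ : ∀ j, f (σ j) = s (f j)) :
    ∃ ρ : J → J, (∀ j, ρ (ρ j) = j) ∧ (∀ j, f (ρ j) = s (f j)) ∧ ∀ j, s (f j) = f j → ρ j = j := by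
  classical
  let _ : LinearOrder α := linearOrderOfSTO WellOrderingRel
  have hσ' : ∀ j, f (σ.symm j) = s (f j) := fun j => by
    rw [← hs (σ.symm j), ← hσ (σ.symm j), Equiv.apply_symm_apply]
  let ρ : J → J := fun j =>
    if s (f j) = f j then j else if f j < s (f j) then σ j else σ.symm j
  have hρ : ∀ j, ρ j = if s (f j) = f j then j else if f j < s (f j) then σ j else σ.symm j :=
    fun j => rfl
  refine ⟨ρ, fun j => ?_, fun j => ?_, fun j h => if_pos h⟩
  · rcases lt_trichotomy (f j) (s (f j)) with h | h | h
    · rw [hρ j, if_neg h.ne', if_pos h, hρ, hσ, hs, if_neg h.ne, if_neg h.asymm,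
        Equiv.symm_apply_apply]
    · rw [hρ j, if_pos h.symm, hρ, if_pos h.symm]
    · rw [hρ j, if_neg h.ne, if_neg h.asymm, hρ, hσ', hs, if_neg h.ne', if_pos h,
        Equiv.apply_symm_apply]
  · rw [hρ]
    split_ifs with h1 h2
    · exact h1.symm
    · exact hσ j
    · exact hσ' j

end Involution

section Transport

variable {k : Type} [Field k] {V W : Type} [AddCommGroup V] [Module k V] [AddCommGroup W]
  [Module k W]

theorem HasIsometryWithModule.of_equiv {B : LinearMap.BilinForm k V}
    {B' : LinearMap.BilinForm k W} {D : ModuleData k} (h : HasIsometryWithModule B D)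
    (e : W ≃ₗ[k] V) (he : ∀ x y, B (e x) (e y) = B' x y) : HasIsometryWithModule B' D := by
  obtain ⟨t, ht, φ, hφ⟩ := h
  refine ⟨e.trans (t.trans e.symm), fun x y => ?_, e.trans φ, fun w => ?_⟩
  · rw [← he, ← he]
    simpa using ht (e x) (e y)
  · simpa using hφ (e w)

/-- The orthogonal sum of two bilinear forms. -/
def orthSum (A : LinearMap.BilinForm k V) (C : LinearMap.BilinForm k W) :
    LinearMap.BilinForm k (V × W) :=
  A.compl₁₂ (LinearMap.fst k V W) (LinearMap.fst k V W) +
    C.compl₁₂ (LinearMap.snd k V W) (LinearMap.snd k V W)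

theorem orthSum_apply (A : LinearMap.BilinForm k V) (C : LinearMap.BilinForm k W) (x y : V × W) :
    orthSum A C x y = A x.1 y.1 + C x.2 y.2 := rfl

theorem IsQuadraticSpace.orthSum {A : LinearMap.BilinForm k V} {C : LinearMap.BilinForm k W}
    (hA : IsQuadraticSpace A) (hC : IsQuadraticSpace C) : IsQuadraticSpace (orthSum A C) := by
  refine ⟨fun x y => ?_, fun x hx => Prod.ext (hA.2 _ fun y => ?_) (hC.2 _ fun y => ?_)⟩
  · rw [orthSum_apply, orthSum_apply, hA.1, hC.1]
  · simpa [orthSum_apply] using hx (y, 0)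
  · simpa [orthSum_apply] using hx (0, y)

end Transport

section Construction

variable {k : Type} [Field k]

theorem AdjoinRoot.exists_equiv_quotient {f g : k[X]} (h : f = g) :
    ∃ q : AdjoinRoot f ≃ₗ[k] k[X] ⧸ Ideal.span {g},
      ∀ x, q (AdjoinRoot.root f * x) = (X : k[X]) • q x := by
  subst h
  exact ⟨LinearEquiv.refl k _, fun x => rfl⟩

theorem exists_piSplitAt {J : Type} [DecidableEq J] (L : J → Type) [∀ j, AddCommGroup (L j)]
    [∀ j, Module k (L j)] (j₀ : J) :
    ∃ e : (∀ j, L j) ≃ₗ[k] L j₀ × (∀ j : {j : J // j ≠ j₀}, L j.1),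
      ∀ x, e x = (x j₀, fun j : {j : J // j ≠ j₀} => x j.1) :=
  ⟨{ Equiv.piSplitAt j₀ L with
      map_add' := fun _ _ => rfl
      map_smul' := fun _ _ => rfl }, fun _ => rfl⟩

variable (D : ModuleData k)

theorem ModuleData.coeff_zero_ne_zero (i : D.ι) : (D.f i).coeff 0 ≠ 0 := by
  intro h
  obtain ⟨σ, hσ⟩ := D.selfdual
  have := (hσ i).1
  rw [starPoly, h, inv_zero, C_0, zero_mul] at this
  exact (D.monic (σ i)).ne_zero this

/-- The simple summands of a semi-simple module, one for each copy. -/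
abbrev ModuleData.Idx : Type := Σ i, Fin (D.n i)

instance (i : D.ι) : Fact (Irreducible (D.f i)) := ⟨D.irr i⟩

instance (i : D.ι) : FiniteDimensional k (AdjoinRoot (D.f i)) :=
  (AdjoinRoot.powerBasis (D.monic i).ne_zero).finite

theorem ModuleData.exists_equiv_spaceVia (hss : D.Semisimple) :
    ∃ e : (∀ j : D.Idx, AdjoinRoot (D.f j.1)) ≃ₗ[k] D.SpaceVia (RingHom.id k),
      ∀ x, e (fun j => AdjoinRoot.root (D.f j.1) * x j) = (X : k[X]) • e x := by
  choose q hq using fun i => AdjoinRoot.exists_equiv_quotient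
    (f := D.f i) (g := ((D.f i).map (RingHom.id k)) ^ D.e i) (by rw [hss, pow_one, map_id])
  refine ⟨(LinearEquiv.piCurry k fun i (_ : Fin (D.n i)) => AdjoinRoot (D.f i)).trans
    (LinearEquiv.piCongrRight fun i => LinearEquiv.piCongrRight fun _ => q i), fun x => ?_⟩
  funext i j
  exact hq i (x ⟨i, j⟩)

theorem ModuleData.exists_involution : ∃ ρ : D.Idx → D.Idx, (∀ j, ρ (ρ j) = j) ∧
    (∀ j, D.f (ρ j).1 = starPoly (D.f j.1)) ∧
    ∀ j : D.Idx, starPoly (D.f j.1) = D.f j.1 → ρ j = j := by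
  obtain ⟨σ, hσ⟩ := D.selfdual
  exact exists_involutive_lift (fun j : D.Idx => D.f j.1) starPoly
    (fun j => starPoly_starPoly (D.monic _) (D.coeff_zero_ne_zero _))
    (Equiv.sigmaCongr σ fun i => finCongr (hσ i).2.2.symm) fun j => (hσ j.1).1

/-- A semisimple module with nonzero type `1` part is realised by a family of quadratic spaces that
varies by scaling a binary norm form on one summand. -/
theorem ModuleData.exists_forms (h2 : (2 : k) ≠ 0) (hss : D.Semisimple)
    (hM1 : ∃ i, D.IsIdx1 i) :
    ∃ (K : Type) (_ : Field K) (_ : Algebra k K) (_ : FiniteDimensional k K) (σ : K →ₗ[k] k)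
      (a : K), σ ≠ 0 ∧ ¬ IsSquare a ∧
      ∃ (R : Type) (_ : AddCommGroup R) (_ : Module k R) (_ : FiniteDimensional k R)
        (C : LinearMap.BilinForm k R), IsQuadraticSpace C ∧
        ∀ l : K, l ≠ 0 → ∃ A : LinearMap.BilinForm k (K × K), IsQuadraticSpace A ∧
          (∀ p, A p p = σ (l * (p.1 ^ 2 - a * p.2 ^ 2))) ∧
          HasIsometryWithModule (orthSum A C) D := by
  classical
  obtain ⟨i₀, hsymm, heven⟩ := hM1
  let j₀ : D.Idx := ⟨i₀, ⟨0, D.npos i₀⟩⟩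
  have h00 := D.coeff_zero_ne_zero i₀
  have hstar : D.f i₀ = starPoly (D.f i₀) := (starPoly_eq_self_of_symm (D.monic i₀) hsymm).symm
  obtain ⟨ρ, hρ, hfρ, hρ0⟩ := D.exists_involution
  have hρj₀ : ρ j₀ = j₀ := hρ0 j₀ hstar.symm
  let J := {j : D.Idx // j ≠ j₀}
  let ρ' : J → J := fun j => ⟨ρ j.1, fun h => j.2 (by rw [← hρ j.1, h, hρj₀])⟩
  have hfρ' : ∀ i j : J, i = ρ' j → D.f j.1.1 = starPoly (D.f i.1.1) := by
    rintro _ j rfl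
    rw [← starPoly_starPoly (D.monic j.1.1) (D.coeff_zero_ne_zero _)]
    exact congrArg starPoly (hfρ j.1).symm
  have hfρ'' : ∀ i j : J, i = ρ' j → D.f i.1.1 = starPoly (D.f j.1.1) := by
    rintro _ j rfl
    exact hfρ j.1
  obtain ⟨C, hC, hCinv⟩ := exists_invariant_form (L := fun j : J => AdjoinRoot (D.f j.1.1)) h2
    (fun j => AdjoinRoot.root _)
    (fun j => AdjoinRoot.root_ne_zero_of_coeff_zero (D.coeff_zero_ne_zero _)) ρ'
    (fun j => Subtype.ext (hρ j.1))
    (fun i j h => AdjoinRoot.invHom _ _ (D.coeff_zero_ne_zero _) (hfρ' i j h))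
    (fun i j h x => ⟨AdjoinRoot.invHom _ _ (D.coeff_zero_ne_zero _) (hfρ'' i j h) x,
      AdjoinRoot.invHom_invHom _ _ _ _ _ _ x⟩)
    (fun i j h => AdjoinRoot.invHom_root _ _ _ _)
    (fun j h x => AdjoinRoot.invHom_invHom _ _ _ _ _ _ x)
  have hr0 : AdjoinRoot.root (D.f i₀) ≠ 0 := AdjoinRoot.root_ne_zero_of_coeff_zero h00
  have hτr := AdjoinRoot.invHom_root (D.f i₀) (D.f i₀) h00 hstar
  obtain ⟨K, hK, hKa, hKf, σ, a, hσ, ha, hB⟩ := exists_twisted_forms h2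
    (τ := AdjoinRoot.invHom (D.f i₀) (D.f i₀) h00 hstar)
    (AdjoinRoot.invHom_invHom _ _ _ _ _ _)
    ⟨AdjoinRoot.root _, by
      rw [hτr]
      exact AdjoinRoot.root_inv_ne_root h00 heven⟩
  refine ⟨K, hK, hKa, hKf, σ, a, hσ, ha, _, inferInstance, inferInstance, inferInstance, C, hC,
    fun l hl => ?_⟩
  obtain ⟨B, hBq, hBinv, Ψ, hΨ⟩ := hB l hl
  refine ⟨B.compl₁₂ Ψ.symm.toLinearMap Ψ.symm.toLinearMap, ⟨fun x y => hBq.1 _ _, fun x hx => ?_⟩,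
    fun p => ?_, ?_⟩
  · refine (LinearEquiv.map_eq_zero_iff Ψ.symm).1 (hBq.2 _ fun y => ?_)
    simpa using hx (Ψ y)
  · simpa using hΨ (Ψ.symm p)
  · obtain ⟨e, he⟩ := D.exists_equiv_spaceVia hss
    obtain ⟨s, hs⟩ := exists_piSplitAt (k := k) (fun j : D.Idx => AdjoinRoot (D.f j.1)) j₀
    let m : (∀ j : D.Idx, AdjoinRoot (D.f j.1)) ≃ₗ[k] (∀ j : D.Idx, AdjoinRoot (D.f j.1)) :=
      LinearEquiv.piCongrRight fun j => LinearEquiv.ofBijective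
        (LinearMap.mulLeft k (AdjoinRoot.root (D.f j.1)))
        (mulLeft_bijective₀ _ (AdjoinRoot.root_ne_zero_of_coeff_zero (D.coeff_zero_ne_zero _)))
    have hm : ∀ x, m x = fun j => AdjoinRoot.root (D.f j.1) * x j := fun x => rfl
    have key : HasIsometryWithModule ((orthSum B C).compl₁₂ s.toLinearMap s.toLinearMap) D := by
      refine ⟨m, fun x y => ?_, e, fun x => he x⟩
      simp only [LinearMap.compl₁₂_apply, LinearEquiv.coe_coe, orthSum_apply, hs, hm]
      exact congrArg₂ (· + ·) (hBinv _ hτr hr0 _ _) (hCinv _ _)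
    refine key.of_equiv ((Ψ.symm.prodCongr (LinearEquiv.refl k _)).trans s.symm) fun x y => ?_
    simp [orthSum_apply]

end Construction

section Isometric

variable {F : Type} [Field F] {V W : Type} [AddCommGroup V] [Module F V] [FiniteDimensional F V]
  [AddCommGroup W] [Module F W] [FiniteDimensional F W]

theorem exists_isometry_of_diag (h2 : (2 : F) ≠ 0) {B : LinearMap.BilinForm F V}
    {B' : LinearMap.BilinForm F W} (hs : ∀ x y, B x y = B y x) (hs' : ∀ x y, B' x y = B' y x)
    {n : ℕ} {a b : Fin n → F} (φ : (Fin n → F) ≃ₗ[F] V) (hφ : ∀ x, B (φ x) (φ x) = diagForm b x)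
    (χ : (Fin n → F) ≃ₗ[F] W) (hχ : ∀ x, B' (χ x) (χ x) = diagForm a x)
    (Φ : (Fin n → F) ≃ₗ[F] (Fin n → F)) (hΦ : ∀ x, diagForm b (Φ x) = diagForm a x) :
    ∃ e : V ≃ₗ[F] W, ∀ x y, B' (e x) (e y) = B x y := by
  refine ⟨(Φ.trans φ).symm.trans χ, fun x y => ?_⟩
  obtain ⟨x, rfl⟩ := (Φ.trans φ).surjective x
  obtain ⟨y, rfl⟩ := (Φ.trans φ).surjective y
  simp only [LinearEquiv.trans_apply (e₁₂ := (Φ.trans φ).symm), LinearEquiv.symm_apply_apply]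
  exact (bilin_eq_of_diag h2 hs' χ.toLinearMap hχ x y).trans (bilin_eq_of_diag h2 hs
    (Φ.trans φ).toLinearMap (fun x => (hφ (Φ x)).trans (hΦ x)) x y).symm

theorem exists_diag_orthSum {A : LinearMap.BilinForm F V} {C : LinearMap.BilinForm F W}
    {m n : ℕ} {a : Fin m → F} {c : Fin n → F} (φ : (Fin m → F) ≃ₗ[F] V)
    (hφ : ∀ x, A (φ x) (φ x) = diagForm a x) (χ : (Fin n → F) ≃ₗ[F] W)
    (hχ : ∀ x, C (χ x) (χ x) = diagForm c x) :
    ∃ e : (Fin (m + n) → F) ≃ₗ[F] V × W,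
      ∀ x, orthSum A C (e x) (e x) = diagForm (Fin.append a c) x := by
  refine ⟨((LinearEquiv.funCongrLeft F F finSumFinEquiv).trans
    (LinearEquiv.sumArrowLequivProdArrow _ _ F F)).trans (φ.prodCongr χ), fun x => ?_⟩
  rw [diagForm_append, ← hφ, ← hχ]
  rfl

end Isometric

section LocalField

variable {k : Type} [NontriviallyNormedField k] [IsUltrametricDist k] [ProperSpace k]

theorem ModuleData.finrank_eq_dim {k : Type} [Field k] (D : ModuleData k) {V : Type}
    [AddCommGroup V] [Module k V] {B : LinearMap.BilinForm k V} (h : HasIsometryWithModule B D) :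
    Module.finrank k V = D.dim := by
  obtain ⟨t, -, φ, -⟩ := h
  rw [φ.finrank_eq, Module.finrank_pi_fintype, ModuleData.dim]
  refine Finset.sum_congr rfl fun i _ => ?_
  rw [Module.finrank_pi_fintype, Finset.sum_const, Finset.card_univ, Fintype.card_fin, smul_eq_mul]
  have hm := ((D.monic i).map (RingHom.id k)).pow (D.e i)
  have := (AdjoinRoot.powerBasis hm.ne_zero).finrank
  rw [AdjoinRoot.powerBasis_dim, ((D.monic i).map _).natDegree_pow, (D.monic i).natDegree_map]
    at this
  rw [← this]
  rfl

/-- Over a local field, a quadratic space of the right dimension and determinant has an isometry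
with the given module. -/
theorem hasIsometryWithModule_of_detOf_eq (h2 : (2 : k) ≠ 0) (D : ModuleData k)
    (hss : D.Semisimple) (hM1 : ∃ i, D.IsIdx1 i)
    (hFM : D.charPoly.eval 1 * D.charPoly.eval (-1) ≠ 0)
    {V : Type} [AddCommGroup V] [Module k V] [FiniteDimensional k V]
    {B : LinearMap.BilinForm k V} (hB : IsQuadraticSpace B) (hdim : Module.finrank k V = D.dim)
    (hdet : ∃ c : k, c ≠ 0 ∧ detOf B = (D.charPoly.eval 1 * D.charPoly.eval (-1)) * c ^ 2) :
    HasIsometryWithModule B D := by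
  let _ : MeasurableSpace k := borel k
  have : BorelSpace k := ⟨rfl⟩
  obtain ⟨ψ, hψ⟩ := exists_isSmoothChar k
  obtain ⟨K, _, _, _, σ, a, hσ, ha, R, _, _, _, C, hC, hA⟩ := D.exists_forms h2 hss hM1
  obtain ⟨l, hl, htwist⟩ := exists_twist hψ h2 hσ ha
  obtain ⟨A₁, hA₁, hA₁σ, hD₁⟩ := hA 1 one_ne_zero
  obtain ⟨A₂, hA₂, hA₂σ, hD₂⟩ := hA l hl
  obtain ⟨α, hα, φ, hφ⟩ := exists_diag h2 A₁ hA₁.1 hA₁.2 rfl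
  obtain ⟨β, hβ, χ, hχ⟩ := exists_diag h2 A₂ hA₂.1 hA₂.2 rfl
  obtain ⟨c, hc, η, hη⟩ := exists_diag h2 C hC.1 hC.2 rfl
  have hdim' : Module.finrank k V = Module.finrank k (K × K) + Module.finrank k R := by
    rw [hdim, ← Module.finrank_prod, D.finrank_eq_dim hD₁]
  obtain ⟨b, hb, ξ, hξ⟩ := exists_diag h2 B hB.1 hB.2 hdim'
  have hne : ∀ {m : ℕ} {d : Fin m → k}, (∀ i, d i ≠ 0) → (∏ i, gaussVal ψ (d i)) ≠ 0 :=
    fun hd => Finset.prod_ne_zero_iff.2 fun i _ => gaussVal_ne_zero hψ h2 (hd i)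
  by_contra hno
  have main : ∀ (A : LinearMap.BilinForm k (K × K)), IsQuadraticSpace A →
      HasIsometryWithModule (orthSum A C) D → ∀ (d : Fin (Module.finrank k (K × K)) → k),
      (∀ i, d i ≠ 0) → ∀ (χ : (Fin (Module.finrank k (K × K)) → k) ≃ₗ[k] K × K),
      (∀ x, A (χ x) (χ x) = diagForm d x) →
      PosRel ((∏ i, gaussVal ψ (d i)) * (∏ i, gaussVal ψ (c i)) *
        conj (∏ i, gaussVal ψ (b i))) (-1) := by
    intro A hA hD d hd χ hχ
    obtain ⟨e, he⟩ := exists_diag_orthSum χ hχ η hη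
    have hAC := hA.orthSum hC
    obtain ⟨c₁, hc₁, h₁⟩ := exists_prod_eq_detOf h2 hAC.1 e he
    obtain ⟨c₂, hc₂, h₂⟩ := exists_prod_eq_detOf h2 hB.1 ξ hξ
    obtain ⟨c₃, hc₃, h₃⟩ := D.exists_detOf_eq h2 hFM hAC hD
    obtain ⟨c₄, hc₄, h₄⟩ := hdet
    have happ : ∀ i, Fin.append d c i ≠ 0 := fun i => by
      refine Fin.addCases (fun j => ?_) (fun j => ?_) i
      · rw [Fin.append_left]; exact hd j
      · rw [Fin.append_right]; exact hc j
    rcases diag_dichotomy hψ h2 (Fin.append d c) b happ hb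
      ⟨c₁ * c₃ / (c₂ * c₄), div_ne_zero (mul_ne_zero hc₁ hc₃) (mul_ne_zero hc₂ hc₄), by
        rw [h₁, h₂, h₃, h₄]; field_simp⟩ with ⟨Φ, hΦ⟩ | h
    · obtain ⟨f, hf⟩ := exists_isometry_of_diag h2 hB.1 hAC.1 ξ hξ e he Φ hΦ
      exact absurd (hD.of_equiv f hf) hno
    · rwa [Fin.prod_univ_add, Finset.prod_congr rfl fun i _ => by rw [Fin.append_left],
        Finset.prod_congr (f := fun i => gaussVal ψ (Fin.append d c (Fin.natAdd _ i))) rfl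
          fun i _ => by rw [Fin.append_right]] at h
  have h1 := main A₁ hA₁ hD₁ α hα φ hφ
  have h3 := main A₂ hA₂ hD₂ β hβ χ hχ
  have h4 := htwist _ α β hα hβ φ χ (fun x => by rw [← hφ, hA₁σ, one_mul])
    (fun x => by rw [← hχ, hA₂σ])
  have h5 := h1.mul h3.star
  have h6 := (h4.mul (PosRel.mul_conj_self (hne hc))).mul (PosRel.mul_conj_self (hne hb))
  refine PosRel.one_neg_one_absurd ?_
  convert h5.symm.trans ?_ using 1
  · simp
  · convert h6 using 1
    · simp only [map_mul, Complex.conj_conj]; ring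
    · simp

end LocalField

end LocalFields

/-- **Cor. 7.4.** Over a non-archimedean local field `k`, if `M` is
semi-simple with `M¹ ≠ 0` and `F_M(1)·F_M(−1) ≠ 0`, then a quadratic space `q` with
`dim q = dim_k M` has an isometry with module `M` iff `det(q) = F_M(1)·F_M(−1)` in
`k*/k*²`. -/
theorem hasIsometryWithModule_iff_det_eq_of_localField
    {k : Type} [Field k] [Valued k (WithZero (Multiplicative ℤ))] [CompleteSpace k]
    (hdisc : Function.Surjective
      (Valued.v : Valuation k (WithZero (Multiplicative ℤ))))
    (hres : Finite (Valued.ResidueField k))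
    (hchar : (2 : k) ≠ 0)
    (D : ModuleData k) (hss : D.Semisimple) (hM1 : ∃ i, D.IsIdx1 i)
    (hFM : D.charPoly.eval 1 * D.charPoly.eval (-1) ≠ 0)
    {V : Type} [AddCommGroup V] [Module k V] [FiniteDimensional k V]
    (B : LinearMap.BilinForm k V) (hq : IsQuadraticSpace B)
    (hdim : Module.finrank k V = D.dim) :
    HasIsometryWithModule B D ↔
      ∃ c : k, c ≠ 0 ∧ detOf B =
        (D.charPoly.eval 1 * D.charPoly.eval (-1)) * c ^ 2 := by
  refine ⟨D.exists_detOf_eq hchar hFM hq, ?_⟩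
  have hd := Valuation.isRankOneDiscrete_of_surjective _ hdisc
  let _ := hd.rankOne (v := (Valued.v : Valuation k (WithZero (Multiplicative ℤ)))) (e := 2)
    (by norm_num)
  let _ : NontriviallyNormedField k :=
    Valued.toNontriviallyNormedField k (WithZero (Multiplicative ℤ))
  have : IsDiscreteValuationRing (Valued.integer k) := inferInstanceAs (IsDiscreteValuationRing
    (Valued.v : Valuation k (WithZero (Multiplicative ℤ))).valuationSubring)
  have : ProperSpace k :=
    Valued.integer.properSpace_iff_completeSpace_and_isDiscreteValuationRing_integer_and_finite_residueField.2
      ⟨inferInstance, this, hres⟩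
  exact hasIsometryWithModule_of_detOf_eq hchar D hss hM1 hFM hq hdim

end
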